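/- Suppose the integral cubic form C has one of the following two shapes, where z = (y₂,…,y_h), F₁ is a nonsingular indefinite integral quadratic form of rank r ≥ 5, and the l's are integral linear forms in z: (I) C(x,y) = y₁F₁(x) + l₁(z)x₁² + l₂(z)x₁x₂ + l₃(z)x₂² + Σ_{i=1}^{m} x_i q_i(y) + R(y) with 4l₁l₃ − l₂² not identically zero and dim_ℚ span{l₁,l₂,l₃} ≠ 1; or (II) C(x,y) = y₁F₁(x) + l̃₂(z)x₁x₂ + x₁·Σ_{i=3}^{m} l̃_i(z)x_i + Σ_{i=1}^{m} x_i q_i(y) + R(y) with l̃₂ not identically zero. Assume C is irreducible over ℚ and for every prime p the equation C = 0 has a nonsingular p-adic zero. Then there exist c > 0, K > 0 and Y₀ such that for every Y ≥ Y₀ there is a finite set 𝒞_h(Y) ⊆ ℤ^h with ‖y‖_∞ ≤ K·Y for all y ∈ 𝒞_h(Y) and Σ_{y ∈ 𝒞_h(Y)} 𝔖(F_y) ≥ c·Y^h/ log Y. -/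

import Mathlib

open Matrix MvPolynomial

/-- The complete exponential sum `S_q(F) = Σ*_{a mod q} Σ_{b mod q} e(a·F(b)/q)` attached to
an integer-valued function `F` on `ℤ^m`. -/
noncomputable def expSum (m : ℕ) (F : (Fin m → ℤ) → ℤ) (q : ℕ) : ℂ :=
  ∑ a ∈ (Finset.range q).filter fun a => Nat.gcd a q = 1,
    ∑ b : Fin m → Fin q,
      Complex.exp (2 * (Real.pi : ℂ) * Complex.I * (a : ℂ) *
        ((F fun j => ((b j : ℕ) : ℤ)) : ℂ) / (q : ℂ))

/-- The singular series `𝔖(F) = Σ_{q ≥ 1} q^{-m} S_q(F)`. -/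
noncomputable def singSeries (m : ℕ) (F : (Fin m → ℤ) → ℤ) : ℂ :=
  ∑' q : ℕ, (q : ℂ) ^ (-(m : ℤ)) * expSum m F q


/-- quadratic polynomial -/
def QP {R : Type*} [CommRing R] {m : ℕ} (A : Matrix (Fin m) (Fin m) R) (b : Fin m → R) (c : R)
    (x : Fin m → R) : R := x ⬝ᵥ A *ᵥ x + b ⬝ᵥ x + c

lemma QP_map {R S : Type*} [CommRing R] [CommRing S] (f : R →+* S) {m : ℕ}
    (A : Matrix (Fin m) (Fin m) R) (b : Fin m → R) (c : R) (x : Fin m → R) :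
    f (QP A b c x) = QP (A.map f) (fun i => f (b i)) (f c) (fun i => f (x i)) := by
  simp [QP, dotProduct, mulVec, map_sum]

lemma QP_add {R : Type*} [CommRing R] {m : ℕ} (A : Matrix (Fin m) (Fin m) R) (b : Fin m → R) (c : R)
    (x v : Fin m → R) :
    QP A b c (x + v) = QP A b c x + v ⬝ᵥ ((A + Aᵀ) *ᵥ x + b) + v ⬝ᵥ A *ᵥ v := by
  have h : x ⬝ᵥ A *ᵥ v = v ⬝ᵥ Aᵀ *ᵥ x := by
    rw [dotProduct_mulVec, dotProduct_comm, mulVec_transpose]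
  simp only [QP, mulVec_add, add_mulVec, dotProduct_add, add_dotProduct]
  rw [h, dotProduct_comm b v]; ring

/-- Reduction of the quadratic polynomial mod `q`. -/
def QPZ {m : ℕ} (A : Matrix (Fin m) (Fin m) ℤ) (b : Fin m → ℤ) (c : ℤ) (q : ℕ)
    (x : Fin m → ZMod q) : ZMod q :=
  QP (A.map (Int.castRingHom (ZMod q))) (fun i => (b i : ZMod q)) (c : ZMod q) x

lemma QPZ_cast {m : ℕ} (A : Matrix (Fin m) (Fin m) ℤ) (b : Fin m → ℤ) (c : ℤ) (q : ℕ)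
    (x : Fin m → ℤ) : ((QP A b c x : ℤ) : ZMod q) = QPZ A b c q (fun i => (x i : ZMod q)) := by
  have := QP_map (Int.castRingHom (ZMod q)) A b c x
  simpa [QPZ] using this

lemma QPZ_castHom {m : ℕ} (A : Matrix (Fin m) (Fin m) ℤ) (b : Fin m → ℤ) (c : ℤ) {q d : ℕ}
    (h : d ∣ q) (x : Fin m → ZMod q) :
    ZMod.castHom h (ZMod d) (QPZ A b c q x) = QPZ A b c d (fun i => ZMod.castHom h (ZMod d) (x i)) := by
  have := QP_map (ZMod.castHom h (ZMod d)) (A.map (Int.castRingHom (ZMod q)))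
    (fun i => (b i : ZMod q)) (c : ZMod q) x
  rw [QPZ, this, QPZ]
  congr 1
  · ext i j; simp
  · ext i; simp
  · simp

/-- number of zeros mod `q` -/
noncomputable def Nsol {m : ℕ} (A : Matrix (Fin m) (Fin m) ℤ) (b : Fin m → ℤ) (c : ℤ) (q : ℕ) : ℕ :=
  Nat.card {x : Fin m → ZMod q // QPZ A b c q x = 0}

lemma expSum_eq {m : ℕ} (A : Matrix (Fin m) (Fin m) ℤ) (b : Fin m → ℤ) (c : ℤ) (q : ℕ) [NeZero q] :
    expSum m (QP A b c) q = ∑ a ∈ (Finset.range q).filter fun a => Nat.gcd a q = 1,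
      ∑ x : Fin m → ZMod q, ZMod.stdAddChar ((a : ZMod q) * QPZ A b c q x) := by
  obtain ⟨k, rfl⟩ : ∃ k, q = k + 1 := ⟨q - 1, by have := NeZero.pos q; omega⟩
  unfold expSum
  refine Finset.sum_congr rfl fun a _ => ?_
  refine Finset.sum_congr rfl fun (x : Fin m → ZMod (k+1)) _ => ?_
  have h1 : QPZ A b c (k+1) x = ((QP A b c (fun j => ((ZMod.val (x j) : ℕ) : ℤ)) : ℤ) : ZMod (k+1)) := by
    rw [QPZ_cast]
    congr 1
    ext i
    push_cast
    exact (ZMod.natCast_zmod_val (n := k+1) (x i)).symm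
  have h2 : (a : ZMod (k+1)) * QPZ A b c (k+1) x
      = ((a * QP A b c (fun j => ((ZMod.val (x j) : ℕ) : ℤ)) : ℤ) : ZMod (k+1)) := by
    rw [h1]; push_cast; rfl
  rw [h2, ZMod.stdAddChar_coe]
  congr 1
  push_cast
  rw [← mul_assoc]
  rfl

lemma sum_comp_hom {G H : Type*} [AddGroup G] [AddGroup H] [Fintype G] [Fintype H] [DecidableEq H]
    (φ : G →+ H) (hs : Function.Surjective φ) (g : H → ℂ) :
    (Fintype.card H : ℂ) * ∑ x, g (φ x) = Fintype.card G * ∑ y, g y := by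
  have key : ∀ g : H → ℂ, ∑ x, g (φ x) =
      ((Finset.univ.filter fun x => φ x = 0).card : ℂ) * ∑ y, g y := by
    intro g
    rw [← Finset.sum_fiberwise Finset.univ φ, Finset.mul_sum]
    refine Finset.sum_congr rfl fun y _ => ?_
    rw [Finset.sum_congr rfl (g := fun _ => g y)]
    · rw [Finset.sum_const, nsmul_eq_mul]
      congr 2
      exact AddMonoidHom.card_fiber_eq_of_mem_range φ (hs y) (hs 0)
    · intro x hx; rw [(Finset.mem_filter.mp hx).2]
  have h1 := key (fun _ => 1)
  simp only [Finset.sum_const, Finset.card_univ, nsmul_eq_mul, mul_one] at h1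
  rw [key g, h1]; ring

lemma sum_castHom {m : ℕ} {q d : ℕ} [NeZero q] [NeZero d] (h : d ∣ q) (g : (Fin m → ZMod d) → ℂ) :
    (d : ℂ) ^ m * ∑ x : Fin m → ZMod q, g (fun i => ZMod.castHom h (ZMod d) (x i))
      = (q : ℂ) ^ m * ∑ x, g x := by
  have := sum_comp_hom (G := Fin m → ZMod q) (H := Fin m → ZMod d)
    { toFun := fun x i => ZMod.castHom h (ZMod d) (x i)
      map_zero' := by ext; simp
      map_add' := by intro x y; ext i; exact map_add _ _ _ } (by
        intro y
        choose x hx using fun i => ZMod.castHom_surjective h (y i)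
        exact ⟨x, by ext i; exact hx i⟩) g
  simpa [ZMod.card] using this

lemma stdAddChar_reduce {q d a' e : ℕ} [NeZero q] [NeZero d] (h : q = d * e) (t : ℤ) :
    ZMod.stdAddChar (((a' * e : ℕ) : ZMod q) * (t : ZMod q)) =
      ZMod.stdAddChar ((a' : ZMod d) * (t : ZMod d)) := by
  have h1 : ((a' * e : ℕ) : ZMod q) * (t : ZMod q) = ((a' * e * t : ℤ) : ZMod q) := by push_cast; rfl
  have h2 : (a' : ZMod d) * (t : ZMod d) = ((a' * t : ℤ) : ZMod d) := by push_cast; rfl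
  rw [h1, h2, ZMod.stdAddChar_coe, ZMod.stdAddChar_coe]
  congr 1
  have hd : (d : ℂ) ≠ 0 := Nat.cast_ne_zero.mpr (NeZero.ne d)
  have he : (e : ℂ) ≠ 0 := by
    have := NeZero.ne q
    rw [h] at this
    exact_mod_cast right_ne_zero_of_mul this
  subst h
  push_cast
  field_simp

/-- `f q = q^{-m} S_q`. -/
noncomputable def ff {m : ℕ} (A : Matrix (Fin m) (Fin m) ℤ) (b : Fin m → ℤ) (c : ℤ) (q : ℕ) : ℂ :=
  (q : ℂ) ^ (-(m : ℤ)) * expSum m (QP A b c) q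

lemma sum_divisors_gcd (q : ℕ) (hq : q ≠ 0) (g : ℕ → ℕ → ℂ) :
    ∑ d ∈ q.divisors, ∑ a ∈ (Finset.range d).filter (fun a => Nat.gcd a d = 1), g d a =
    ∑ a ∈ Finset.range q, g (q / Nat.gcd a q) (a / Nat.gcd a q) := by
  rw [Finset.sum_sigma']
  refine Finset.sum_bij' (fun x _ => x.2 * (q / x.1))
    (fun a _ => ⟨q / Nat.gcd a q, a / Nat.gcd a q⟩) ?_ ?_ ?_ ?_ ?_
  · rintro ⟨d, a⟩ h
    simp only [Finset.mem_sigma, Nat.mem_divisors, Finset.mem_filter, Finset.mem_range] at h ⊢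
    obtain ⟨⟨⟨e, rfl⟩, -⟩, h2, h3⟩ := h
    have hd : 0 < d := by omega
    rw [Nat.mul_div_cancel_left _ hd]
    have he : 0 < e := Nat.pos_of_ne_zero (right_ne_zero_of_mul hq)
    exact Nat.mul_lt_mul_of_pos_right h2 he
  · intro a ha
    have hg : 0 < Nat.gcd a q := Nat.gcd_pos_of_pos_right _ (Nat.pos_of_ne_zero hq)
    simp only [Finset.mem_sigma, Nat.mem_divisors, Finset.mem_filter, Finset.mem_range] at ha ⊢
    refine ⟨⟨Nat.div_dvd_of_dvd (Nat.gcd_dvd_right a q), hq⟩, ?_, Nat.coprime_div_gcd_div_gcd hg⟩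
    exact Nat.div_lt_div_of_lt_of_dvd (Nat.gcd_dvd_right a q) ha
  · rintro ⟨d, a⟩ h
    simp only [Finset.mem_sigma, Nat.mem_divisors, Finset.mem_filter, Finset.mem_range] at h ⊢
    obtain ⟨⟨⟨e, rfl⟩, -⟩, h2, h3⟩ := h
    have hd : 0 < d := by omega
    have he : 0 < e := Nat.pos_of_ne_zero (right_ne_zero_of_mul hq)
    have : Nat.gcd (a * e) (d * e) = e := by rw [Nat.gcd_mul_right, h3, one_mul]
    rw [Nat.mul_div_cancel_left _ hd, this, Nat.mul_div_cancel _ he, Nat.mul_div_cancel _ he]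
  · intro a ha
    simp only
    have hg : 0 < Nat.gcd a q := Nat.gcd_pos_of_pos_right _ (Nat.pos_of_ne_zero hq)
    rw [Nat.div_div_self (Nat.gcd_dvd_right a q) hq, Nat.div_mul_cancel (Nat.gcd_dvd_left a q)]
  · rintro ⟨d, a⟩ h
    simp only [Finset.mem_sigma, Nat.mem_divisors, Finset.mem_filter, Finset.mem_range] at h ⊢
    obtain ⟨⟨⟨e, rfl⟩, -⟩, h2, h3⟩ := h
    have hd : 0 < d := by omega
    have he : 0 < e := Nat.pos_of_ne_zero (right_ne_zero_of_mul hq)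
    have : Nat.gcd (a * e) (d * e) = e := by rw [Nat.gcd_mul_right, h3, one_mul]
    rw [Nat.mul_div_cancel_left _ hd, this, Nat.mul_div_cancel _ he, Nat.mul_div_cancel _ he]

lemma sum_all {m : ℕ} (A : Matrix (Fin m) (Fin m) ℤ) (b : Fin m → ℤ) (c : ℤ) (q : ℕ) [NeZero q] :
    ∑ a ∈ Finset.range q, ∑ x : Fin m → ZMod q, ZMod.stdAddChar ((a : ZMod q) * QPZ A b c q x)
      = q * (Nsol A b c q : ℂ) := by
  classical
  rw [Finset.sum_comm]
  have h1 : ∀ x : Fin m → ZMod q, ∑ a ∈ Finset.range q, ZMod.stdAddChar ((a : ZMod q) * QPZ A b c q x)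
      = if QPZ A b c q x = 0 then (q : ℂ) else 0 := by
    intro x
    have : ∑ a ∈ Finset.range q, ZMod.stdAddChar ((a : ZMod q) * QPZ A b c q x) =
        ∑ a : ZMod q, ZMod.stdAddChar (a * QPZ A b c q x) := by
      refine Finset.sum_bij (fun a _ => (a : ZMod q)) (by simp) ?_ ?_ (by simp)
      · intro a ha b hb hab
        simp only [Finset.mem_range] at ha hb
        have := (ZMod.natCast_eq_natCast_iff a b q).mp hab
        rwa [Nat.ModEq, Nat.mod_eq_of_lt ha, Nat.mod_eq_of_lt hb] at this
      · intro y _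
        exact ⟨y.val, by simp [ZMod.val_lt], by simp⟩
    rw [this, AddChar.sum_mulShift _ (ZMod.isPrimitive_stdAddChar q)]
    simp [ZMod.card]
  rw [Finset.sum_congr rfl fun x _ => h1 x, ← Finset.sum_filter, Finset.sum_const, nsmul_eq_mul,
    mul_comm, Nsol, Nat.card_eq_fintype_card, Fintype.card_subtype]

lemma ff_sum_divisors {m : ℕ} (A : Matrix (Fin m) (Fin m) ℤ) (b : Fin m → ℤ) (c : ℤ) (q : ℕ)
    (hq : q ≠ 0) :
    ∑ d ∈ q.divisors, ff A b c d = (Nsol A b c q : ℂ) * q / (q : ℂ) ^ m := by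
  have : NeZero q := ⟨hq⟩
  have hqm : (q : ℂ) ^ m ≠ 0 := pow_ne_zero _ (Nat.cast_ne_zero.mpr hq)
  have h1 : ∀ d ∈ q.divisors, ff A b c d = ∑ a ∈ (Finset.range d).filter (fun a => Nat.gcd a d = 1),
      ((q : ℂ) ^ m)⁻¹ * ∑ x : Fin m → ZMod q, ZMod.stdAddChar (((a * (q / d) : ℕ) : ZMod q) * QPZ A b c q x) := by
    intro d hd
    have hdq : d ∣ q := Nat.dvd_of_mem_divisors hd
    have : NeZero d := ⟨fun h => hq (by subst h; exact Nat.eq_zero_of_zero_dvd hdq)⟩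
    have hdm : (d : ℂ) ^ m ≠ 0 := pow_ne_zero _ (Nat.cast_ne_zero.mpr (NeZero.ne d))
    rw [ff, expSum_eq, Finset.mul_sum]
    refine Finset.sum_congr rfl fun a _ => ?_
    have h2 := sum_castHom (m := m) hdq (fun x => ZMod.stdAddChar ((a : ZMod d) * QPZ A b c d x))
    have h3 : ∀ x : Fin m → ZMod q, ZMod.stdAddChar (((a * (q / d) : ℕ) : ZMod q) * QPZ A b c q x)
        = ZMod.stdAddChar ((a : ZMod d) * QPZ A b c d (fun i => ZMod.castHom hdq (ZMod d) (x i))) := by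
      intro x
      rw [← QPZ_castHom]
      obtain ⟨t, ht⟩ := ZMod.intCast_surjective (QPZ A b c q x)
      rw [← ht, stdAddChar_reduce (Nat.mul_div_cancel' hdq).symm]
      simp
    rw [Finset.sum_congr rfl fun x _ => h3 x, _root_.zpow_neg, zpow_natCast]
    field_simp
    rw [h2, mul_comm]
  rw [Finset.sum_congr rfl h1, sum_divisors_gcd q hq (fun d a => ((q : ℂ) ^ m)⁻¹ * ∑ x : Fin m → ZMod q,
    ZMod.stdAddChar (((a * (q / d) : ℕ) : ZMod q) * QPZ A b c q x)), ← Finset.mul_sum]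
  have h4 : ∀ a ∈ Finset.range q, ∑ x : Fin m → ZMod q,
    ZMod.stdAddChar (((a / Nat.gcd a q * (q / (q / Nat.gcd a q)) : ℕ) : ZMod q) * QPZ A b c q x) =
     ∑ x : Fin m → ZMod q, ZMod.stdAddChar ((a : ZMod q) * QPZ A b c q x) := by
    intro a _
    rw [Nat.div_div_self (Nat.gcd_dvd_right a q) hq, Nat.div_mul_cancel (Nat.gcd_dvd_left a q)]
  rw [Finset.sum_congr rfl h4, sum_all]
  field_simp

lemma Nsol_mul {m : ℕ} (A : Matrix (Fin m) (Fin m) ℤ) (b : Fin m → ℤ) (c : ℤ) {q r : ℕ}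
    (h : Nat.Coprime q r) : Nsol A b c (q * r) = Nsol A b c q * Nsol A b c r := by
  unfold Nsol
  rw [← Nat.card_prod]
  let e : (Fin m → ZMod (q * r)) ≃ (Fin m → ZMod q) × (Fin m → ZMod r) :=
    (Equiv.arrowCongr (Equiv.refl _) (ZMod.chineseRemainder h).toEquiv).trans
      (Equiv.arrowProdEquivProdArrow _ _ _)
  refine Nat.card_congr ((Equiv.subtypeEquiv e ?_).trans
    (Equiv.subtypeProdEquivProd (p := fun x => QPZ A b c q x = 0) (q := fun x => QPZ A b c r x = 0)))
  intro x
  have h1 : (ZMod.chineseRemainder h (QPZ A b c (q * r) x)) =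
      (QPZ A b c q (e x).1, QPZ A b c r (e x).2) := by
    have key := QP_map (ZMod.chineseRemainder h).toRingHom (A.map (Int.castRingHom (ZMod (q*r))))
      (fun i => (b i : ZMod (q*r))) (c : ZMod (q*r)) x
    have e1 := congrArg (RingHom.fst (ZMod q) (ZMod r)) key
    have e2 := congrArg (RingHom.snd (ZMod q) (ZMod r)) key
    rw [QP_map (RingHom.fst (ZMod q) (ZMod r))] at e1
    rw [QP_map (RingHom.snd (ZMod q) (ZMod r))] at e2
    apply Prod.ext
    · refine e1.trans ?_
      unfold QPZ
      congr 1
      · ext i j; simp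
      · ext i; simp
      · simp
    · refine e2.trans ?_
      unfold QPZ
      congr 1
      · ext i j; simp
      · ext i; simp
      · simp
  rw [← (ZMod.chineseRemainder h).map_eq_zero_iff, h1, Prod.mk_eq_zero]


lemma card_tors_le (q : ℕ) [NeZero q] (d : ℤ) (hd : d ≠ 0) :
    (Finset.univ.filter fun t : ZMod q => (d : ZMod q) * t = 0).card ≤ d.natAbs := by
  have hq : 0 < q := NeZero.pos q
  rw [← Finset.card_range d.natAbs]
  have hdv : ∀ t : ZMod q, (d : ZMod q) * t = 0 → q ∣ d.natAbs * t.val := by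
    intro t ht
    have h1 : ((d * (t.val : ℤ) : ℤ) : ZMod q) = 0 := by push_cast; simpa using ht
    rw [ZMod.intCast_zmod_eq_zero_iff_dvd] at h1
    have := Int.natAbs_dvd_natAbs.mpr h1
    rwa [Int.natAbs_mul, Int.natAbs_natCast, Int.natAbs_natCast] at this
  refine Finset.card_le_card_of_injOn (fun t => d.natAbs * t.val / q) ?_ ?_
  · intro t ht
    simp only [Finset.coe_range, Set.mem_Iio]
    rw [Nat.div_lt_iff_lt_mul hq]
    exact Nat.mul_lt_mul_of_pos_left (ZMod.val_lt t) (Int.natAbs_pos.mpr hd)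
  · intro s hs t ht hst
    simp only [Finset.coe_filter, Finset.mem_univ, true_and, Set.mem_ofPred_eq] at hs ht
    have h1 := Nat.div_mul_cancel (hdv s hs)
    have h2 := Nat.div_mul_cancel (hdv t ht)
    simp only at hst
    rw [hst, h2] at h1
    exact (ZMod.val_injective q (Nat.eq_of_mul_eq_mul_left (Int.natAbs_pos.mpr hd) h1)).symm

lemma card_ker_le {m : ℕ} (q : ℕ) [NeZero q] (G : Matrix (Fin m) (Fin m) ℤ) (f g : Fin 5 → Fin m)
    (d : ℤ) (hd : d ≠ 0) (hdet : (G.submatrix f g).det = d) :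
    (Finset.univ.filter fun v : Fin m → ZMod q =>
      (G.map (Int.castRingHom (ZMod q))) *ᵥ v = 0).card * q ^ 5 ≤ d.natAbs ^ 5 * q ^ m := by
  classical
  set Gq := G.map (Int.castRingHom (ZMod q)) with hGq
  set K := Finset.univ.filter fun v : Fin m → ZMod q => Gq *ᵥ v = 0 with hK
  let E : (Fin 5 → ZMod q) → (Fin m → ZMod q) := fun s i => ∑ j, if g j = i then s j else 0
  have hE : ∀ s t, E (s - t) = E s - E t := by
    intro s t; ext i
    simp only [E, Pi.sub_apply, ← Finset.sum_sub_distrib]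
    refine Finset.sum_congr rfl fun j _ => ?_
    split_ifs <;> simp
  have hGE : ∀ s k, (Gq *ᵥ E s) (f k) = ((Gq.submatrix f g) *ᵥ s) k := by
    intro s k
    simp only [mulVec, dotProduct, E, submatrix_apply, Finset.mul_sum]
    rw [Finset.sum_comm]
    refine Finset.sum_congr rfl fun j _ => ?_
    simp
  have hdet' : (Gq.submatrix f g).det = (d : ZMod q) := by
    have := (Int.castRingHom (ZMod q)).map_det (G.submatrix f g)
    rw [hdet] at this
    simp only [eq_intCast] at this
    rw [this]
    rfl
  have hker : ∀ s, Gq *ᵥ E s = 0 → ∀ j, (d : ZMod q) * s j = 0 := by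
    intro s hs j
    have h0 : (Gq.submatrix f g) *ᵥ s = 0 := by
      ext k; rw [← hGE, hs]; rfl
    have h1 := congrArg (fun v => (adjugate (Gq.submatrix f g)) *ᵥ v) h0
    simp only [mulVec_mulVec, adjugate_mul, hdet', mulVec_zero, smul_mulVec, one_mulVec] at h1
    exact congrFun h1 j
  have h1 := Finset.card_le_mul_card_image (f := fun vs : (Fin m → ZMod q) × (Fin 5 → ZMod q) =>
      vs.1 + E vs.2) (K ×ˢ (Finset.univ : Finset (Fin 5 → ZMod q))) (d.natAbs ^ 5) ?_
  · rw [Finset.card_product, Finset.card_univ, Fintype.card_pi] at h1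
    simp only [ZMod.card, Finset.prod_const, Finset.card_univ, Fintype.card_fin] at h1
    refine h1.trans (Nat.mul_le_mul_left _ ?_)
    refine (Finset.card_le_univ _).trans ?_
    simp [ZMod.card]
  · intro w hw
    obtain ⟨⟨v0, s0⟩, h0, rfl⟩ := Finset.mem_image.mp hw
    have hv0 : Gq *ᵥ v0 = 0 := by simpa [hK] using h0
    let T := Fintype.piFinset (fun _ : Fin 5 => Finset.univ.filter fun t : ZMod q => (d : ZMod q) * t = 0)
    have hT : T.card ≤ d.natAbs ^ 5 := by
      rw [Fintype.card_piFinset]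
      simp only [Finset.prod_const, Finset.card_univ, Fintype.card_fin]
      exact Nat.pow_le_pow_left (card_tors_le q d hd) 5
    refine le_trans ?_ hT
    refine Finset.card_le_card_of_injOn (fun vs => vs.2 - s0) ?_ ?_
    · rintro ⟨v, s⟩ hvs
      simp only [Finset.coe_filter, Finset.mem_product, Finset.mem_univ, and_true, Set.mem_ofPred_eq, hK,
        Finset.mem_filter, true_and] at hvs
      obtain ⟨hv, he⟩ := hvs
      simp only [T, Fintype.coe_piFinset, Set.mem_pi, Finset.coe_filter, Finset.mem_univ, true_and,
        Set.mem_ofPred_eq]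
      intro j _
      refine hker (s - s0) ?_ j
      have : E (s - s0) = v0 - v := by
        rw [hE, sub_eq_sub_iff_add_eq_add, add_comm, he]
      rw [this, mulVec_sub, hv, hv0, sub_zero]
    · rintro ⟨v, s⟩ hvs ⟨v', s'⟩ hvs' h
      simp only [Finset.coe_filter, Finset.mem_product, Finset.mem_univ, and_true, Set.mem_ofPred_eq] at hvs hvs'
      have hss : s = s' := sub_left_injective h
      subst hss
      have : v = v' := by
        have := hvs.2.trans hvs'.2.symm
        exact add_right_cancel this
      rw [this]

lemma sum_char_linear {m : ℕ} (q : ℕ) [NeZero q] (w : Fin m → ZMod q) :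
    ‖∑ y : Fin m → ZMod q, (ZMod.stdAddChar (w ⬝ᵥ y) : ℂ)‖ = if w = 0 then (q : ℝ) ^ m else 0 := by
  have h : ∑ y : Fin m → ZMod q, (ZMod.stdAddChar (w ⬝ᵥ y) : ℂ) =
      ∏ i, ∑ t : ZMod q, ZMod.stdAddChar (t * w i) := by
    rw [Finset.prod_univ_sum, Fintype.piFinset_univ]
    refine Finset.sum_congr rfl fun y _ => ?_
    have : ∀ s : Finset (Fin m), (ZMod.stdAddChar (∑ i ∈ s, w i * y i) : ℂ) =
        ∏ i ∈ s, ZMod.stdAddChar (y i * w i) := by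
      intro s
      induction s using Finset.induction_on with
      | empty => simp
      | insert a s ha ih =>
        rw [Finset.sum_insert ha, Finset.prod_insert ha, AddChar.map_add_eq_mul, ih, mul_comm (w a)]
    exact this _
  rw [h]
  simp only [AddChar.sum_mulShift _ (ZMod.isPrimitive_stdAddChar q), ZMod.card]
  split_ifs with hw
  · subst hw; simp
  · obtain ⟨i, hi⟩ := Function.ne_iff.mp hw
    rw [Finset.prod_eq_zero (Finset.mem_univ i)]
    · simp
    · simp only [Pi.zero_apply] at hi; simp [hi]

lemma weyl {m : ℕ} (A : Matrix (Fin m) (Fin m) ℤ) (b : Fin m → ℤ) (c : ℤ) (q : ℕ) [NeZero q]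
    (u : ZMod q) (hu : IsUnit u) :
    ‖∑ x : Fin m → ZMod q, (ZMod.stdAddChar (u * QPZ A b c q x) : ℂ)‖ ^ 2 ≤
      (q : ℝ) ^ m * (Finset.univ.filter fun v : Fin m → ZMod q =>
      ((A + Aᵀ).map (Int.castRingHom (ZMod q))) *ᵥ v = 0).card := by
  classical
  set S := ∑ x : Fin m → ZMod q, (ZMod.stdAddChar (u * QPZ A b c q x) : ℂ) with hS
  set Aq := A.map (Int.castRingHom (ZMod q)) with hAq
  set Gq := (A + Aᵀ).map (Int.castRingHom (ZMod q)) with hGq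
  have hG : Gq = Aq + Aqᵀ := by ext i j; simp [hGq, hAq]
  have hGs : Gqᵀ = Gq := by rw [hG]; simp [add_comm]
  have hconj : ∀ t : ZMod q, (starRingEnd ℂ) (ZMod.stdAddChar t : ℂ) = ZMod.stdAddChar (-t) := by
    intro t
    rw [AddChar.map_neg_eq_conj]
  have h1 : ((‖S‖ ^ 2 : ℝ) : ℂ) = ∑ v : Fin m → ZMod q,
      ZMod.stdAddChar (u * (v ⬝ᵥ Aq *ᵥ v + v ⬝ᵥ fun i => (b i : ZMod q))) *
        ∑ y : Fin m → ZMod q, (ZMod.stdAddChar ((u • Gq *ᵥ v) ⬝ᵥ y) : ℂ) := by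
    push_cast
    rw [← Complex.conj_mul', mul_comm, hS, map_sum, Finset.sum_mul_sum, Finset.sum_comm]
    simp only [Finset.mul_sum]
    rw [Finset.sum_comm]
    conv_rhs => rw [Finset.sum_comm]
    rw [Finset.sum_comm]
    refine Finset.sum_congr rfl fun y _ => ?_
    rw [← Equiv.sum_comp (Equiv.addLeft y)]
    refine Finset.sum_congr rfl fun v _ => ?_
    rw [hconj, ← AddChar.map_add_eq_mul, ← AddChar.map_add_eq_mul]
    congr 1
    simp only [Equiv.coe_addLeft]
    rw [QPZ, QPZ, QP_add, ← hAq, ← hG]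
    have h2 : v ⬝ᵥ Gq *ᵥ y = (Gq *ᵥ v) ⬝ᵥ y := by
      rw [dotProduct_mulVec, ← mulVec_transpose, hGs]
    rw [dotProduct_add, h2, smul_dotProduct, smul_eq_mul]
    ring
  have h2 : ‖S‖ ^ 2 = ‖((‖S‖ ^ 2 : ℝ) : ℂ)‖ := by
    rw [Complex.norm_real, Real.norm_of_nonneg (by positivity)]
  rw [h2, h1]
  refine (norm_sum_le _ _).trans ?_
  have h3 : ∀ v : Fin m → ZMod q, ‖ZMod.stdAddChar (u * (v ⬝ᵥ Aq *ᵥ v + v ⬝ᵥ fun i => (b i : ZMod q))) *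
        ∑ y : Fin m → ZMod q, (ZMod.stdAddChar ((u • Gq *ᵥ v) ⬝ᵥ y) : ℂ)‖ =
        if Gq *ᵥ v = 0 then (q : ℝ) ^ m else 0 := by
    intro v
    rw [norm_mul, sum_char_linear, ZMod.stdAddChar_apply, Circle.norm_coe, one_mul]
    congr 1
    rw [eq_iff_iff]
    obtain ⟨u, rfl⟩ := hu
    exact smul_eq_zero_iff_eq u
  rw [Finset.sum_congr rfl fun v _ => h3 v, ← Finset.sum_filter, Finset.sum_const, nsmul_eq_mul, mul_comm]


lemma ff_zero {m : ℕ} (A : Matrix (Fin m) (Fin m) ℤ) (b : Fin m → ℤ) (c : ℤ) : ff A b c 0 = 0 := by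
  simp [ff, expSum]

lemma ff_bound {m : ℕ} (A : Matrix (Fin m) (Fin m) ℤ) (b : Fin m → ℤ) (c : ℤ)
    (f g : Fin 5 → Fin m) (d : ℤ) (hd : d ≠ 0) (hdet : ((A + Aᵀ).submatrix f g).det = d) (q : ℕ)
    (hq : q ≠ 0) :
    ‖ff A b c q‖ ≤ √((d.natAbs : ℝ) ^ 5) * (1 / (q : ℝ) ^ (3 / 2 : ℝ)) := by
  have : NeZero q := ⟨hq⟩
  have hq0 : (0 : ℝ) < q := Nat.cast_pos.mpr (Nat.pos_of_ne_zero hq)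
  set K := √((d.natAbs : ℝ) ^ 5) with hK
  have h1 : ∀ a ∈ (Finset.range q).filter (fun a => Nat.gcd a q = 1),
      ‖∑ x : Fin m → ZMod q, (ZMod.stdAddChar ((a : ZMod q) * QPZ A b c q x) : ℂ)‖
        ≤ K * (q : ℝ) ^ m / (q : ℝ) ^ (5 / 2 : ℝ) := by
    intro a ha
    have hu : IsUnit (a : ZMod q) := (ZMod.isUnit_iff_coprime a q).mpr (Finset.mem_filter.mp ha).2
    have hw := weyl A b c q a hu
    have hk := card_ker_le q (A + Aᵀ) f g d hd hdet
    set k := (Finset.univ.filter fun v : Fin m → ZMod q =>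
      ((A + Aᵀ).map (Int.castRingHom (ZMod q))) *ᵥ v = 0).card
    have hk' : (k : ℝ) * q ^ 5 ≤ (d.natAbs : ℝ) ^ 5 * q ^ m := by exact_mod_cast hk
    refine abs_le_of_sq_le_sq' ?_ (by positivity) |>.2
    refine hw.trans ?_
    have e1 : ((q : ℝ) ^ (5 / 2 : ℝ)) ^ 2 = q ^ 5 := by
      rw [← Real.rpow_natCast, ← Real.rpow_mul hq0.le]
      norm_num
    rw [div_pow, mul_pow, e1, hK, Real.sq_sqrt (by positivity), le_div_iff₀ (by positivity)]
    calc (q : ℝ) ^ m * k * q ^ 5 = q ^ m * (k * q ^ 5) := by ring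
      _ ≤ q ^ m * ((d.natAbs : ℝ) ^ 5 * q ^ m) := by gcongr
      _ = _ := by ring
  have h2 : ‖expSum m (QP A b c) q‖ ≤ q * (K * (q : ℝ) ^ m / (q : ℝ) ^ (5 / 2 : ℝ)) := by
    rw [expSum_eq]
    refine (norm_sum_le_of_le _ h1).trans ?_
    rw [Finset.sum_const, nsmul_eq_mul]
    gcongr
    exact (Finset.card_filter_le _ _).trans (by simp)
  rw [ff, norm_mul, norm_zpow, Complex.norm_natCast, _root_.zpow_neg, zpow_natCast]
  calc ((q : ℝ) ^ m)⁻¹ * ‖expSum m (QP A b c) q‖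
      ≤ ((q : ℝ) ^ m)⁻¹ * (q * (K * (q : ℝ) ^ m / (q : ℝ) ^ (5 / 2 : ℝ))) := by gcongr
    _ = _ := by
      have e2 : (q : ℝ) ^ (5 / 2 : ℝ) = q * (q : ℝ) ^ (3 / 2 : ℝ) := by
        rw [show (5 / 2 : ℝ) = 1 + 3 / 2 by norm_num, Real.rpow_add hq0, Real.rpow_one]
      rw [e2]
      field_simp

lemma ff_summable {m : ℕ} (A : Matrix (Fin m) (Fin m) ℤ) (b : Fin m → ℤ) (c : ℤ)
    (f g : Fin 5 → Fin m) (hdet : ((A + Aᵀ).submatrix f g).det ≠ 0) :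
    Summable (fun q => ‖ff A b c q‖) := by
  refine Summable.of_nonneg_of_le (fun _ => norm_nonneg _) (fun q => ?_)
    ((Real.summable_one_div_nat_rpow (p := 3 / 2)).mpr (by norm_num) |>.mul_left
      (√((((A + Aᵀ).submatrix f g).det.natAbs : ℝ) ^ 5)))
  by_cases hq : q = 0
  · subst hq; rw [ff_zero, norm_zero]; positivity
  · exact ff_bound A b c f g _ hdet rfl q hq

/-- normalised number of solutions -/
noncomputable def rho {m : ℕ} (A : Matrix (Fin m) (Fin m) ℤ) (b : Fin m → ℤ) (c : ℤ) (q : ℕ) : ℝ :=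
  (Nsol A b c q : ℝ) * q / (q : ℝ) ^ m

lemma ff_one {m : ℕ} (A : Matrix (Fin m) (Fin m) ℤ) (b : Fin m → ℤ) (c : ℤ) : ff A b c 1 = 1 := by
  have h := ff_sum_divisors A b c 1 one_ne_zero
  have : Nsol A b c 1 = 1 := by
    unfold Nsol
    rw [Nat.card_eq_one_iff_unique]
    refine ⟨⟨fun a b => Subtype.ext (Subsingleton.elim _ _)⟩, ⟨⟨0, Subsingleton.elim _ _⟩⟩⟩
  simpa [this] using h

open ArithmeticFunction in
lemma ff_mul {m : ℕ} (A : Matrix (Fin m) (Fin m) ℤ) (b : Fin m → ℤ) (c : ℤ) {q r : ℕ}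
    (h : Nat.Coprime q r) : ff A b c (q * r) = ff A b c q * ff A b c r := by
  let F : ArithmeticFunction ℂ := ⟨ff A b c, ff_zero A b c⟩
  let P : ArithmeticFunction ℂ := ⟨fun q => if q = 0 then 0 else (Nsol A b c q : ℂ) * q / (q : ℂ) ^ m, by simp⟩
  have hP : P.IsMultiplicative := by
    rw [IsMultiplicative.iff_ne_zero]
    constructor
    · have h := ff_sum_divisors A b c 1 one_ne_zero
      simp only [Nat.divisors_one, Finset.sum_singleton, ff_one] at h
      simpa [P] using h.symm
    · intro q r hq hr hqr
      simp only [P, coe_mk, hq, hr, mul_eq_zero, or_self, if_false]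
      rw [Nsol_mul A b c hqr]
      push_cast
      rw [mul_pow]
      have : (q : ℂ) ≠ 0 := by exact_mod_cast hq
      have : (r : ℂ) ≠ 0 := by exact_mod_cast hr
      field_simp
  have h1 : ((ArithmeticFunction.zeta : ArithmeticFunction ℕ) : ArithmeticFunction ℂ) * F = P := by
    ext q
    rw [coe_zeta_mul_apply]
    by_cases hq : q = 0
    · subst hq; simp
    · simp only [P, F, coe_mk, hq, if_false]
      exact ff_sum_divisors A b c q hq
  have h2 : F = ((ArithmeticFunction.moebius : ArithmeticFunction ℤ) : ArithmeticFunction ℂ) * P := by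
    rw [← h1, ← mul_assoc, coe_moebius_mul_coe_zeta, one_mul]
  have h3 : F.IsMultiplicative := by
    rw [h2]; exact isMultiplicative_moebius.intCast.mul hP
  exact h3.map_mul_of_coprime h

lemma ff_sum_pow {m : ℕ} (A : Matrix (Fin m) (Fin m) ℤ) (b : Fin m → ℤ) (c : ℤ) (p N : ℕ)
    (hp : p.Prime) : ∑ e ∈ Finset.range (N + 1), ff A b c (p ^ e) = (rho A b c (p ^ N) : ℂ) := by
  have h := ff_sum_divisors A b c (p ^ N) (pow_ne_zero _ hp.ne_zero)
  rw [Nat.divisors_prime_pow hp, Finset.sum_map] at h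
  simp only [Function.Embedding.coeFn_mk] at h
  rw [h, rho]
  push_cast
  rfl

open Filter Topology in
theorem singSeries_ge {m : ℕ} (A : Matrix (Fin m) (Fin m) ℤ) (b : Fin m → ℤ) (c : ℤ)
    (f g : Fin 5 → Fin m) (hdet : ((A + Aᵀ).submatrix f g).det ≠ 0)
    (L : ℕ → ℝ) (hL0 : ∀ p, p.Prime → 0 ≤ L p)
    (hL : ∀ p, p.Prime → ∀ᶠ N in atTop, L p ≤ rho A b c (p ^ N)) (c0 : ℝ)
    (hc : ∀ n, c0 ≤ ∏ p ∈ Nat.primesBelow n, L p) :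
    c0 ≤ (singSeries m (QP A b c)).re := by
  have hsum := ff_summable A b c f g hdet
  have hE := EulerProduct.eulerProduct (f := ff A b c) (ff_one A b c) (fun h => ff_mul A b c h)
    hsum (ff_zero A b c)
  have hσ : ∀ p, p.Prime → ∃ s : ℝ, L p ≤ s ∧ ∑' e, ff A b c (p ^ e) = (s : ℂ) := by
    intro p hp
    have hs : Summable fun e => ff A b c (p ^ e) :=
      hsum.of_norm.comp_injective (Nat.pow_right_injective hp.two_le)
    have ht := (hs.hasSum.tendsto_sum_nat.comp (tendsto_add_atTop_nat 1))
    have ht' : Tendsto (fun N => (rho A b c (p ^ N) : ℂ)) atTop (𝓝 (∑' e, ff A b c (p ^ e))) := by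
      refine ht.congr fun N => ?_
      exact ff_sum_pow A b c p N hp
    have hre : Tendsto (fun N => rho A b c (p ^ N)) atTop (𝓝 (∑' e, ff A b c (p ^ e)).re) := by
      have := (Complex.continuous_re.tendsto _).comp ht'
      simpa [Function.comp_def] using this
    have him : Tendsto (fun _ : ℕ => (0 : ℝ)) atTop (𝓝 (∑' e, ff A b c (p ^ e)).im) := by
      have := (Complex.continuous_im.tendsto _).comp ht'
      simpa [Function.comp_def] using this
    refine ⟨(∑' e, ff A b c (p ^ e)).re, ge_of_tendsto hre (hL p hp), ?_⟩
    have := tendsto_nhds_unique him tendsto_const_nhds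
    apply Complex.ext <;> simp [this]
  choose! s hs1 hs2 using hσ
  have hE' : Tendsto (fun n => ∏ p ∈ Nat.primesBelow n, s p) atTop (𝓝 (∑' n, ff A b c n).re) := by
    have := (Complex.continuous_re.tendsto _).comp hE
    refine this.congr fun n => ?_
    have : ∏ p ∈ Nat.primesBelow n, ∑' e, ff A b c (p ^ e) = ((∏ p ∈ Nat.primesBelow n, s p : ℝ) : ℂ) := by
      push_cast
      exact Finset.prod_congr rfl fun p hp => hs2 p (Nat.prime_of_mem_primesBelow hp)
    simp only [Function.comp_apply, this, Complex.ofReal_re]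
  refine ge_of_tendsto hE' (Eventually.of_forall fun n => (hc n).trans ?_)
  exact Finset.prod_le_prod (fun p hp => hL0 p (Nat.prime_of_mem_primesBelow hp))
    (fun p hp => hs1 p (Nat.prime_of_mem_primesBelow hp))


lemma quad_hensel {p : ℕ} [Fact p.Prime] (c0 c1 c2 : ℤ_[p]) (h : ‖c0‖ < ‖c1‖ ^ 2) :
    ∃ z : ℤ_[p], c0 + z * c1 + z * c2 * z = 0 ∧ ‖z‖ < 1 := by
  let F : Polynomial ℤ_[p] := Polynomial.C c0 + Polynomial.C c1 * Polynomial.X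
    + Polynomial.C c2 * Polynomial.X ^ 2
  have hF : ∀ z, F.aeval z = c0 + c1 * z + c2 * z ^ 2 := by intro z; simp [F]
  have hF' : ∀ z, F.derivative.aeval z = c1 + c2 * (2 * z) := by
    intro z; simp [F]; left; left; norm_num
  obtain ⟨z, h1, h2, -⟩ := hensels_lemma (F := F) (a := (0 : ℤ_[p])) (by rw [hF, hF']; simpa using h)
  rw [hF] at h1
  refine ⟨z, by rw [← h1]; ring, ?_⟩
  rw [sub_zero] at h2
  exact h2.trans_le (PadicInt.norm_le_one _)

lemma hensel_count {m : ℕ} (A : Matrix (Fin m) (Fin m) ℤ) (b : Fin m → ℤ) (c : ℤ) (p : ℕ)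
    (hp : p.Prime) (x₀ : Fin m → ℤ) (i : Fin m) (v N : ℕ) (hN : 2 * v + 1 ≤ N)
    (h0 : ((p : ℤ) ^ (2 * v + 1)) ∣ QP A b c x₀)
    (h1 : ¬ ((p : ℤ) ^ (v + 1)) ∣ ((A + Aᵀ) *ᵥ x₀ + b) i) :
    p ^ ((N - (2 * v + 1)) * (m - 1)) ≤
      Nat.card {x : Fin m → ZMod (p ^ N) // QPZ A b c (p ^ N) x = 0 ∧
        ∀ j, ZMod.castHom (dvd_pow_self p (by omega : N ≠ 0)) (ZMod p) (x j) = (x₀ j : ZMod p)} := by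
  classical
  have : Fact p.Prime := ⟨hp⟩
  have : NeZero (p ^ N) := ⟨pow_ne_zero _ hp.ne_zero⟩
  set k := 2 * v + 1 with hk
  have hp1 : (1 : ℝ) < p := by exact_mod_cast hp.one_lt
  -- existence of lifts
  have key : ∀ w : Fin m → ℤ, ∃ z : ℤ_[p], ‖z‖ < 1 ∧
      QP (A.map (Int.castRingHom ℤ_[p])) (fun j => (b j : ℤ_[p])) (c : ℤ_[p])
        ((fun j => ((x₀ j + p ^ k * w j : ℤ) : ℤ_[p])) + Pi.single i z) = 0 := by
    intro w
    set u : Fin m → ℤ := x₀ + (fun j => (p : ℤ) ^ k * w j) with hu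
    have hu' : u = x₀ + ((p : ℤ) ^ k) • w := by ext j; simp [hu]
    have e0 : ((p : ℤ) ^ k) ∣ QP A b c u := by
      rw [hu', QP_add, smul_dotProduct, smul_dotProduct]
      exact dvd_add (dvd_add h0 (Dvd.intro _ rfl)) (Dvd.intro _ rfl)
    have e1 : ¬ ((p : ℤ) ^ (v + 1)) ∣ ((A + Aᵀ) *ᵥ u + b) i := by
      intro hd
      apply h1
      have : ((A + Aᵀ) *ᵥ u + b) i = ((A + Aᵀ) *ᵥ x₀ + b) i + (p : ℤ) ^ k * ((A + Aᵀ) *ᵥ w) i := by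
        rw [hu', mulVec_add, mulVec_smul]; simp; ring
      rw [this] at hd
      refine (Int.dvd_add_left ?_).mp hd
      exact Dvd.dvd.mul_right (pow_dvd_pow _ (by omega)) _
    set c0 : ℤ := QP A b c u
    set c1 : ℤ := ((A + Aᵀ) *ᵥ u + b) i
    have n0 : ‖(c0 : ℤ_[p])‖ ≤ (p : ℝ) ^ (-(k : ℕ) : ℤ) := PadicInt.norm_int_le_pow_iff_dvd.mpr e0
    have n1 : (p : ℝ) ^ (-(v : ℕ) : ℤ) ≤ ‖(c1 : ℤ_[p])‖ := by
      by_contra hlt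
      push Not at hlt
      apply e1
      apply (PadicInt.norm_int_le_pow_iff_dvd (p := p)).mp
      rw [PadicInt.norm_le_pow_iff_norm_lt_pow_add_one]
      have e : (-((v + 1 : ℕ) : ℤ) + 1) = -(v : ℤ) := by push_cast; ring
      rw [e]; exact hlt
    obtain ⟨z, hz1, hz2⟩ := quad_hensel (c0 : ℤ_[p]) c1 (A i i : ℤ) (by
      refine n0.trans_lt (lt_of_lt_of_le ?_ (pow_le_pow_left₀ (by positivity) n1 2))
      rw [← zpow_natCast, ← _root_.zpow_mul]
      apply zpow_lt_zpow_right₀ hp1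
      rw [hk]; push_cast; linarith)
    refine ⟨z, hz2, ?_⟩
    rw [QP_add]
    have a0 := QP_map (Int.castRingHom ℤ_[p]) A b c u
    have a1 : ((A.map (Int.castRingHom ℤ_[p]) + (A.map (Int.castRingHom ℤ_[p]))ᵀ) *ᵥ
      (fun j => ((x₀ j + p ^ k * w j : ℤ) : ℤ_[p])) + fun j => (b j : ℤ_[p])) i = (c1 : ℤ_[p]) := by
      simp only [c1, hu, Pi.add_apply, mulVec, dotProduct, Matrix.add_apply, transpose_apply, Matrix.map_apply, eq_intCast]
      push_cast
      rfl
    rw [single_dotProduct, single_dotProduct, a1]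
    rw [mulVec_single]
    simp only [eq_intCast] at a0
    rw [← hz1]
    congr 1
    · congr 1
      rw [a0]; rfl
    · simp; ring
  choose Z hZ1 hZ2 using key
  -- the injection
  let W : Type := {j : Fin m // j ≠ i} → Fin (p ^ (N - k))
  have hWc : Nat.card W = p ^ ((N - k) * (m - 1)) := by
    rw [Nat.card_eq_fintype_card, Fintype.card_fun, Fintype.card_fin, ← pow_mul]
    congr 2
    rw [Fintype.card_subtype_compl, Fintype.card_fin]; simp
  rw [← hWc]
  let ext : W → Fin m → ℤ := fun w j => if h : j ≠ i then ((w ⟨j, h⟩ : ℕ) : ℤ) else 0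
  let X : W → Fin m → ℤ_[p] := fun w =>
    (fun j => ((x₀ j + p ^ k * ext w j : ℤ) : ℤ_[p])) + Pi.single i (Z (ext w))
  refine Nat.card_le_card_of_injective (fun w : W => ⟨fun j => PadicInt.toZModPow N (X w j), ?_, ?_⟩) ?_
  · have := QP_map (PadicInt.toZModPow N : ℤ_[p] →+* ZMod (p ^ N)) (A.map (Int.castRingHom ℤ_[p]))
      (fun j => (b j : ℤ_[p])) (c : ℤ_[p]) (X w)
    rw [hZ2 (ext w), map_zero] at this
    rw [QPZ, this]
    congr 1
    · ext; simp
    · ext; simp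
    · simp
  · intro j
    have hpN : (p : ℕ) ^ 1 ∣ p ^ N := pow_dvd_pow _ (by omega)
    have hX : ∃ t : ℤ_[p], X w j = (x₀ j : ℤ_[p]) + p * t := by
      obtain ⟨t, ht⟩ := (PadicInt.norm_lt_one_iff_dvd _).mp (hZ1 (ext w))
      by_cases hj : j = i
      · subst hj
        refine ⟨p ^ (2 * v) * ext w j + t, ?_⟩
        simp only [X, Pi.add_apply, Pi.single_eq_same, hk]; push_cast; rw [ht]; ring
      · refine ⟨p ^ (2 * v) * ext w j, ?_⟩
        simp only [X, Pi.add_apply, Pi.single_eq_of_ne hj, hk]; push_cast; ring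
    obtain ⟨t, ht⟩ := hX
    simp only [ht, map_add, map_mul, map_intCast, map_natCast]
    simp only [CharP.cast_eq_zero, zero_mul, add_zero]
  · intro w w' hww
    have h' : ∀ j, PadicInt.toZModPow N (X w j) = PadicInt.toZModPow N (X w' j) := fun j =>
      congrFun (congrArg Subtype.val hww) j
    funext ⟨j, hj⟩
    have := h' j
    simp only [X, Pi.add_apply, Pi.single_eq_of_ne hj, add_zero, map_intCast, ext, dif_pos hj] at this
    rw [ZMod.intCast_eq_intCast_iff_dvd_sub] at this
    have e : (x₀ j + p ^ k * ((w' ⟨j, hj⟩ : ℕ) : ℤ)) - (x₀ j + p ^ k * ((w ⟨j, hj⟩ : ℕ) : ℤ)) =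
      p ^ k * (((w' ⟨j, hj⟩ : ℕ) : ℤ) - ((w ⟨j, hj⟩ : ℕ) : ℤ)) := by ring
    rw [e, show p ^ N = p ^ k * p ^ (N - k) by rw [← pow_add]; congr 1; omega] at this
    push_cast at this
    have := Int.dvd_of_mul_dvd_mul_left (by exact_mod_cast pow_ne_zero _ hp.ne_zero) this
    have l1 := (w ⟨j, hj⟩).2
    have l2 := (w' ⟨j, hj⟩).2
    ext
    have := Int.eq_zero_of_abs_lt_dvd this (by
      rw [abs_lt]; constructor <;> push_cast <;> zify at l1 l2 <;> omega)
    omega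

lemma rho_ge_pow {m : ℕ} (hm : 1 ≤ m) (A : Matrix (Fin m) (Fin m) ℤ) (b : Fin m → ℤ) (c : ℤ) (p : ℕ)
    (hp : p.Prime) (x₀ : Fin m → ℤ) (i : Fin m) (v N : ℕ) (hN : 2 * v + 1 ≤ N)
    (h0 : ((p : ℤ) ^ (2 * v + 1)) ∣ QP A b c x₀)
    (h1 : ¬ ((p : ℤ) ^ (v + 1)) ∣ ((A + Aᵀ) *ᵥ x₀ + b) i) :
    1 / (p : ℝ) ^ ((2 * v + 1) * (m - 1)) ≤ rho A b c (p ^ N) := by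
  have : NeZero (p ^ N) := ⟨pow_ne_zero _ hp.ne_zero⟩
  have h := hensel_count A b c p hp x₀ i v N hN h0 h1
  have h2 : p ^ ((N - (2 * v + 1)) * (m - 1)) ≤ Nsol A b c (p ^ N) := by
    refine h.trans ?_
    unfold Nsol
    exact Nat.card_le_card_of_injective (fun x => ⟨x.1, x.2.1⟩) (fun x y hxy =>
      Subtype.ext (Subtype.mk.inj hxy))
  have hp0 : (0 : ℝ) < p := by exact_mod_cast hp.pos
  unfold rho
  have hpm : (0 : ℝ) < ((p ^ N : ℕ) : ℝ) ^ m := by push_cast; positivity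
  rw [div_le_div_iff₀ (by positivity) hpm]
  have h3 : (p : ℝ) ^ ((N - (2 * v + 1)) * (m - 1)) ≤ Nsol A b c (p ^ N) := by exact_mod_cast h2
  push_cast
  calc 1 * ((p : ℝ) ^ N) ^ m = (p : ℝ) ^ ((N - (2 * v + 1)) * (m - 1)) * p ^ N * p ^ ((2 * v + 1) * (m - 1)) := by
        rw [one_mul, ← pow_mul, ← pow_add, ← pow_add]
        congr 1
        obtain ⟨k, rfl⟩ : ∃ k, m = k + 1 := ⟨m - 1, by omega⟩
        obtain ⟨M, rfl⟩ : ∃ M, N = M + (2 * v + 1) := ⟨N - (2 * v + 1), by omega⟩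
        simp; ring
    _ ≤ _ := by gcongr

lemma rho_ge_nonsing {m : ℕ} (hm : 1 ≤ m) (A : Matrix (Fin m) (Fin m) ℤ) (b : Fin m → ℤ) (c : ℤ) (p : ℕ)
    (hp : p.Prime) (N : ℕ) (hN : 1 ≤ N) (S : Finset (Fin m → ZMod p))
    (hS : ∀ x ∈ S, QPZ A b c p x = 0 ∧
      ((A + Aᵀ).map (Int.castRingHom (ZMod p))) *ᵥ x + (fun i => (b i : ZMod p)) ≠ 0) :
    (S.card : ℝ) / (p : ℝ) ^ (m - 1) ≤ rho A b c (p ^ N) := by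
  classical
  have : NeZero (p ^ N) := ⟨pow_ne_zero _ hp.ne_zero⟩
  have : NeZero p := ⟨hp.ne_zero⟩
  have hdp := dvd_pow_self p (by omega : N ≠ 0)
  let π : (Fin m → ZMod (p ^ N)) → (Fin m → ZMod p) := fun x j => ZMod.castHom hdp (ZMod p) (x j)
  have h1 : ∀ s ∈ S, p ^ ((N - 1) * (m - 1)) ≤
      (Finset.univ.filter fun x : Fin m → ZMod (p ^ N) => QPZ A b c (p ^ N) x = 0 ∧ π x = s).card := by
    intro s hs
    obtain ⟨hs1, hs2⟩ := hS s hs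
    obtain ⟨i, hi⟩ := Function.ne_iff.mp hs2
    let x₀ : Fin m → ℤ := fun j => ((s j).val : ℤ)
    have hx₀ : (fun j => (x₀ j : ZMod p)) = s := by ext j; simp [x₀]
    have := hensel_count A b c p hp x₀ i 0 N (by omega)
      (by rw [show 2 * 0 + 1 = 1 from rfl, pow_one, ← ZMod.intCast_zmod_eq_zero_iff_dvd, QPZ_cast, hx₀, hs1])
      (by
        rw [zero_add, pow_one, ← ZMod.intCast_zmod_eq_zero_iff_dvd]
        intro h
        apply hi
        rw [← hx₀, Pi.zero_apply, ← h]
        simp [mulVec, dotProduct])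
    refine this.trans (le_of_eq ?_)
    rw [Nat.card_eq_fintype_card, Fintype.card_subtype]
    congr 1
    ext x
    simp only [Finset.mem_filter, Finset.mem_univ, true_and, π, _root_.funext_iff, x₀]
    simp
  have h2 : S.card * p ^ ((N - 1) * (m - 1)) ≤ Nsol A b c (p ^ N) := by
    unfold Nsol
    rw [Nat.card_eq_fintype_card, Fintype.card_subtype]
    rw [← smul_eq_mul, ← Finset.sum_const]
    refine (Finset.sum_le_sum h1).trans ?_
    rw [← Finset.card_biUnion]
    · apply Finset.card_le_card
      intro x hx
      simp only [Finset.mem_biUnion, Finset.mem_filter, Finset.mem_univ, true_and] at hx ⊢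
      obtain ⟨s, -, h, -⟩ := hx
      exact h
    · intro s _ t _ hst
      rw [Function.onFun, Finset.disjoint_left]
      intro x hx hx'
      simp only [Finset.mem_filter, Finset.mem_univ, true_and] at hx hx'
      exact hst (hx.2.symm.trans hx'.2)
  have hp0 : (0 : ℝ) < p := by exact_mod_cast hp.pos
  unfold rho
  have hpm : (0 : ℝ) < ((p ^ N : ℕ) : ℝ) ^ m := by push_cast; positivity
  rw [div_le_div_iff₀ (by positivity) hpm]
  have h3 : (S.card : ℝ) * (p : ℝ) ^ ((N - 1) * (m - 1)) ≤ Nsol A b c (p ^ N) := by exact_mod_cast h2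
  push_cast
  calc (S.card : ℝ) * ((p : ℝ) ^ N) ^ m
      = (S.card : ℝ) * (p : ℝ) ^ ((N - 1) * (m - 1)) * p ^ N * p ^ (m - 1) := by
        rw [mul_assoc, mul_assoc, ← pow_mul, ← pow_add, ← pow_add]
        congr 2
        obtain ⟨k, rfl⟩ : ∃ k, m = k + 1 := ⟨m - 1, by omega⟩
        obtain ⟨M, rfl⟩ : ∃ M, N = M + 1 := ⟨N - 1, by omega⟩
        simp; ring
    _ ≤ _ := by gcongr


lemma fiber_count {K : Type*} [Field K] [Fintype K] [DecidableEq K] {d m : ℕ}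
    (M : Matrix (Fin d) (Fin m) K) (hM : LinearIndependent K M.row) (w : Fin d → K) :
    (Finset.univ.filter fun x => M *ᵥ x = w).card * Fintype.card K ^ d = Fintype.card K ^ m := by
  have hr : M.rank = d := by simpa using hM.rank_matrix
  have hs : Function.Surjective M.mulVecLin := by
    rw [← LinearMap.range_eq_top]
    apply Submodule.eq_top_of_finrank_eq
    rw [Module.finrank_fin_fun]
    exact hr
  have h1 : ∀ y, (Finset.univ.filter fun x => M.mulVecLin x = y).card =
      (Finset.univ.filter fun x => M.mulVecLin x = w).card := fun y =>
    AddMonoidHom.card_fiber_eq_of_mem_range M.mulVecLin (hs y) (hs w)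
  have h2 := Finset.card_eq_sum_card_fiberwise (f := M.mulVecLin) (s := Finset.univ)
    (t := Finset.univ) (fun _ _ => by simp)
  simp only [h1, Finset.sum_const, smul_eq_mul, Finset.card_univ, Fintype.card_fun, Fintype.card_fin] at h2
  rw [h2, mul_comm]
  rfl

lemma flow_count {K : Type*} [Field K] [Fintype K] [DecidableEq K] {m : ℕ}
    (A : Matrix (Fin m) (Fin m) K) (b : Fin m → K) (c : K) (T : Finset (Fin m → K)) (e : Fin m → K)
    (he : e ⬝ᵥ A *ᵥ e = 0) (hinv : ∀ x ∈ T, ∀ s : K, x + s • e ∈ T)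
    (hφ : ∀ x ∈ T, e ⬝ᵥ ((A + Aᵀ) *ᵥ x + b) ≠ 0) :
    T.card ≤ (T.filter fun x => QP A b c x = 0).card * Fintype.card K := by
  rw [← Finset.card_univ, ← Finset.card_product]
  let s : (Fin m → K) → K := fun x => - QP A b c x / (e ⬝ᵥ ((A + Aᵀ) *ᵥ x + b))
  refine Finset.card_le_card_of_injOn (fun x => (x + s x • e, s x)) ?_ ?_
  · intro x hx
    have hx' : x ∈ T := hx
    simp only [Finset.coe_product, Set.mem_prod, Finset.mem_coe, Finset.mem_filter, Finset.mem_univ, and_true]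
    refine ⟨hinv x hx' _, ?_⟩
    rw [QP_add, mulVec_smul, smul_dotProduct, smul_dotProduct, dotProduct_smul, he]
    have := hφ x hx'
    simp only [smul_eq_mul, mul_zero, add_zero, s]
    field_simp
    ring
  · intro x _ y _ hxy
    simp only [Prod.mk.injEq] at hxy
    obtain ⟨h1, h2⟩ := hxy
    rw [h2] at h1
    exact add_right_cancel h1

lemma dot_symm {K : Type*} [CommRing K] {m : ℕ} (A : Matrix (Fin m) (Fin m) K) (e x : Fin m → K) :
    e ⬝ᵥ ((A + Aᵀ) *ᵥ x) = ((A + Aᵀ) *ᵥ e) ⬝ᵥ x := by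
  rw [dotProduct_mulVec, ← mulVec_transpose]; simp [add_comm]

lemma dot_self {K : Type*} [CommRing K] {m : ℕ} (A : Matrix (Fin m) (Fin m) K) (e : Fin m → K) :
    e ⬝ᵥ ((A + Aᵀ) *ᵥ e) = 2 * (e ⬝ᵥ A *ᵥ e) := by
  rw [add_mulVec, dotProduct_add, mulVec_transpose, dotProduct_comm e (e ᵥ* A), ← dotProduct_mulVec]; ring

lemma iso1_count {K : Type*} [Field K] [Fintype K] [DecidableEq K] {m : ℕ}
    (A : Matrix (Fin m) (Fin m) K) (b : Fin m → K) (c : K) (e : Fin m → K)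
    (he : e ⬝ᵥ A *ᵥ e = 0) (hG : (A + Aᵀ) *ᵥ e ≠ 0) :
    (Fintype.card K : ℝ) ^ m * (1 - 1 / Fintype.card K) ≤
      (Finset.univ.filter fun x => QP A b c x = 0 ∧ (A + Aᵀ) *ᵥ x + b ≠ 0).card * Fintype.card K := by
  set κ := Fintype.card K
  have hκ : (0 : ℝ) < κ := by exact_mod_cast Fintype.card_pos
  let φ : (Fin m → K) → K := fun x => e ⬝ᵥ ((A + Aᵀ) *ᵥ x + b)
  let T := Finset.univ.filter fun x => φ x ≠ 0
  have h1 := flow_count A b c T e he (by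
      intro x hx s
      simp only [T, φ, Finset.mem_filter, Finset.mem_univ, true_and] at hx ⊢
      rw [mulVec_add, mulVec_smul, dotProduct_add, dotProduct_add, dotProduct_smul, dot_self, he]
      rw [dotProduct_add] at hx
      simpa using hx) (by
      intro x hx
      simpa [T, φ] using hx)
  have h2 : (T.filter fun x => QP A b c x = 0).card ≤
      (Finset.univ.filter fun x => QP A b c x = 0 ∧ (A + Aᵀ) *ᵥ x + b ≠ 0).card := by
    apply Finset.card_le_card
    intro x hx
    simp only [T, φ, Finset.mem_filter, Finset.mem_univ, true_and] at hx ⊢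
    refine ⟨hx.2, fun h => hx.1 ?_⟩
    rw [h, dotProduct_zero]
  have h3 := fiber_count (Matrix.of ![(A + Aᵀ) *ᵥ e]) (by
      rw [show (Matrix.of ![(A + Aᵀ) *ᵥ e]).row = ![(A + Aᵀ) *ᵥ e] from rfl]
      exact linearIndependent_unique_iff.mpr (by simpa using hG)) ![-(e ⬝ᵥ b)]
  have h4 : (Finset.univ.filter fun x => Matrix.of ![(A + Aᵀ) *ᵥ e] *ᵥ x = ![-(e ⬝ᵥ b)]) =
      Finset.univ.filter fun x => ¬ φ x ≠ 0 := by
    ext x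
    simp only [Finset.mem_filter, Finset.mem_univ, true_and, φ, not_not, dotProduct_add, dot_symm]
    rw [_root_.funext_iff, Fin.forall_fin_one, eq_neg_iff_add_eq_zero.symm]
    rfl
  rw [h4] at h3
  have h5 := Finset.card_filter_add_card_filter_not (s := (Finset.univ : Finset (Fin m → K))) (fun x => φ x ≠ 0)
  rw [Finset.card_univ, Fintype.card_fun, Fintype.card_fin] at h5
  set t' := (Finset.univ.filter fun x => ¬ φ x ≠ 0).card
  have h5' : (T.card : ℝ) + t' = (κ : ℝ) ^ m := by exact_mod_cast h5
  have h3' : (t' : ℝ) * κ = (κ : ℝ) ^ m := by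
    have : t' * κ = κ ^ m := by simpa using h3
    exact_mod_cast this
  have h1' : (T.card : ℝ) ≤ ((T.filter fun x => QP A b c x = 0).card : ℝ) * κ := by exact_mod_cast h1
  have h2' : ((T.filter fun x => QP A b c x = 0).card : ℝ) ≤
      ((Finset.univ.filter fun x => QP A b c x = 0 ∧ (A + Aᵀ) *ᵥ x + b ≠ 0).card : ℝ) := by exact_mod_cast h2
  have h6 : (t' : ℝ) = κ ^ m / κ := by rw [← h3']; field_simp
  calc (κ : ℝ) ^ m * (1 - 1 / κ) = T.card := by
        have : (κ : ℝ) ^ m * (1 - 1 / κ) = κ ^ m - κ ^ m / κ := by ring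
        rw [this, ← h6]; linarith
    _ ≤ _ := h1'
    _ ≤ _ := by gcongr

lemma iso2_count {K : Type*} [Field K] [Fintype K] [DecidableEq K] {m : ℕ}
    (A : Matrix (Fin m) (Fin m) K) (b : Fin m → K) (c : K) (e e' : Fin m → K)
    (he : e ⬝ᵥ A *ᵥ e = 0) (he' : e' ⬝ᵥ A *ᵥ e' = 0) (hee : e ⬝ᵥ (A + Aᵀ) *ᵥ e' = 0)
    (hG : LinearIndependent K ![(A + Aᵀ) *ᵥ e, (A + Aᵀ) *ᵥ e']) :
    (Fintype.card K : ℝ) ^ m * (1 - 1 / (Fintype.card K : ℝ) ^ 2) ≤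
      (Finset.univ.filter fun x => QP A b c x = 0 ∧ (A + Aᵀ) *ᵥ x + b ≠ 0).card * Fintype.card K := by
  set κ := Fintype.card K
  have hκ : (0 : ℝ) < κ := by exact_mod_cast Fintype.card_pos
  let φ : (Fin m → K) → K := fun x => e ⬝ᵥ ((A + Aᵀ) *ᵥ x + b)
  let ψ : (Fin m → K) → K := fun x => e' ⬝ᵥ ((A + Aᵀ) *ᵥ x + b)
  let T := Finset.univ.filter fun x => φ x ≠ 0
  let T' := Finset.univ.filter fun x => ¬ φ x ≠ 0 ∧ ψ x ≠ 0
  have i1 : ∀ (x : Fin m → K) (s : K), φ (x + s • e) = φ x := by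
    intro x s
    simp only [φ, mulVec_add, mulVec_smul, dotProduct_add, dotProduct_smul, dot_self, he]; simp
  have i2 : ∀ (x : Fin m → K) (s : K), φ (x + s • e') = φ x := by
    intro x s
    simp only [φ, mulVec_add, mulVec_smul, dotProduct_add, dotProduct_smul, hee]; simp
  have i3 : ∀ (x : Fin m → K) (s : K), ψ (x + s • e') = ψ x := by
    intro x s
    simp only [ψ, mulVec_add, mulVec_smul, dotProduct_add, dotProduct_smul, dot_self, he']; simp
  have h1 := flow_count A b c T e he (by
      intro x hx s
      simp only [T, Finset.mem_filter, Finset.mem_univ, true_and, i1] at hx ⊢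
      exact hx) (by
      intro x hx
      simpa [T, φ] using hx)
  have h1b := flow_count A b c T' e' he' (by
      intro x hx s
      simp only [T', Finset.mem_filter, Finset.mem_univ, true_and, i2, i3] at hx ⊢
      exact hx) (by
      intro x hx
      simp only [T', Finset.mem_filter, Finset.mem_univ, true_and] at hx
      exact hx.2)
  set Z := (Finset.univ.filter fun x => QP A b c x = 0 ∧ (A + Aᵀ) *ᵥ x + b ≠ 0)
  have h2 : (T.filter fun x => QP A b c x = 0).card + (T'.filter fun x => QP A b c x = 0).card ≤ Z.card := by
    rw [← Finset.card_union_of_disjoint]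
    · apply Finset.card_le_card
      intro x hx
      simp only [T, T', Z, φ, ψ, Finset.mem_union, Finset.mem_filter, Finset.mem_univ, true_and] at hx ⊢
      rcases hx with hx | hx
      · refine ⟨hx.2, fun h => hx.1 ?_⟩
        rw [h, dotProduct_zero]
      · refine ⟨hx.2, fun h => hx.1.2 ?_⟩
        rw [h, dotProduct_zero]
    · rw [Finset.disjoint_left]
      intro x hx hx'
      simp only [T, T', Finset.mem_filter, Finset.mem_univ, true_and] at hx hx'
      exact hx'.1.1 hx.1
  have h3 := fiber_count (Matrix.of ![(A + Aᵀ) *ᵥ e, (A + Aᵀ) *ᵥ e']) hG ![-(e ⬝ᵥ b), -(e' ⬝ᵥ b)]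
  have h4 : (Finset.univ.filter fun x => Matrix.of ![(A + Aᵀ) *ᵥ e, (A + Aᵀ) *ᵥ e'] *ᵥ x = ![-(e ⬝ᵥ b), -(e' ⬝ᵥ b)]) =
      Finset.univ.filter fun x => ¬ φ x ≠ 0 ∧ ¬ ψ x ≠ 0 := by
    ext x
    simp only [Finset.mem_filter, Finset.mem_univ, true_and, φ, ψ, not_not, dotProduct_add, dot_symm]
    rw [_root_.funext_iff, Fin.forall_fin_two, ← eq_neg_iff_add_eq_zero, ← eq_neg_iff_add_eq_zero]
    rfl
  rw [h4] at h3
  have h5 : T.card + T'.card + (Finset.univ.filter fun x => ¬ φ x ≠ 0 ∧ ¬ ψ x ≠ 0).card = κ ^ m := by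
    have a1 := Finset.card_filter_add_card_filter_not (s := (Finset.univ : Finset (Fin m → K))) (fun x => φ x ≠ 0)
    have a2 := Finset.card_filter_add_card_filter_not
      (s := (Finset.univ.filter fun x => ¬ φ x ≠ 0 : Finset (Fin m → K))) (fun x => ψ x ≠ 0)
    rw [Finset.card_univ, Fintype.card_fun, Fintype.card_fin] at a1
    rw [Finset.filter_filter, Finset.filter_filter] at a2
    rw [add_assoc, a2]; exact a1
  set t' := (Finset.univ.filter fun x => ¬ φ x ≠ 0 ∧ ¬ ψ x ≠ 0).card
  set z1 := (T.filter fun x => QP A b c x = 0).card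
  set z2 := (T'.filter fun x => QP A b c x = 0).card
  have h6 : κ ^ m ≤ Z.card * κ + t' := by
    have : (z1 + z2) * κ ≤ Z.card * κ := Nat.mul_le_mul_right _ h2
    rw [add_mul] at this
    have h1c : T.card ≤ z1 * κ := h1
    have h1d : T'.card ≤ z2 * κ := h1b
    have h5c : T.card + T'.card + t' = κ ^ m := h5
    omega
  have h6' : (κ : ℝ) ^ m ≤ Z.card * κ + t' := by exact_mod_cast h6
  have h3' : (t' : ℝ) * κ ^ 2 = (κ : ℝ) ^ m := by exact_mod_cast h3
  have h7 : (t' : ℝ) = κ ^ m * (1 / κ ^ 2) := by rw [← h3']; field_simp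
  rw [mul_sub, ← h7]; linarith

lemma chevalley {K : Type*} [Field K] [Fintype K] [DecidableEq K] {n r : ℕ}
    (Q : Matrix (Fin n) (Fin n) K) (L : Fin r → Fin n → K) (h : r + 2 < n) :
    ∃ t : Fin n → K, t ≠ 0 ∧ t ⬝ᵥ Q *ᵥ t = 0 ∧ ∀ i, L i ⬝ᵥ t = 0 := by
  obtain ⟨p, hp⟩ := CharP.exists K
  have hprime : p.Prime := (CharP.char_is_prime_or_zero K p).resolve_right (CharP.char_ne_zero_of_finite K p)
  let f : Option (Fin r) → MvPolynomial (Fin n) K := fun o => match o with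
    | none => ∑ i, ∑ j, C (Q i j) * (X i * X j)
    | some k => ∑ i, C (L k i) * X i
  have d0 : (f none).totalDegree ≤ 2 := by
    refine totalDegree_finsetSum_le fun i _ => totalDegree_finsetSum_le fun j _ => ?_
    refine (totalDegree_mul _ _).trans ?_
    rw [totalDegree_C, zero_add]
    refine (totalDegree_mul _ _).trans ?_
    simp [totalDegree_X]
  have d1 : ∀ k, (f (some k)).totalDegree ≤ 1 := by
    intro k
    refine totalDegree_finsetSum_le fun i _ => ?_
    refine (totalDegree_mul _ _).trans ?_
    simp [totalDegree_X]
  have hd := char_dvd_card_solutions_of_fintype_sum_lt p (f := f) (by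
    rw [Fintype.sum_option, Fintype.card_fin]
    have : ∑ k, (f (some k)).totalDegree ≤ r := by
      refine (Finset.sum_le_sum fun k _ => d1 k).trans ?_
      simp
    omega)
  have e0 : ∀ x, eval x (f none) = x ⬝ᵥ Q *ᵥ x := by
    intro x
    simp only [f, map_sum, map_mul, eval_C, eval_X, dotProduct, mulVec, Finset.mul_sum]
    refine Finset.sum_congr rfl fun i _ => Finset.sum_congr rfl fun j _ => by ring
  have e1 : ∀ k x, eval x (f (some k)) = L k ⬝ᵥ x := by
    intro k x
    simp [f, dotProduct]
  have hz : ∀ i, eval (0 : Fin n → K) (f i) = 0 := by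
    rintro (_ | k)
    · rw [e0]; simp
    · rw [e1]; simp
  have hlt : 1 < Fintype.card {x : Fin n → K // ∀ i, eval x (f i) = 0} := by
    have : 0 < Fintype.card {x : Fin n → K // ∀ i, eval x (f i) = 0} :=
      Fintype.card_pos_iff.mpr ⟨⟨0, hz⟩⟩
    exact hprime.one_lt.trans_le (Nat.le_of_dvd this hd)
  obtain ⟨⟨x, hx⟩, hne⟩ := Fintype.exists_ne_of_one_lt_card hlt ⟨0, hz⟩
  refine ⟨x, fun h => hne (Subtype.ext h), ?_, fun i => ?_⟩
  · rw [← e0]; exact hx none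
  · rw [← e1]; exact hx (some i)

lemma exists_indep {K : Type*} [Field K] {m : ℕ} (G : Matrix (Fin m) (Fin m) K) (n : ℕ) (h : n ≤ G.rank) :
    ∃ u : Fin n → (Fin m → K), LinearIndependent K (fun i => G *ᵥ u i) := by
  obtain ⟨f, hf⟩ := exists_linearIndependent_of_le_finrank (R := K) (M := LinearMap.range G.mulVecLin) h
  choose u hu using fun i => (f i).2
  refine ⟨u, ?_⟩
  have := hf.map' (Submodule.subtype _) (Submodule.ker_subtype _)
  have e : (fun i => G *ᵥ u i) = (Submodule.subtype (LinearMap.range G.mulVecLin)) ∘ f := by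
    ext1 i
    exact hu i
  rw [e]; exact this

lemma quad_comb {K : Type*} [Field K] {m n : ℕ} (A : Matrix (Fin m) (Fin m) K) (u : Fin n → (Fin m → K))
    (t : Fin n → K) : (∑ i, t i • u i) ⬝ᵥ A *ᵥ (∑ i, t i • u i) =
      t ⬝ᵥ (Matrix.of fun i j => u i ⬝ᵥ A *ᵥ u j) *ᵥ t := by
  rw [sum_dotProduct]
  simp only [mulVec_sum, dotProduct_sum, mulVec_smul, smul_dotProduct, dotProduct_smul]
  simp only [dotProduct, mulVec, of_apply, smul_eq_mul, Finset.mul_sum]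
  refine Finset.sum_congr rfl fun i _ => Finset.sum_congr rfl fun j _ => ?_
  simp only [Finset.mul_sum, Finset.sum_mul]
  refine Finset.sum_congr rfl fun k _ => Finset.sum_congr rfl fun l _ => by ring

lemma exists_iso1 {K : Type*} [Field K] [Fintype K] [DecidableEq K] {m : ℕ}
    (A : Matrix (Fin m) (Fin m) K) (h : 3 ≤ (A + Aᵀ).rank) :
    ∃ e : Fin m → K, e ⬝ᵥ A *ᵥ e = 0 ∧ (A + Aᵀ) *ᵥ e ≠ 0 := by
  obtain ⟨u, hu⟩ := exists_indep _ _ h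
  obtain ⟨t, ht0, ht, -⟩ := chevalley (r := 0) (Matrix.of fun i j => u i ⬝ᵥ A *ᵥ u j) (fun i => i.elim0) (by norm_num)
  refine ⟨∑ i, t i • u i, by rw [quad_comb, ht], fun h0 => ht0 ?_⟩
  rw [mulVec_sum] at h0
  simp only [mulVec_smul] at h0
  ext i
  exact Fintype.linearIndependent_iff.mp hu t h0 i

lemma exists_iso2 {K : Type*} [Field K] [Fintype K] [DecidableEq K] {m : ℕ}
    (A : Matrix (Fin m) (Fin m) K) (h : 5 ≤ (A + Aᵀ).rank) :
    ∃ e e' : Fin m → K, e ⬝ᵥ A *ᵥ e = 0 ∧ e' ⬝ᵥ A *ᵥ e' = 0 ∧ e ⬝ᵥ (A + Aᵀ) *ᵥ e' = 0 ∧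
      LinearIndependent K ![(A + Aᵀ) *ᵥ e, (A + Aᵀ) *ᵥ e'] := by
  obtain ⟨u, hu⟩ := exists_indep _ _ h
  obtain ⟨s, hs0, hs, -⟩ := chevalley (r := 0) (Matrix.of fun i j => u i ⬝ᵥ A *ᵥ u j) (fun i => i.elim0) (by norm_num)
  obtain ⟨k, hk⟩ := Function.ne_iff.mp hs0
  set e := ∑ i, s i • u i with he
  obtain ⟨t, ht0, ht, htl⟩ := chevalley (r := 2) (Matrix.of fun i j => u i ⬝ᵥ A *ᵥ u j)
    ![fun i => e ⬝ᵥ (A + Aᵀ) *ᵥ u i, Pi.single k 1] (by norm_num)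
  refine ⟨e, ∑ i, t i • u i, by rw [quad_comb, hs], by rw [quad_comb, ht], ?_, ?_⟩
  · rw [mulVec_sum, dotProduct_sum]
    have := htl 0
    rw [cons_val_zero] at this
    refine Eq.trans ?_ this
    change _ = ∑ i, (e ⬝ᵥ (A + Aᵀ) *ᵥ u i) * t i
    refine Finset.sum_congr rfl fun i _ => ?_
    rw [mulVec_smul, dotProduct_smul, smul_eq_mul, mul_comm]
  · have htk : t k = 0 := by simpa using htl 1
    rw [LinearIndependent.pair_iff]
    intro α β hab
    rw [he, mulVec_sum, mulVec_sum, Finset.smul_sum, Finset.smul_sum, ← Finset.sum_add_distrib] at hab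
    have h2 := Fintype.linearIndependent_iff.mp hu (fun i => α * s i + β * t i) (by
      rw [← hab]
      refine Finset.sum_congr rfl fun i _ => ?_
      rw [mulVec_smul, mulVec_smul, add_smul, mul_smul, mul_smul])
    have hα : α = 0 := by
      have := h2 k
      rw [htk, mul_zero, add_zero] at this
      exact (mul_eq_zero.mp this).resolve_right hk
    refine ⟨hα, ?_⟩
    obtain ⟨l, hl⟩ := Function.ne_iff.mp ht0
    have := h2 l
    rw [hα, zero_mul, zero_add] at this
    exact (mul_eq_zero.mp this).resolve_right hl

lemma map_symm_Z {m : ℕ} (A : Matrix (Fin m) (Fin m) ℤ) {R : Type*} [CommRing R] (f : ℤ →+* R) :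
    (A + Aᵀ).map f = A.map f + (A.map f)ᵀ := by ext i j; simp

lemma rho_ge_iso1 {m : ℕ} (hm : 1 ≤ m) (A : Matrix (Fin m) (Fin m) ℤ) (b : Fin m → ℤ) (c : ℤ) (p : ℕ)
    (hp : p.Prime) (N : ℕ) (hN : 1 ≤ N) (e : Fin m → ZMod p)
    (he : e ⬝ᵥ (A.map (Int.castRingHom (ZMod p))) *ᵥ e = 0)
    (hG : (A.map (Int.castRingHom (ZMod p)) + (A.map (Int.castRingHom (ZMod p)))ᵀ) *ᵥ e ≠ 0) :
    1 - 1 / (p : ℝ) ≤ rho A b c (p ^ N) := by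
  have : Fact p.Prime := ⟨hp⟩
  have h := iso1_count (A.map (Int.castRingHom (ZMod p))) (fun i => (b i : ZMod p)) (c : ZMod p) e he hG
  have h2 := rho_ge_nonsing hm A b c p hp N hN (S := Finset.univ.filter fun x =>
      QP (A.map (Int.castRingHom (ZMod p))) (fun i => (b i : ZMod p)) (c : ZMod p) x = 0 ∧
      (A.map (Int.castRingHom (ZMod p)) + (A.map (Int.castRingHom (ZMod p)))ᵀ) *ᵥ x +
        (fun i => (b i : ZMod p)) ≠ 0) (by
    intro x hx
    simp only [Finset.mem_filter, Finset.mem_univ, true_and] at hx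
    rw [map_symm_Z]
    exact hx)
  refine le_trans ?_ h2
  have hp0 : (0 : ℝ) < p := by exact_mod_cast hp.pos
  rw [ZMod.card] at h
  rw [le_div_iff₀ (by positivity)]
  refine le_of_mul_le_mul_right ?_ hp0
  refine le_trans (le_of_eq ?_) h
  obtain ⟨k, rfl⟩ : ∃ k, m = k + 1 := ⟨m - 1, by omega⟩
  simp; ring

lemma rho_ge_rank3 {m : ℕ} (hm : 1 ≤ m) (A : Matrix (Fin m) (Fin m) ℤ) (b : Fin m → ℤ) (c : ℤ) (p : ℕ)
    (hp : p.Prime) (N : ℕ) (hN : 1 ≤ N)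
    (hr : 3 ≤ ((A + Aᵀ).map (Int.castRingHom (ZMod p))).rank) :
    1 - 1 / (p : ℝ) ≤ rho A b c (p ^ N) := by
  have : Fact p.Prime := ⟨hp⟩
  rw [map_symm_Z] at hr
  obtain ⟨e, he, hG⟩ := exists_iso1 _ hr
  exact rho_ge_iso1 hm A b c p hp N hN e he hG

lemma rho_ge_rank5 {m : ℕ} (hm : 1 ≤ m) (A : Matrix (Fin m) (Fin m) ℤ) (b : Fin m → ℤ) (c : ℤ) (p : ℕ)
    (hp : p.Prime) (N : ℕ) (hN : 1 ≤ N)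
    (hr : 5 ≤ ((A + Aᵀ).map (Int.castRingHom (ZMod p))).rank) :
    1 - 1 / (p : ℝ) ^ 2 ≤ rho A b c (p ^ N) := by
  have : Fact p.Prime := ⟨hp⟩
  rw [map_symm_Z] at hr
  obtain ⟨e, e', he, he', hee, hG⟩ := exists_iso2 _ hr
  have h := iso2_count (A.map (Int.castRingHom (ZMod p))) (fun i => (b i : ZMod p)) (c : ZMod p) e e' he he' hee hG
  have h2 := rho_ge_nonsing hm A b c p hp N hN (S := Finset.univ.filter fun x =>
      QP (A.map (Int.castRingHom (ZMod p))) (fun i => (b i : ZMod p)) (c : ZMod p) x = 0 ∧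
      (A.map (Int.castRingHom (ZMod p)) + (A.map (Int.castRingHom (ZMod p)))ᵀ) *ᵥ x +
        (fun i => (b i : ZMod p)) ≠ 0) (by
    intro x hx
    simp only [Finset.mem_filter, Finset.mem_univ, true_and] at hx
    rw [map_symm_Z]
    exact hx)
  refine le_trans ?_ h2
  have hp0 : (0 : ℝ) < p := by exact_mod_cast hp.pos
  rw [ZMod.card] at h
  rw [le_div_iff₀ (by positivity)]
  refine le_of_mul_le_mul_right ?_ hp0
  refine le_trans (le_of_eq ?_) h
  obtain ⟨k, rfl⟩ : ∃ k, m = k + 1 := ⟨m - 1, by omega⟩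
  simp; ring


section curve
variable {K : Type*} [NontriviallyNormedField K] {σ : Type*} [Fintype σ]

/-- total derivative of a polynomial map -/
noncomputable def dC (p : MvPolynomial σ ℤ) (z : σ → K) : (σ → K) →L[K] K :=
  ∑ w, (aeval z (pderiv w p) : K) • ContinuousLinearMap.proj (R := K) (φ := fun _ : σ => K) w

lemma dC_apply (p : MvPolynomial σ ℤ) (z v : σ → K) :
    dC p z v = ∑ w, aeval z (pderiv w p) * v w := by
  simp [dC]

lemma hasStrictFDerivAt_aeval (p : MvPolynomial σ ℤ) (z : σ → K) :
    HasStrictFDerivAt (fun z : σ → K => (aeval z p : K)) (dC p z) z := by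
  classical
  induction p using MvPolynomial.induction_on with
  | C a =>
    have : (dC (C a) z : (σ → K) →L[K] K) = 0 := by ext; simp [dC]
    rw [this]; simpa using hasStrictFDerivAt_const (𝕜 := K) _ z
  | add p q hp hq =>
    have : (dC (p + q) z : (σ → K) →L[K] K) = dC p z + dC q z := by
      ext v; simp [dC, ← Finset.sum_add_distrib, add_mul]
    rw [this]
    have h2 : (fun z : σ → K => (aeval z (p + q) : K)) = fun z => (aeval z p : K) + aeval z q := by
      ext; simp
    rw [h2]
    exact hp.fun_add hq
  | mul_X p i hp =>
    have h1 : HasStrictFDerivAt (fun z : σ → K => z i)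
      (ContinuousLinearMap.proj (R := K) (φ := fun _ : σ => K) i) z :=
      (ContinuousLinearMap.proj (R := K) (φ := fun _ : σ => K) i).hasStrictFDerivAt
    have h2 : (fun z : σ → K => (aeval z (p * X i) : K)) = fun z => (aeval z p : K) * z i := by
      ext; simp
    have h3 : (dC (p * X i) z : (σ → K) →L[K] K) =
       (aeval z p : K) • ContinuousLinearMap.proj (R := K) (φ := fun _ : σ => K) i + z i • dC p z := by
      ext v
      simp only [dC_apply, Derivation.leibniz, pderiv_X, _root_.add_apply,
        _root_.smul_apply, ContinuousLinearMap.proj_apply, smul_eq_mul, map_add, map_mul,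
        add_mul, Finset.sum_add_distrib, Finset.mul_sum]
      congr 1
      · rw [Finset.sum_eq_single i]
        · simp
        · intro b _ hb
          simp [hb]
        · simp
      · refine Finset.sum_congr rfl fun w _ => ?_
        simp; ring
    rw [h2, h3]
    exact hp.mul h1

/-- implicit curve -/
lemma exists_curve [CompleteSpace K] [DecidableEq σ] (p : MvPolynomial σ ℤ) (P v : σ → K) (u : σ)
    (h0 : aeval P p = (0 : K)) (hu : aeval P (pderiv u p) ≠ (0 : K)) :
    ∃ t : K → K, t 0 = 0 ∧
      HasDerivAt t (-(dC p P v) / aeval P (pderiv u p)) 0 ∧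
      ∀ᶠ ε in nhds (0 : K), aeval (P + ε • v + t ε • Pi.single u 1) p = (0 : K) := by
  set g : K × K → (σ → K) := fun x => P + x.1 • v + x.2 • Pi.single u 1 with hg
  set g' : K × K →L[K] (σ → K) := (ContinuousLinearMap.fst K K K).smulRight v +
    (ContinuousLinearMap.snd K K K).smulRight (Pi.single u 1) with hg'
  have hgd : HasStrictFDerivAt g g' (0, 0) := by
    have : HasStrictFDerivAt (fun x => P + g' x) g' (0, 0) := g'.hasStrictFDerivAt.const_add P
    convert this using 1
    ext x : 1
    simp [hg, hg', add_assoc]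
  have hg0 : g (0, 0) = P := by simp [hg]
  have hf : HasStrictFDerivAt (fun x : K × K => (aeval (g x) p : K)) ((dC p P).comp g') (0, 0) := by
    have h1 := hasStrictFDerivAt_aeval p (g (0,0))
    have := h1.comp ((0 : K), (0 : K)) hgd
    rw [hg0] at this
    exact this
  have hsing : dC p P (Pi.single u 1) = aeval P (pderiv u p) := by
    rw [dC_apply]; simp [Pi.single_apply]
  have hinv : (((dC p P).comp g').comp (ContinuousLinearMap.inr K K K)).IsInvertible := by
    refine ⟨ContinuousLinearEquiv.unitsEquivAut K (Units.mk0 _ hu), ?_⟩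
    ext
    simp [hg', hsing]
  set t := hf.implicitFunctionOfProdDomain hinv with ht
  have ht0 : t 0 = 0 := by
    exact (hf.eventually_apply_eq_iff_implicitFunctionOfProdDomain hinv).self_of_nhds.mp rfl
  have hev := hf.eventually_apply_implicitFunctionOfProdDomain hinv
  have hd := (hf.hasStrictFDerivAt_implicitFunctionOfProdDomain hinv).hasFDerivAt.hasDerivAt
  rw [← ht] at hd hev
  have hev' : ∀ᶠ ε in nhds (0 : K), aeval (P + ε • v + t ε • Pi.single u 1) p = (0 : K) := by
    filter_upwards [hev] with ε hε
    have : (aeval (g (0,0)) p : K) = 0 := by rw [hg0, h0]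
    rw [this] at hε; exact hε
  refine ⟨t, ht0, ?_, hev'⟩
  obtain ⟨t', ht'⟩ : ∃ t', HasDerivAt t t' 0 := ⟨_, hd⟩
  have hcomp : HasDerivAt (fun ε => (aeval (g (ε, t ε)) p : K)) (((dC p P).comp g') (1, t')) 0 := by
    have h1 : HasDerivAt (fun ε : K => (ε, t ε)) (1, t') 0 := (hasDerivAt_id (0:K)).prodMk ht'
    have h2 : HasFDerivAt (fun x : K × K => (aeval (g x) p : K)) ((dC p P).comp g') ((0 : K), t 0) := by
      rw [ht0]; exact hf.hasFDerivAt
    exact h2.comp_hasDerivAt (0:K) h1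
  have hz : HasDerivAt (fun ε => (aeval (g (ε, t ε)) p : K)) 0 0 := by
    refine (hasDerivAt_const (0:K) (0:K)).congr_of_eventuallyEq hev'
  have := hcomp.unique hz
  simp [hg', hsing] at this
  have h3 : t' = -(dC p P v) / aeval P (pderiv u p) := by
    field_simp; linear_combination this
  rw [← h3]; exact ht'

lemma curve_deriv [DecidableEq σ] (p : MvPolynomial σ ℤ) (P v : σ → K) (u : σ) (t : K → K) (t' : K)
    (h0 : t 0 = 0) (ht : HasDerivAt t t' 0) :
    HasDerivAt (fun ε => (aeval (P + ε • v + t ε • Pi.single u 1) p : K))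
      (dC p P (v + t' • Pi.single u 1)) 0 := by
  have h1 : HasDerivAt (fun ε : K => P + ε • v + t ε • (Pi.single u 1 : σ → K)) (v + t' • Pi.single u 1) 0 := by
    have ha : HasDerivAt (fun ε : K => ε • v) ((1:K) • v) 0 := (hasDerivAt_id (0:K)).smul_const v
    have hb := ht.smul_const (Pi.single u 1 : σ → K)
    rw [one_smul] at ha
    exact (ha.const_add P).add hb
  have h2 := (hasStrictFDerivAt_aeval p P).hasFDerivAt
  have h3 : P = (fun ε : K => P + ε • v + t ε • (Pi.single u 1 : σ → K)) 0 := by simp [h0]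
  have h4 : HasFDerivAt (fun z : σ → K => (aeval z p : K)) (dC p P)
    ((fun ε : K => P + ε • v + t ε • (Pi.single u 1 : σ → K)) 0) := by rw [← h3]; exact h2
  exact h4.comp_hasDerivAt (0:K) h1

/-- nonvanishing is preserved along the curve -/
lemma curve_ne [DecidableEq σ] (p : MvPolynomial σ ℤ) (P v : σ → K) (u : σ) (t : K → K) (t' : K)
    (h0 : t 0 = 0) (ht : HasDerivAt t t' 0) (hp : aeval P p ≠ (0 : K)) :
    ∀ᶠ ε in nhds (0 : K), aeval (P + ε • v + t ε • Pi.single u 1) p ≠ (0 : K) := by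
  have h := (curve_deriv p P v u t t' h0 ht).continuousAt
  refine h.eventually_ne ?_
  simpa [h0] using hp

lemma curve_ne' [DecidableEq σ] (p : MvPolynomial σ ℤ) (P v : σ → K) (u : σ) (t : K → K) (t' : K)
    (h0 : t 0 = 0) (ht : HasDerivAt t t' 0) (hd : dC p P (v + t' • Pi.single u 1) ≠ 0) :
    ∀ᶠ ε in nhdsWithin (0 : K) {0}ᶜ, aeval (P + ε • v + t ε • Pi.single u 1) p ≠ (0 : K) :=
  (curve_deriv p P v u t t' h0 ht).eventually_ne hd
end curve


section setup
variable {m h : ℕ} {S : Type*} [CommRing S]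

/-- matrix of the quadratic part -/
def AA (B : Fin h → Matrix (Fin m) (Fin m) ℤ) (y : Fin h → S) : Matrix (Fin m) (Fin m) S :=
  fun i j => ∑ k, y k * (B k i j : S)

/-- symmetrised matrix -/
def GG (B : Fin h → Matrix (Fin m) (Fin m) ℤ) (y : Fin h → S) : Matrix (Fin m) (Fin m) S :=
  AA B y + (AA B y)ᵀ

lemma AA_map {T : Type*} [CommRing T] (f : S →+* T) (B : Fin h → Matrix (Fin m) (Fin m) ℤ)
    (y : Fin h → S) : (AA B y).map f = AA B (fun k => f (y k)) := by
  ext i j; simp [AA]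

lemma GG_map {T : Type*} [CommRing T] (f : S →+* T) (B : Fin h → Matrix (Fin m) (Fin m) ℤ)
    (y : Fin h → S) : (GG B y).map f = GG B (fun k => f (y k)) := by
  ext i j; simp [GG, AA]

lemma AA_add (B : Fin h → Matrix (Fin m) (Fin m) ℤ) (y z : Fin h → S) :
    AA B (y + z) = AA B y + AA B z := by
  ext i j; simp [AA, add_mul, Finset.sum_add_distrib]

lemma AA_smul (B : Fin h → Matrix (Fin m) (Fin m) ℤ) (c : S) (y : Fin h → S) :
    AA B (c • y) = c • AA B y := by
  ext i j; simp [AA, Finset.mul_sum, mul_assoc]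

lemma GG_add (B : Fin h → Matrix (Fin m) (Fin m) ℤ) (y z : Fin h → S) :
    GG B (y + z) = GG B y + GG B z := by
  simp only [GG, AA_add, transpose_add]; abel

lemma GG_smul (B : Fin h → Matrix (Fin m) (Fin m) ℤ) (c : S) (y : Fin h → S) :
    GG B (c • y) = c • GG B y := by
  simp only [GG, AA_smul, transpose_smul, smul_add]

lemma GG_single (B : Fin h → Matrix (Fin m) (Fin m) ℤ) (k : Fin h) :
    GG B (Pi.single k (1 : S)) = (B k + (B k)ᵀ).map (Int.castRingHom S) := by
  ext i j; simp [GG, AA, Pi.single_apply]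

/-- the polynomial value -/
noncomputable def FF (B : Fin h → Matrix (Fin m) (Fin m) ℤ) (q : Fin m → MvPolynomial (Fin h) ℤ)
    (R : MvPolynomial (Fin h) ℤ) (x : Fin m → S) (y : Fin h → S) : S :=
  QP (AA B y) (fun i => aeval y (q i)) (aeval y R) x

/-- gradient in the `x` variables -/
noncomputable def gX (B : Fin h → Matrix (Fin m) (Fin m) ℤ) (q : Fin m → MvPolynomial (Fin h) ℤ)
    (x : Fin m → S) (y : Fin h → S) : Fin m → S :=
  GG B y *ᵥ x + fun i => aeval y (q i)

lemma aeval_hom {T : Type*} [CommRing T] (f : S →+* T) {σ : Type*} (y : σ → S) (p : MvPolynomial σ ℤ) :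
    f (aeval y p) = aeval (fun k => f (y k)) p := by
  simp only [aeval_def, eval₂_comp_left f]
  congr 1
  exact Subsingleton.elim _ _

lemma FF_map {T : Type*} [CommRing T] (f : S →+* T) (B : Fin h → Matrix (Fin m) (Fin m) ℤ)
    (q : Fin m → MvPolynomial (Fin h) ℤ) (R : MvPolynomial (Fin h) ℤ) (x : Fin m → S) (y : Fin h → S) :
    f (FF B q R x y) = FF B q R (fun i => f (x i)) (fun k => f (y k)) := by
  simp only [FF, QP_map, AA_map, aeval_hom]

lemma gX_map {T : Type*} [CommRing T] (f : S →+* T) (B : Fin h → Matrix (Fin m) (Fin m) ℤ)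
    (q : Fin m → MvPolynomial (Fin h) ℤ) (x : Fin m → S) (y : Fin h → S) (i : Fin m) :
    f (gX B q x y i) = gX B q (fun i => f (x i)) (fun k => f (y k)) i := by
  simp only [gX, Pi.add_apply, map_add, aeval_hom, ← GG_map f, mulVec, dotProduct, map_sum, map_mul,
    Matrix.map_apply]

lemma aeval_homog {σ : Type*} (p : MvPolynomial σ ℤ) (d : ℕ) (hp : p.IsHomogeneous d) (c : S) (y : σ → S) :
    aeval (c • y) p = c ^ d * aeval y p := by
  rw [aeval_def, aeval_def, eval₂_eq, eval₂_eq, Finset.mul_sum]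
  refine Finset.sum_congr rfl fun e he => ?_
  have h1 := hp (mem_support_iff.mp he)
  rw [Finsupp.weight_apply, Finsupp.sum] at h1
  simp only [Pi.smul_apply, smul_eq_mul, mul_pow, Finset.prod_mul_distrib, Finset.prod_pow_eq_pow_sum]
  have h2 : ∑ i ∈ e.support, e i = d := by simpa using h1
  rw [h2]; ring

lemma FF_homog (B : Fin h → Matrix (Fin m) (Fin m) ℤ) (q : Fin m → MvPolynomial (Fin h) ℤ)
    (hq : ∀ j, (q j).IsHomogeneous 2) (R : MvPolynomial (Fin h) ℤ) (hR : R.IsHomogeneous 3)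
    (c : S) (x : Fin m → S) (y : Fin h → S) :
    FF B q R (c • x) (c • y) = c ^ 3 * FF B q R x y := by
  simp only [FF, QP, AA_smul, aeval_homog _ _ (hq _), aeval_homog _ _ hR]
  have : (fun i => c ^ 2 * aeval y (q i)) = c ^ 2 • (fun i => aeval y (q i)) := by ext; simp
  rw [this]
  simp only [smul_mulVec, mulVec_smul, smul_dotProduct, dotProduct_smul, smul_eq_mul]
  ring

lemma gX_homog (B : Fin h → Matrix (Fin m) (Fin m) ℤ) (q : Fin m → MvPolynomial (Fin h) ℤ)
    (hq : ∀ j, (q j).IsHomogeneous 2) (c : S) (x : Fin m → S) (y : Fin h → S) :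
    gX B q (c • x) (c • y) = c ^ 2 • gX B q x y := by
  simp only [gX, GG_smul, aeval_homog _ _ (hq _)]
  ext i
  simp only [smul_mulVec, mulVec_smul, Pi.add_apply, Pi.smul_apply, smul_eq_mul]
  ring

/-- the cubic form as a polynomial -/
noncomputable def CP (B : Fin h → Matrix (Fin m) (Fin m) ℤ) (q : Fin m → MvPolynomial (Fin h) ℤ)
    (R : MvPolynomial (Fin h) ℤ) : MvPolynomial (Fin m ⊕ Fin h) ℤ :=
  ∑ k, X (Sum.inr k) * ∑ i, ∑ j, C (B k i j) * (X (Sum.inl i) * X (Sum.inl j))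
    + ∑ i, X (Sum.inl i) * rename Sum.inr (q i) + rename Sum.inr R

lemma aeval_CP (B : Fin h → Matrix (Fin m) (Fin m) ℤ) (q : Fin m → MvPolynomial (Fin h) ℤ)
    (R : MvPolynomial (Fin h) ℤ) (z : Fin m ⊕ Fin h → S) :
    aeval z (CP B q R) = FF B q R (fun i => z (Sum.inl i)) (fun k => z (Sum.inr k)) := by
  simp only [CP, FF, QP, map_add, map_sum, map_mul, aeval_X, aeval_rename, aeval_C]
  congr 2
  · simp only [dotProduct, mulVec, AA, Finset.mul_sum, Finset.sum_mul]
    rw [Finset.sum_comm]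
    refine Finset.sum_congr rfl fun i _ => ?_
    rw [Finset.sum_comm]
    refine Finset.sum_congr rfl fun j _ => Finset.sum_congr rfl fun k _ => ?_
    simp; ring
  · simp only [dotProduct]
    exact Finset.sum_congr rfl fun i _ => mul_comm _ _

/-- the `x`-derivative polynomial -/
noncomputable def gP (B : Fin h → Matrix (Fin m) (Fin m) ℤ) (q : Fin m → MvPolynomial (Fin h) ℤ)
    (i : Fin m) : MvPolynomial (Fin m ⊕ Fin h) ℤ :=
  ∑ k, X (Sum.inr k) * (∑ j, C (B k i j + B k j i) * X (Sum.inl j)) + rename Sum.inr (q i)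

lemma pderiv_inl_rename (i : Fin m) (p : MvPolynomial (Fin h) ℤ) :
    pderiv (Sum.inl i : Fin m ⊕ Fin h) (rename Sum.inr p) = 0 := by
  apply pderiv_eq_zero_of_notMem_vars
  intro hm
  have := vars_rename (Sum.inr : Fin h → Fin m ⊕ Fin h) p hm
  simp at this

lemma pderiv_quad (M : Matrix (Fin m) (Fin m) ℤ) (i : Fin m) :
    pderiv (Sum.inl i : Fin m ⊕ Fin h)
      (∑ i, ∑ j, C (M i j) * (X (Sum.inl i) * X (Sum.inl j)) : MvPolynomial (Fin m ⊕ Fin h) ℤ) =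
      ∑ j, C (M i j + M j i) * X (Sum.inl j) := by
  have key : ∀ a b : Fin m, pderiv (Sum.inl i : Fin m ⊕ Fin h)
      (C (M a b) * (X (Sum.inl a) * X (Sum.inl b)) : MvPolynomial (Fin m ⊕ Fin h) ℤ) =
      (if a = i then C (M a b) * X (Sum.inl b) else 0) +
      (if b = i then C (M a b) * X (Sum.inl a) else 0) := by
    intro a b
    simp only [Derivation.leibniz, pderiv_C, pderiv_X, Pi.single_apply, Sum.inl.injEq, smul_eq_mul]
    split_ifs <;> simp_all <;> ring
  simp only [map_sum, key, Finset.sum_add_distrib, C_add, add_mul]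
  congr 1
  · rw [Finset.sum_comm]; simp
  · simp

lemma pderiv_CP (B : Fin h → Matrix (Fin m) (Fin m) ℤ) (q : Fin m → MvPolynomial (Fin h) ℤ)
    (R : MvPolynomial (Fin h) ℤ) (i : Fin m) :
    pderiv (Sum.inl i) (CP B q R) = gP B q i := by
  have h1 : ∀ k : Fin h, ∀ T : MvPolynomial (Fin m ⊕ Fin h) ℤ,
      pderiv (Sum.inl i) (X (Sum.inr k) * T) = X (Sum.inr k) * pderiv (Sum.inl i) T := by
    intro k T
    simp [Derivation.leibniz, pderiv_X]
  have h2 : ∀ j : Fin m, pderiv (Sum.inl i : Fin m ⊕ Fin h) (X (Sum.inl j) * rename Sum.inr (q j))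
      = if j = i then rename Sum.inr (q j) else 0 := by
    intro j
    simp only [Derivation.leibniz, pderiv_X, pderiv_inl_rename, Pi.single_apply, Sum.inl.injEq, smul_eq_mul]
    split_ifs <;> simp
  rw [CP, gP, map_add, map_add, map_sum, map_sum, pderiv_inl_rename, add_zero]
  simp only [h1, h2, pderiv_quad]
  simp

lemma aeval_gP (B : Fin h → Matrix (Fin m) (Fin m) ℤ) (q : Fin m → MvPolynomial (Fin h) ℤ)
    (i : Fin m) (z : Fin m ⊕ Fin h → S) :
    aeval z (gP B q i) = gX B q (fun i => z (Sum.inl i)) (fun k => z (Sum.inr k)) i := by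
  simp only [gP, gX, GG, AA, map_add, map_sum, map_mul, aeval_X, aeval_rename, aeval_C, Pi.add_apply,
    mulVec, dotProduct, Matrix.add_apply, transpose_apply]
  congr 1
  simp only [Finset.mul_sum, ← Finset.sum_add_distrib, Finset.sum_mul]
  rw [Finset.sum_comm]
  refine Finset.sum_congr rfl fun j _ => Finset.sum_congr rfl fun k _ => ?_
  simp; ring

lemma aeval_pderiv_gP (B : Fin h → Matrix (Fin m) (Fin m) ℤ) (q : Fin m → MvPolynomial (Fin h) ℤ)
    (i l : Fin m) (z : Fin m ⊕ Fin h → S) :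
    aeval z (pderiv (Sum.inl l) (gP B q i)) = GG B (fun k => z (Sum.inr k)) i l := by
  simp only [gP, GG, map_add, map_sum, Derivation.leibniz, pderiv_C, pderiv_inl_rename, pderiv_X,
    Pi.single_apply, smul_zero, add_zero, zero_add, smul_eq_mul, Sum.inl.injEq, reduceCtorEq, if_false]
  simp [Matrix.add_apply, ← Finset.sum_add_distrib, Finset.sum_ite_eq, mul_add, apply_ite, mul_ite]
  simp [AA, Finset.sum_add_distrib]
end setup


lemma rank5_of_minor {K : Type*} [Field K] {m : ℕ} (M : Matrix (Fin m) (Fin m) K) (f g : Fin 5 → Fin m)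
    (hd : (M.submatrix f g).det ≠ 0) : 5 ≤ M.rank := by
  have h1 := Matrix.rank_submatrix_le M f g
  have h2 := Matrix.rank_of_isUnit (M.submatrix f g) ((Matrix.isUnit_iff_isUnit_det _).mpr (isUnit_iff_ne_zero.mpr hd))
  rw [h2] at h1
  simpa using h1

section loc
variable {K : Type*} [NontriviallyNormedField K] [CompleteSpace K] [CharZero K] {m h : ℕ}
  (B : Fin h → Matrix (Fin m) (Fin m) ℤ) (q : Fin m → MvPolynomial (Fin h) ℤ)
  (R : MvPolynomial (Fin h) ℤ) (o : Fin h)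

lemma rank_smul_le' {K : Type*} [Field K] {m : ℕ} (M : Matrix (Fin m) (Fin m) K) (c : K) :
    (c • M).rank ≤ M.rank := by
  have : c • M = (c • (1 : Matrix (Fin m) (Fin m) K)) * M := by simp
  rw [this]; exact rank_mul_le_right _ _

lemma exists_punct {p : K → Prop} (hp : ∀ᶠ ε in nhdsWithin (0 : K) {0}ᶜ, p ε) :
    ∃ ε : K, ε ≠ 0 ∧ p ε := by
  have h2 : ∀ᶠ ε in nhdsWithin (0 : K) {0}ᶜ, ε ≠ 0 := eventually_mem_nhdsWithin
  exact (h2.and hp).exists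

/-- Step C -/
lemma step_C (hq : ∀ j, (q j).IsHomogeneous 2) (hR : R.IsHomogeneous 3)
    (z : Fin m ⊕ Fin h → K) (h0 : aeval z (CP B q R) = 0) (i : Fin m)
    (hi : aeval z (gP B q i) ≠ 0) :
    ∃ (x : Fin m → K) (y : Fin h → K), FF B q R x y = 0 ∧ gX B q x y i ≠ 0 ∧ y o = 1 := by
  obtain ⟨z, h0, hi, hz⟩ : ∃ z : Fin m ⊕ Fin h → K, aeval z (CP B q R) = 0 ∧ aeval z (gP B q i) ≠ 0 ∧
      z (Sum.inr o) ≠ 0 := by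
    by_cases hz : z (Sum.inr o) = 0
    · obtain ⟨t, ht0, htd, hev⟩ := exists_curve (CP B q R) z (Pi.single (Sum.inr o) 1) (Sum.inl i) h0
        (by rw [pderiv_CP]; exact hi)
      have h2 := curve_ne (gP B q i) z (Pi.single (Sum.inr o) 1) (Sum.inl i) t _ ht0 htd hi
      obtain ⟨ε, hε, h3, h4⟩ := exists_punct ((hev.and h2).filter_mono nhdsWithin_le_nhds)
      refine ⟨_, h3, h4, ?_⟩
      simp [hz, hε]
    · exact ⟨z, h0, hi, hz⟩
  set c := (z (Sum.inr o))⁻¹ with hc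
  have hc0 : c ≠ 0 := inv_ne_zero hz
  refine ⟨c • fun i => z (Sum.inl i), c • fun k => z (Sum.inr k), ?_, ?_, ?_⟩
  · rw [FF_homog _ _ hq _ hR, ← aeval_CP, h0, mul_zero]
  · rw [gX_homog _ _ hq, Pi.smul_apply, ← aeval_gP, smul_eq_mul]
    exact mul_ne_zero (pow_ne_zero _ hc0) hi
  · simp [hc, hz]

/-- Step B -/
lemma step_B (z : Fin m ⊕ Fin h → K) (h0 : aeval z (CP B q R) = 0) (u : Fin m ⊕ Fin h)
    (hu : aeval z (pderiv u (CP B q R)) ≠ 0) (hG : GG B (fun k => z (Sum.inr k)) ≠ 0) :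
    ∃ (z : Fin m ⊕ Fin h → K) (i : Fin m), aeval z (CP B q R) = 0 ∧ aeval z (gP B q i) ≠ 0 := by
  by_cases hx : ∃ i, aeval z (gP B q i) ≠ 0
  · obtain ⟨i, hi⟩ := hx; exact ⟨z, i, h0, hi⟩
  push Not at hx
  obtain ⟨i, l, hil⟩ : ∃ i l, GG B (fun k => z (Sum.inr k)) i l ≠ 0 := by
    by_contra hcon
    push Not at hcon
    exact hG (by ext i l; exact hcon i l)
  have hv : dC (CP B q R) z (Pi.single (Sum.inl l) 1) = 0 := by
    rw [dC_apply]
    simp [Pi.single_apply, pderiv_CP, hx]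
  obtain ⟨t, ht0, htd, hev⟩ := exists_curve (CP B q R) z (Pi.single (Sum.inl l) 1) u h0 hu
  rw [hv] at htd
  have h2 := curve_ne' (gP B q i) z (Pi.single (Sum.inl l) 1) u t _ ht0 htd (by
    simp only [neg_zero, zero_div, zero_smul, add_zero]
    rw [dC_apply]
    simpa [Pi.single_apply, aeval_pderiv_gP] using hil)
  obtain ⟨ε, hε, h3, h4⟩ := exists_punct ((hev.filter_mono nhdsWithin_le_nhds).and h2)
  exact ⟨_, i, h3, h4⟩

/-- Step A -/
lemma step_A (f g : Fin 5 → Fin m) (hd : ((B o + (B o)ᵀ).submatrix f g).det ≠ 0)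
    (H2 : ∀ y : Fin h → K, y o = 0 → (GG B y).rank ≤ 2)
    (H4 : ∃ k, k ≠ o ∧ B k + (B k)ᵀ ≠ 0)
    (z : Fin m ⊕ Fin h → K) (h0 : aeval z (CP B q R) = 0) (u : Fin m ⊕ Fin h)
    (hu : aeval z (pderiv u (CP B q R)) ≠ 0) :
    ∃ (z : Fin m ⊕ Fin h → K) (i : Fin m), aeval z (CP B q R) = 0 ∧ aeval z (gP B q i) ≠ 0 := by
  by_cases hG : GG B (fun k => z (Sum.inr k)) = 0
  swap
  · exact step_B B q R z h0 u hu hG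
  rcases u with i | j
  · exact ⟨z, i, h0, by rwa [← pderiv_CP B q R]⟩
  have hrank : 5 ≤ (GG B (Pi.single o (1 : K))).rank := by
    apply rank5_of_minor _ f g
    rw [GG_single, Matrix.submatrix_map, ← RingHom.mapMatrix_apply, ← RingHom.map_det]
    simpa using hd
  have hGo : ∀ c : K, c ≠ 0 → ∀ y : Fin h → K, y o = 0 → c • GG B (Pi.single o (1 : K)) + GG B y ≠ 0 := by
    intro c hc y hy he
    have : GG B (Pi.single o (1 : K)) = (-c⁻¹) • GG B y := by
      have h1 : c • GG B (Pi.single o (1 : K)) = - GG B y := eq_neg_of_add_eq_zero_left he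
      rw [neg_smul, ← smul_neg, ← h1, smul_smul, inv_mul_cancel₀ hc, one_smul]
    have h2 := rank_smul_le' (GG B y) (-c⁻¹)
    rw [← this] at h2
    have := H2 y hy
    omega
  have main : ∃ k, k ≠ j ∧ ∀ ε t : K, ε ≠ 0 → ε • GG B (Pi.single k (1 : K)) + t • GG B (Pi.single j (1 : K)) ≠ 0 := by
    by_cases hj : j = o
    · obtain ⟨k, hk, hBk⟩ := H4
      refine ⟨k, hj ▸ hk, fun ε t hε => ?_⟩
      by_cases ht : t = 0
      · rw [ht, zero_smul, add_zero]
        intro h1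
        have h2 := (smul_eq_zero.mp h1).resolve_left hε
        apply hBk
        rw [GG_single] at h2
        ext a b
        have := congrFun (congrFun h2 a) b
        simp only [Matrix.map_apply, Matrix.zero_apply, eq_intCast, Int.cast_eq_zero] at this
        simpa using this
      · rw [hj, add_comm, ← GG_smul B ε]
        exact hGo t ht _ (by simp [Pi.single_apply, Ne.symm hk])
    · refine ⟨o, Ne.symm hj, fun ε t hε => ?_⟩
      rw [← GG_smul B t]
      exact hGo ε hε _ (by simp [Pi.single_apply, Ne.symm hj])
  obtain ⟨k, hkj, hk⟩ := main
  obtain ⟨t, ht0, htd, hev⟩ := exists_curve (CP B q R) z (Pi.single (Sum.inr k) 1) (Sum.inr j) h0 hu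
  have h2 := curve_ne _ z (Pi.single (Sum.inr k) 1) (Sum.inr j) t _ ht0 htd hu
  obtain ⟨ε, hε, h3, h4⟩ := exists_punct ((hev.and h2).filter_mono nhdsWithin_le_nhds)
  refine step_B B q R _ h3 (Sum.inr j) h4 ?_
  have e : (fun a => (z + ε • Pi.single (Sum.inr k) 1 + t ε • Pi.single (Sum.inr j) 1 : Fin m ⊕ Fin h → K) (Sum.inr a))
      = (fun a => z (Sum.inr a)) + ε • Pi.single k (1 : K) + t ε • Pi.single j (1 : K) := by
    ext a
    simp [Pi.single_apply]
  rw [e, GG_add, GG_add, hG, zero_add, GG_smul, GG_smul]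
  exact hk _ _ hε

lemma local_data (f g : Fin 5 → Fin m) (hd : ((B o + (B o)ᵀ).submatrix f g).det ≠ 0)
    (H2 : ∀ y : Fin h → K, y o = 0 → (GG B y).rank ≤ 2)
    (H4 : ∃ k, k ≠ o ∧ B k + (B k)ᵀ ≠ 0)
    (hq : ∀ j, (q j).IsHomogeneous 2) (hR : R.IsHomogeneous 3)
    (z : Fin m ⊕ Fin h → K) (h0 : aeval z (CP B q R) = 0) (u : Fin m ⊕ Fin h)
    (hu : aeval z (pderiv u (CP B q R)) ≠ 0) :
    ∃ (x : Fin m → K) (y : Fin h → K) (i : Fin m), FF B q R x y = 0 ∧ gX B q x y i ≠ 0 ∧ y o = 1 := by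
  obtain ⟨z, i, h1, h2⟩ := step_A B q R o f g hd H2 H4 z h0 u hu
  obtain ⟨x, y, h3⟩ := step_C B q R o hq hR z h1 i h2
  exact ⟨x, y, i, h3⟩
end loc


/-- local density for the fibre over `y` -/
noncomputable def rhoY {m h : ℕ} (B : Fin h → Matrix (Fin m) (Fin m) ℤ) (q : Fin m → MvPolynomial (Fin h) ℤ)
    (R : MvPolynomial (Fin h) ℤ) (y : Fin h → ℤ) (n : ℕ) : ℝ :=
  rho (AA B y) (fun i => aeval y (q i)) (aeval y R) n

section
variable {m h : ℕ} (B : Fin h → Matrix (Fin m) (Fin m) ℤ) (q : Fin m → MvPolynomial (Fin h) ℤ)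
  (R : MvPolynomial (Fin h) ℤ) (o : Fin h)

lemma local_int (hm : 1 ≤ m) (hq : ∀ j, (q j).IsHomogeneous 2) (hR : R.IsHomogeneous 3)
    (p : ℕ) [hp : Fact p.Prime]
    (X : Fin m → ℤ_[p]) (Y : Fin h → ℤ_[p]) (i : Fin m) (h0 : FF B q R X Y = 0) (hi : gX B q X Y i ≠ 0)
    (a : ℕ) (ha : Y o = a) :
    ∃ (k : ℕ) (L : ℝ) (y₀ : Fin h → ℤ), 0 < L ∧ y₀ o = a ∧ ∀ l : ℕ, Nat.Coprime l p →
      ∀ y : Fin h → ℤ, (∀ j, ((p : ℤ) ^ k) ∣ y j - l * y₀ j) → ∀ N, k ≤ N →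
        L ≤ rhoY B q R y (p ^ N) := by
  obtain ⟨v, hv⟩ : ∃ v : ℕ, ¬ ((p : ℤ_[p]) ^ (v + 1)) ∣ gX B q X Y i := by
    refine ⟨(gX B q X Y i).valuation, fun hdvd => ?_⟩
    rw [← Ideal.mem_span_singleton, ← PadicInt.norm_le_pow_iff_mem_span_pow,
      PadicInt.norm_eq_zpow_neg_valuation hi] at hdvd
    have hp1 : (1 : ℝ) < p := by exact_mod_cast hp.1.one_lt
    rw [zpow_le_zpow_iff_right₀ hp1] at hdvd
    push_cast at hdvd
    omega
  have hlift : ∀ t : ZMod (p ^ (2 * v + 1)), ∃ n : ℤ, (n : ZMod (p ^ (2 * v + 1))) = t :=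
    fun t => ZMod.intCast_surjective t
  choose x₀ hx₀ using fun i => hlift (PadicInt.toZModPow (2 * v + 1) (X i))
  choose y₀ hy₀ using fun j => hlift (PadicInt.toZModPow (2 * v + 1) (Y j))
  set y₁ := Function.update y₀ o (a : ℤ) with hy₁
  have hy₁' : ∀ j, ((y₁ j : ℤ) : ZMod (p ^ (2 * v + 1))) = PadicInt.toZModPow (2 * v + 1) (Y j) := by
    intro j
    by_cases hj : j = o
    · subst hj; simp [hy₁, ha]
    · simp [hy₁, hj, hy₀]
  have down : ∀ (n : ℤ) (t : ℤ_[p]) (w : ℕ), w ≤ 2 * v + 1 →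
      (n : ZMod (p ^ (2 * v + 1))) = PadicInt.toZModPow (2 * v + 1) t →
      (n : ZMod (p ^ w)) = PadicInt.toZModPow w t := by
    intro n t w hw hn
    rw [← PadicInt.cast_toZModPow w (2 * v + 1) hw, ← hn, ZMod.cast_intCast (pow_dvd_pow p hw)]
  refine ⟨2 * v + 1, 1 / (p : ℝ) ^ ((2 * v + 1) * (m - 1)), y₁, ?_, by simp [hy₁], ?_⟩
  · have : (0 : ℝ) < p := by exact_mod_cast hp.1.pos
    positivity
  intro l hl y hy N hN
  have hyc : ∀ w, w ≤ 2 * v + 1 → ∀ j, (y j : ZMod (p ^ w)) = l * PadicInt.toZModPow w (Y j) := by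
    intro w hw j
    rw [← down _ _ w hw (hy₁' j)]
    have h1 : ((p : ℤ) ^ w) ∣ y j - l * y₁ j := (pow_dvd_pow _ hw).trans (hy j)
    have h2 := (ZMod.intCast_zmod_eq_zero_iff_dvd (y j - l * y₁ j) (p ^ w)).mpr (by push_cast; exact h1)
    push_cast at h2
    linear_combination h2
  have hxc : ∀ w, w ≤ 2 * v + 1 → ∀ j, (((l : ℤ) * x₀ j : ℤ) : ZMod (p ^ w)) = l * PadicInt.toZModPow w (X j) := by
    intro w hw j
    rw [← down _ _ w hw (hx₀ j)]; push_cast; rfl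
  refine rho_ge_pow hm _ _ _ p hp.1 (fun j => (l : ℤ) * x₀ j) i v N hN ?_ ?_
  · have h1 := FF_map (Int.castRingHom (ZMod (p ^ (2 * v + 1)))) B q R (fun j => (l : ℤ) * x₀ j) y
    simp only [eq_intCast, hyc _ le_rfl, hxc _ le_rfl] at h1
    have h2 := FF_homog B q hq R hR (l : ZMod (p ^ (2 * v + 1)))
      (fun j => PadicInt.toZModPow (2 * v + 1) (X j)) (fun j => PadicInt.toZModPow (2 * v + 1) (Y j))
    rw [← FF_map, h0, map_zero, mul_zero] at h2
    have h3 : ((FF B q R (fun j => (l : ℤ) * x₀ j) y : ℤ) : ZMod (p ^ (2 * v + 1))) = 0 := h1.trans h2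
    rw [ZMod.intCast_zmod_eq_zero_iff_dvd] at h3
    push_cast at h3
    exact h3
  · intro hdvd
    have h1 := gX_map (Int.castRingHom (ZMod (p ^ (v + 1)))) B q (fun j => (l : ℤ) * x₀ j) y i
    have hle : v + 1 ≤ 2 * v + 1 := by omega
    simp only [eq_intCast, hyc _ hle, hxc _ hle] at h1
    have h2 := gX_homog B q hq (l : ZMod (p ^ (v + 1)))
      (fun j => PadicInt.toZModPow (v + 1) (X j)) (fun j => PadicInt.toZModPow (v + 1) (Y j))
    have h3 := h1.trans (congrFun h2 i)
    rw [Pi.smul_apply, ← gX_map] at h3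
    have h4 : ((gX B q (fun j => (l : ℤ) * x₀ j) y i : ℤ) : ZMod (p ^ (v + 1))) = 0 := by
      rw [ZMod.intCast_zmod_eq_zero_iff_dvd]; push_cast; exact hdvd
    rw [h4, smul_eq_mul] at h3
    have hu : IsUnit ((l : ZMod (p ^ (v + 1))) ^ 2) :=
      ((ZMod.isUnit_iff_coprime l _).mpr (Nat.Coprime.pow_right _ hl)).pow 2
    have h5 := (hu.mul_right_eq_zero).mp h3.symm
    apply hv
    rw [← Ideal.mem_span_singleton, ← PadicInt.ker_toZModPow]
    exact h5

lemma local_int' (hm : 1 ≤ m) (hq : ∀ j, (q j).IsHomogeneous 2) (hR : R.IsHomogeneous 3)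
    (p : ℕ) [hp : Fact p.Prime]
    (x : Fin m → ℚ_[p]) (y : Fin h → ℚ_[p]) (i : Fin m) (h0 : FF B q R x y = 0) (hi : gX B q x y i ≠ 0)
    (ho : y o = 1) :
    ∃ s : ℕ, ∀ a : ℕ, a ≠ 0 → p ^ s ∣ a →
    ∃ (k : ℕ) (L : ℝ) (y₀ : Fin h → ℤ), 0 < L ∧ y₀ o = a ∧ ∀ l : ℕ, Nat.Coprime l p →
      ∀ y : Fin h → ℤ, (∀ j, ((p : ℤ) ^ k) ∣ y j - l * y₀ j) → ∀ N, k ≤ N →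
        L ≤ rhoY B q R y (p ^ N) := by
  obtain ⟨s, hs⟩ := PadicInt.exists_pow_neg_lt p (ε := 1 / (‖x‖ + ‖y‖ + 1)) (by positivity)
  refine ⟨s, fun a ha hsa => ?_⟩
  have hna : ‖(a : ℚ_[p])‖ ≤ 1 / (‖x‖ + ‖y‖ + 1) := by
    obtain ⟨b, rfl⟩ := hsa
    push_cast
    rw [norm_mul, Padic.norm_p_pow]
    have : ‖(b : ℚ_[p])‖ ≤ 1 := by exact_mod_cast Padic.norm_int_le_one (b : ℤ)
    calc _ ≤ (p : ℝ) ^ (-(s : ℤ)) * 1 := by gcongr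
      _ ≤ _ := by rw [mul_one]; exact hs.le
  have hpos : 0 < ‖x‖ + ‖y‖ + 1 := by positivity
  have hbnd0 : ∀ w : ℚ_[p], ‖w‖ ≤ ‖x‖ + ‖y‖ → ‖(a : ℚ_[p]) * w‖ ≤ 1 := by
    intro w hw
    rw [norm_mul]
    calc _ ≤ 1 / (‖x‖ + ‖y‖ + 1) * (‖x‖ + ‖y‖ + 1) := by gcongr; linarith
      _ = 1 := by field_simp
  have hX : ∀ j, ‖(a : ℚ_[p]) * x j‖ ≤ 1 := fun j => hbnd0 _ (by
    have := norm_le_pi_norm x j; have := norm_nonneg y; linarith)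
  have hY : ∀ j, ‖(a : ℚ_[p]) * y j‖ ≤ 1 := fun j => hbnd0 _ (by
    have := norm_le_pi_norm y j; have := norm_nonneg x; linarith)
  have inj : Function.Injective (PadicInt.Coe.ringHom (p := p)) := fun u v huv => Subtype.ext huv
  have ha0 : (a : ℚ_[p]) ≠ 0 := by exact_mod_cast ha
  obtain ⟨XX, hXX⟩ : ∃ X : Fin m → ℤ_[p], ∀ j, PadicInt.Coe.ringHom (X j) = (a : ℚ_[p]) * x j :=
    ⟨fun j => (⟨_, hX j⟩ : ℤ_[p]), fun j => rfl⟩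
  obtain ⟨YY, hYY⟩ : ∃ X : Fin h → ℤ_[p], ∀ j, PadicInt.Coe.ringHom (X j) = (a : ℚ_[p]) * y j :=
    ⟨fun j => (⟨_, hY j⟩ : ℤ_[p]), fun j => rfl⟩
  refine local_int B q R o hm hq hR p XX YY i ?_ ?_ a ?_
  · apply inj
    rw [FF_map, map_zero]
    simp only [hXX, hYY]
    have := FF_homog B q hq R hR (a : ℚ_[p]) x y
    rw [h0, mul_zero] at this
    exact this
  · intro hc
    have h1 := gX_map (PadicInt.Coe.ringHom (p := p)) B q XX YY i
    rw [hc, map_zero] at h1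
    simp only [hXX, hYY] at h1
    have := congrFun (gX_homog B q hq (a : ℚ_[p]) x y) i
    have h2 : (0 : ℚ_[p]) = a ^ 2 * gX B q x y i := h1.trans this
    exact mul_ne_zero (pow_ne_zero _ ha0) hi h2.symm
  · apply inj
    simp [hYY, ho]

/-- global congruence data at primes `≤ W` -/
lemma glob_data (hm : 1 ≤ m) (hq : ∀ j, (q j).IsHomogeneous 2) (hR : R.IsHomogeneous 3)
    (hloc : ∀ (p : ℕ) [Fact p.Prime], ∃ (x : Fin m → ℚ_[p]) (y : Fin h → ℚ_[p]) (i : Fin m),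
      FF B q R x y = 0 ∧ gX B q x y i ≠ 0 ∧ y o = 1) (W : ℕ) :
    ∃ (a M : ℕ) (L : ℕ → ℝ) (ys : Fin h → ℤ), 0 < a ∧ 0 < M ∧ (∀ p, 0 < L p) ∧ ys o = a ∧
      (∀ p, p.Prime → p ∣ a → p < W) ∧ (∀ p, p.Prime → p ∣ M → p < W) ∧
      ∀ p, p.Prime → p < W → ∀ l : ℕ, Nat.Coprime l p → ∀ y : Fin h → ℤ,
        (∀ j, (M : ℤ) ∣ y j - l * ys j) → ∀ᶠ N in Filter.atTop, L p ≤ rhoY B q R y (p ^ N) := by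
  classical
  have H : ∀ p : ℕ, ∃ s : ℕ, p.Prime → ∀ a : ℕ, a ≠ 0 → p ^ s ∣ a →
    ∃ (k : ℕ) (L : ℝ) (y₀ : Fin h → ℤ), 0 < L ∧ y₀ o = a ∧ ∀ l : ℕ, Nat.Coprime l p →
      ∀ y : Fin h → ℤ, (∀ j, ((p : ℤ) ^ k) ∣ y j - l * y₀ j) → ∀ N, k ≤ N →
        L ≤ rhoY B q R y (p ^ N) := by
    intro p
    by_cases hp : p.Prime
    · have : Fact p.Prime := ⟨hp⟩
      obtain ⟨x, y, i, h1, h2, h3⟩ := hloc p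
      obtain ⟨s, hs⟩ := local_int' B q R o hm hq hR p x y i h1 h2 h3
      exact ⟨s, fun _ => hs⟩
    · exact ⟨0, fun h => absurd h hp⟩
  choose s hs using H
  set T := Nat.primesBelow W with hT
  have hTp : ∀ p ∈ T, p.Prime := fun p hp => Nat.prime_of_mem_primesBelow hp
  set a := ∏ p ∈ T, p ^ s p with ha
  have ha0 : a ≠ 0 := Finset.prod_ne_zero_iff.mpr fun p hp => pow_ne_zero _ (hTp p hp).ne_zero
  have H2 : ∀ p : T, ∃ (k : ℕ) (L : ℝ) (y₀ : Fin h → ℤ), 0 < L ∧ y₀ o = a ∧ ∀ l : ℕ, Nat.Coprime l p →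
      ∀ y : Fin h → ℤ, (∀ j, ((p : ℤ) ^ k) ∣ y j - l * y₀ j) → ∀ N, k ≤ N →
        L ≤ rhoY B q R y (p ^ N) :=
    fun p => hs p (hTp p p.2) a ha0 (Finset.dvd_prod_of_mem (fun p => p ^ s p) p.2)
  choose k L y₀ hL hy₀ hk using H2
  have hcop : Pairwise (Function.onFun IsCoprime fun p : T => Ideal.span {((p : ℕ) : ℤ) ^ k p}) := by
    intro p p' hne
    rw [Function.onFun, Ideal.isCoprime_span_singleton_iff]
    apply IsCoprime.pow
    rw [Nat.isCoprime_iff_coprime]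
    exact (Nat.coprime_primes (hTp p p.2) (hTp p' p'.2)).mpr fun h => hne (Subtype.ext h)
  choose ys hys using fun j : Fin h => Ideal.exists_forall_sub_mem_ideal hcop (fun p => y₀ p j)
  set M := ∏ p : T, (p : ℕ) ^ k p with hM
  refine ⟨a, M, fun p => if hp : p ∈ T then L ⟨p, hp⟩ else 1, Function.update ys o a,
    Nat.pos_of_ne_zero ha0, Finset.prod_pos fun p _ => pow_pos (hTp p p.2).pos _, ?_, by simp, ?_, ?_, ?_⟩
  · intro p; dsimp only; split_ifs
    · exact hL _
    · exact one_pos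
  · intro p hp hpa
    obtain ⟨p', hp', hd⟩ := (hp.prime.dvd_finsetProd_iff _).mp hpa
    have := (Nat.prime_dvd_prime_iff_eq hp (hTp _ hp')).mp (hp.dvd_of_dvd_pow hd)
    exact this ▸ Nat.lt_of_mem_primesBelow hp'
  · intro p hp hpa
    obtain ⟨p', hp', hd⟩ := (hp.prime.dvd_finsetProd_iff _).mp hpa
    have := (Nat.prime_dvd_prime_iff_eq hp (hTp _ p'.2)).mp (hp.dvd_of_dvd_pow hd)
    exact this ▸ Nat.lt_of_mem_primesBelow p'.2
  · intro p hp hpW l hl y hy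
    have hpT : p ∈ T := Nat.mem_primesBelow.mpr ⟨hpW, hp⟩
    simp only [dif_pos hpT]
    filter_upwards [Filter.eventually_ge_atTop (k ⟨p, hpT⟩)] with N hN
    refine hk ⟨p, hpT⟩ l hl y (fun j => ?_) N hN
    have h1 : ((p : ℤ) ^ k ⟨p, hpT⟩) ∣ (M : ℤ) := by
      have : p ^ k ⟨p, hpT⟩ ∣ M := Finset.dvd_prod_of_mem (fun p : T => (p : ℕ) ^ k p) (Finset.mem_univ (⟨p, hpT⟩ : T))
      exact_mod_cast this
    have h2 := h1.trans (hy j)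
    have h3 : ((p : ℤ) ^ k ⟨p, hpT⟩) ∣ Function.update ys o (a : ℤ) j - y₀ ⟨p, hpT⟩ j := by
      by_cases hj : j = o
      · subst hj; simp [hy₀]
      · rw [Function.update_of_ne hj]
        exact Ideal.mem_span_singleton.mp (hys j ⟨p, hpT⟩)
    have := dvd_add h2 (h3.mul_left (l : ℤ))
    have e : y j - (l : ℤ) * y₀ ⟨p, hpT⟩ j = (y j - l * Function.update ys o (a : ℤ) j) +
      l * (Function.update ys o (a : ℤ) j - y₀ ⟨p, hpT⟩ j) := by ring
    rw [e]; exact this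
end


lemma rank_add_le' {K : Type*} [Field K] {m : ℕ} (M N : Matrix (Fin m) (Fin m) K) :
    (M + N).rank ≤ M.rank + N.rank := by
  unfold Matrix.rank
  rw [Matrix.mulVecLin_add]
  exact (Submodule.finrank_mono (LinearMap.range_add_le _ _)).trans
    (Submodule.finrank_add_le_finrank_add_finrank _ _)

lemma weierstrass (s : Finset ℕ) (a : ℕ → ℝ) (h0 : ∀ i ∈ s, 0 ≤ a i) (h1 : ∀ i ∈ s, a i ≤ 1) :
    1 - ∑ i ∈ s, a i ≤ ∏ i ∈ s, (1 - a i) ∧ ∏ i ∈ s, (1 - a i) ≤ 1 ∧ 0 ≤ ∏ i ∈ s, (1 - a i) := by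
  classical
  induction s using Finset.induction_on with
  | empty => simp
  | insert i s hi ih =>
    obtain ⟨e1, e2, e3⟩ := ih (fun j hj => h0 j (Finset.mem_insert_of_mem hj))
      (fun j hj => h1 j (Finset.mem_insert_of_mem hj))
    have a0 := h0 i (Finset.mem_insert_self _ _)
    have a1 := h1 i (Finset.mem_insert_self _ _)
    rw [Finset.sum_insert hi, Finset.prod_insert hi]
    refine ⟨?_, ?_, ?_⟩
    · nlinarith
    · nlinarith
    · exact mul_nonneg (by linarith) e3

lemma prod_one_sub_sq (n : ℕ) : (1 : ℝ) / 2 ≤ ∏ p ∈ Nat.primesBelow n, (1 - 1 / (p : ℝ) ^ 2) := by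
  have h1 : ∀ n : ℕ, (1 : ℝ) / 2 + 1 / (2 * (n + 1)) ≤ ∏ k ∈ Finset.range n, (1 - 1 / ((k + 2 : ℕ) : ℝ) ^ 2) := by
    intro n
    induction n with
    | zero => norm_num
    | succ n ih =>
      rw [Finset.prod_range_succ]
      have h2 : (0 : ℝ) ≤ 1 - 1 / ((n + 2 : ℕ) : ℝ) ^ 2 := by
        have : (1 : ℝ) ≤ ((n + 2 : ℕ) : ℝ) ^ 2 := by
          apply one_le_pow₀; push_cast; linarith [(Nat.cast_nonneg n : (0:ℝ) ≤ n)]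
        rw [sub_nonneg, div_le_one (by linarith)]; exact this
      refine le_trans (le_of_eq ?_) (mul_le_mul_of_nonneg_right ih h2)
      push_cast
      have : (n : ℝ) + 1 ≠ 0 := by positivity
      have : (n : ℝ) + 2 ≠ 0 := by positivity
      have : (n : ℝ) + 1 + 1 ≠ 0 := by positivity
      field_simp
      ring
  have h3 := h1 n
  have h4 : (0 : ℝ) ≤ 1 / (2 * ((n : ℝ) + 1)) := by positivity
  have h5 : ∏ k ∈ Finset.range n, (1 - 1 / ((k + 2 : ℕ) : ℝ) ^ 2) =
      ∏ p ∈ (Finset.range n).map (addRightEmbedding 2), (1 - 1 / (p : ℝ) ^ 2) := by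
    rw [Finset.prod_map]; rfl
  rw [h5] at h3
  refine le_trans (by linarith) (h3.trans ?_)
  have hge : ∀ p : ℕ, 2 ≤ p → (1 : ℝ) / (p : ℝ) ^ 2 ≤ 1 := by
    intro p hp
    have : (1 : ℝ) ≤ p := by exact_mod_cast (by omega : 1 ≤ p)
    rw [div_le_one (by positivity)]; exact one_le_pow₀ this
  have hmem : ∀ p ∈ (Finset.range n).map (addRightEmbedding 2), 2 ≤ p := by
    intro p hp; simp at hp; omega
  apply Finset.prod_le_prod_of_subset_of_le_one
  · intro p hp
    have h6 := (Nat.prime_of_mem_primesBelow hp).two_le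
    have h7 := Nat.lt_of_mem_primesBelow hp
    simp only [Finset.mem_map, Finset.mem_range, addRightEmbedding_apply]
    exact ⟨p - 2, by omega, by omega⟩
  · intro p hp; linarith [hge p (hmem p hp)]
  · intro p hp _
    have : (0 : ℝ) ≤ 1 / (p : ℝ) ^ 2 := by positivity
    linarith

/-- existence of a good isotropic vector -/
def Iso {m h : ℕ} (B : Fin h → Matrix (Fin m) (Fin m) ℤ) {l : ℕ} (z : Fin h → ZMod l) : Prop :=
  ∃ e : Fin m → ZMod l, e ⬝ᵥ AA B z *ᵥ e = 0 ∧ GG B z *ᵥ e ≠ 0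

section
variable {m h : ℕ} (B : Fin h → Matrix (Fin m) (Fin m) ℤ) (q : Fin m → MvPolynomial (Fin h) ℤ)
  (R : MvPolynomial (Fin h) ℤ) (o : Fin h)

/-- `5×5` minor of the pencil -/
def DD (f g : Fin 5 → Fin m) {S : Type*} [CommRing S] (y : Fin h → S) : S :=
  ((GG B y).submatrix f g).det

lemma DD_map (f g : Fin 5 → Fin m) {S T : Type*} [CommRing S] [CommRing T] (φ : S →+* T) (y : Fin h → S) :
    φ (DD B f g y) = DD B f g (fun k => φ (y k)) := by
  rw [DD, DD, ← GG_map, Matrix.submatrix_map, RingHom.map_det, RingHom.mapMatrix_apply]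

lemma fac_rank5 (hm : 1 ≤ m) (f g : Fin 5 → Fin m) (y : Fin h → ℤ) (p : ℕ) (hp : p.Prime)
    (hD : ¬ (p : ℤ) ∣ DD B f g y) (N : ℕ) (hN : 1 ≤ N) : 1 - 1 / (p : ℝ) ^ 2 ≤ rhoY B q R y (p ^ N) := by
  have : Fact p.Prime := ⟨hp⟩
  refine rho_ge_rank5 hm _ _ _ p hp N hN ?_
  refine rank5_of_minor _ f g ?_
  have h1 := DD_map B f g (Int.castRingHom (ZMod p)) y
  rw [DD, DD, ← GG_map, eq_intCast] at h1
  intro h2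
  have h3 := h1.trans h2
  rw [ZMod.intCast_zmod_eq_zero_iff_dvd] at h3
  exact hD h3

lemma fac_rank3 (hm : 1 ≤ m) (f g : Fin 5 → Fin m)
    (H2 : ∀ (K : Type) [Field K] (y : Fin h → K), y o = 0 → (GG B y).rank ≤ 2)
    (y : Fin h → ℤ) (p : ℕ) (hp : p.Prime)
    (hD : ¬ (p : ℤ) ∣ ((B o + (B o)ᵀ).submatrix f g).det) (hy : ¬ (p : ℤ) ∣ y o)
    (N : ℕ) (hN : 1 ≤ N) : 1 - 1 / (p : ℝ) ≤ rhoY B q R y (p ^ N) := by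
  have : Fact p.Prime := ⟨hp⟩
  refine rho_ge_rank3 hm _ _ _ p hp N hN ?_
  change 3 ≤ ((GG B y).map (Int.castRingHom (ZMod p))).rank
  rw [GG_map]
  set w : Fin h → ZMod p := fun k => Int.castRingHom (ZMod p) (y k) with hw
  have hwo : w o ≠ 0 := by
    simp only [hw, eq_intCast]
    rwa [Ne, ZMod.intCast_zmod_eq_zero_iff_dvd]
  have h5 : 5 ≤ (GG B (Pi.single o (1 : ZMod p))).rank := by
    apply rank5_of_minor _ f g
    rw [GG_single, Matrix.submatrix_map, ← RingHom.mapMatrix_apply, ← RingHom.map_det, eq_intCast]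
    rwa [Ne, ZMod.intCast_zmod_eq_zero_iff_dvd]
  set z : Fin h → ZMod p := Pi.single o (1 : ZMod p) - (w o)⁻¹ • w with hz
  have hzo : z o = 0 := by simp [hz, hwo]
  have h6 : GG B (Pi.single o (1 : ZMod p)) = (w o)⁻¹ • GG B w + GG B z := by
    rw [← GG_smul, ← GG_add, hz]; congr 1; abel
  have h7 := rank_add_le' ((w o)⁻¹ • GG B w) (GG B z)
  rw [← h6] at h7
  have h8 := rank_smul_le' (GG B w) (w o)⁻¹
  have h9 := H2 (ZMod p) z hzo
  omega

lemma fac_iso (hm : 1 ≤ m) (y : Fin h → ℤ) (p : ℕ) (hp : p.Prime)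
    (hi : Iso B (fun k => (y k : ZMod p))) (N : ℕ) (hN : 1 ≤ N) : 1 - 1 / (p : ℝ) ≤ rhoY B q R y (p ^ N) := by
  obtain ⟨e, h1, h2⟩ := hi
  have h3 := AA_map (Int.castRingHom (ZMod p)) B y
  refine rho_ge_iso1 hm _ _ _ p hp N hN e ?_ ?_
  · rw [h3]; exact h1
  · rw [h3]; exact h2

lemma sing_lower (hm : 1 ≤ m) (f g : Fin 5 → Fin m)
    (H2 : ∀ (K : Type) [Field K] (y : Fin h → K), y o = 0 → (GG B y).rank ≤ 2)
    (W : ℕ) (L : ℕ → ℝ) (hL0 : ∀ p, 0 < L p) (y : Fin h → ℤ) (l : ℕ) (hl : l.Prime)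
    (hlW : W ≤ l)
    (hL : ∀ p, p.Prime → p < W → ∀ᶠ N in Filter.atTop, L p ≤ rhoY B q R y (p ^ N))
    (hd : ∀ p, p.Prime → W ≤ p → ¬ (p : ℤ) ∣ ((B o + (B o)ᵀ).submatrix f g).det)
    (hyo : ∀ p, p.Prime → W ≤ p → p ≠ l → ¬ (p : ℤ) ∣ y o)
    (hiso : Iso B (fun k => (y k : ZMod l)))
    (hD : DD B f g y ≠ 0)
    (hsum : ∑ p ∈ (DD B f g y).natAbs.primeFactors.filter (fun p => W ≤ p ∧ p ≠ l), 1 / (p : ℝ) ≤ 1 / 2) :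
    (∏ p ∈ Nat.primesBelow W, min (L p) 1) / 8 ≤ (singSeries m (fun x => FF B q R x y)).re := by
  classical
  set u : ℕ → ℝ := fun p => if p < W then min (L p) 1 else 1 with hu
  set v : ℕ → ℝ := fun p => 1 - 1 / (p : ℝ) ^ 2 with hv
  set w : ℕ → ℝ := fun p => if (p : ℤ) ∣ DD B f g y ∧ W ≤ p ∧ p ≠ l then 1 - 1 / (p : ℝ) else 1 with hw
  set x : ℕ → ℝ := fun p => if p = l then 1 - 1 / (p : ℝ) else 1 with hx
  have hp1 : ∀ p : ℕ, p.Prime → (0 : ℝ) ≤ 1 / p ∧ (1 : ℝ) / p ≤ 1 / 2 := by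
    intro p hp
    have : (2 : ℝ) ≤ p := by exact_mod_cast hp.two_le
    exact ⟨by positivity, by gcongr⟩
  have hu0 : ∀ p, 0 < u p ∧ u p ≤ 1 := by
    intro p; simp only [hu]; split_ifs
    · exact ⟨lt_min (hL0 p) one_pos, min_le_right _ _⟩
    · norm_num
  have hv0 : ∀ p : ℕ, p.Prime → 0 ≤ v p ∧ v p ≤ 1 := by
    intro p hp
    obtain ⟨e1, e2⟩ := hp1 p hp
    have : (1 : ℝ) / (p : ℝ) ^ 2 = (1 / p) ^ 2 := by rw [_root_.one_div_pow]
    simp only [hv, this]; constructor <;> nlinarith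
  have hw0 : ∀ p : ℕ, p.Prime → 0 ≤ w p ∧ w p ≤ 1 := by
    intro p hp
    obtain ⟨e1, e2⟩ := hp1 p hp
    simp only [hw]; split_ifs <;> constructor <;> linarith
  have hx0 : ∀ p : ℕ, p.Prime → 0 ≤ x p ∧ x p ≤ 1 := by
    intro p hp
    obtain ⟨e1, e2⟩ := hp1 p hp
    simp only [hx]; split_ifs <;> constructor <;> linarith
  refine singSeries_ge (AA B y) (fun i => aeval y (q i)) (aeval y R) f g hD
    (fun p => u p * v p * w p * x p) ?_ ?_ _ ?_
  · intro p hp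
    exact mul_nonneg (mul_nonneg (mul_nonneg (hu0 p).1.le (hv0 p hp).1) (hw0 p hp).1) (hx0 p hp).1
  · intro p hp
    obtain ⟨u1, u2⟩ := hu0 p
    obtain ⟨v1, v2⟩ := hv0 p hp
    obtain ⟨w1, w2⟩ := hw0 p hp
    obtain ⟨x1, x2⟩ := hx0 p hp
    by_cases hpW : p < W
    · filter_upwards [hL p hp hpW] with N hN
      refine le_trans ?_ hN
      have : u p ≤ L p := by simp only [hu, if_pos hpW]; exact min_le_left _ _
      calc u p * v p * w p * x p ≤ u p * 1 * 1 * 1 := by gcongr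
        _ ≤ L p := by linarith
    · filter_upwards [Filter.eventually_ge_atTop 1] with N hN
      by_cases hpl : p = l
      · refine le_trans ?_ (fac_iso B q R hm y p hp (hpl ▸ hiso) N hN)
        have : x p = 1 - 1 / (p : ℝ) := by simp only [hx, if_pos hpl]
        rw [← this]
        calc u p * v p * w p * x p ≤ 1 * 1 * 1 * x p := by gcongr
          _ = x p := by ring
      · by_cases hpD : (p : ℤ) ∣ DD B f g y
        · refine le_trans ?_ (fac_rank3 B q R o hm f g H2 y p hp (hd p hp (not_lt.mp hpW))
            (hyo p hp (not_lt.mp hpW) hpl) N hN)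
          have : w p = 1 - 1 / (p : ℝ) := by
            simp only [hw]; rw [if_pos ⟨hpD, not_lt.mp hpW, hpl⟩]
          rw [← this]
          calc u p * v p * w p * x p ≤ 1 * 1 * w p * 1 := by gcongr
            _ = w p := by ring
        · refine le_trans ?_ (fac_rank5 B q R hm f g y p hp hpD N hN)
          calc u p * v p * w p * x p ≤ 1 * v p * 1 * 1 := by gcongr
            _ = v p := by ring
  · intro n
    simp only [Finset.prod_mul_distrib]
    have hpr : ∀ p ∈ Nat.primesBelow n, p.Prime := fun p hp => Nat.prime_of_mem_primesBelow hp
    have U : ∏ p ∈ Nat.primesBelow W, min (L p) 1 ≤ ∏ p ∈ Nat.primesBelow n, u p := by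
      have e1 : ∏ p ∈ Nat.primesBelow W, min (L p) 1 = ∏ p ∈ Nat.primesBelow W, u p := by
        refine Finset.prod_congr rfl fun p hp => ?_
        simp only [hu, if_pos (Nat.lt_of_mem_primesBelow hp)]
      have e2 : ∏ p ∈ Nat.primesBelow (max n W), u p = ∏ p ∈ Nat.primesBelow W, u p := by
        refine (Finset.prod_subset ?_ ?_).symm
        · intro p hp; rw [Nat.mem_primesBelow] at hp ⊢; exact ⟨by omega, hp.2⟩
        · intro p hp hp'
          rw [Nat.mem_primesBelow] at hp hp'
          simp only [hu]; rw [if_neg fun h => hp' ⟨h, hp.2⟩]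
      rw [e1, ← e2]
      apply Finset.prod_le_prod_of_subset_of_le_one
      · intro p hp; rw [Nat.mem_primesBelow] at hp ⊢; exact ⟨by omega, hp.2⟩
      · intro p _; exact (hu0 p).1.le
      · intro p _ _; exact (hu0 p).2
    have V : (1 : ℝ) / 2 ≤ ∏ p ∈ Nat.primesBelow n, v p := prod_one_sub_sq n
    have Wd : (1 : ℝ) / 2 ≤ ∏ p ∈ Nat.primesBelow n, w p := by
      set a : ℕ → ℝ := fun p => if (p : ℤ) ∣ DD B f g y ∧ W ≤ p ∧ p ≠ l then 1 / (p : ℝ) else 0 with ha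
      have e1 : ∀ p, w p = 1 - a p := by intro p; simp only [hw, ha]; split_ifs <;> simp
      simp only [e1]
      have e2 := (weierstrass (Nat.primesBelow n) a ?_ ?_).1
      · refine le_trans ?_ e2
        have e3 : ∑ p ∈ Nat.primesBelow n, a p ≤ 1 / 2 := by
          refine le_trans ?_ hsum
          simp only [ha]
          rw [← Finset.sum_filter]
          refine Finset.sum_le_sum_of_subset_of_nonneg ?_ ?_
          · intro p hp
            rw [Finset.mem_filter] at hp ⊢
            refine ⟨Nat.mem_primeFactors.mpr ⟨hpr p hp.1, Int.natCast_dvd.mp hp.2.1, ?_⟩, hp.2.2⟩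
            rwa [Ne, Int.natAbs_eq_zero]
          · intro p _ _; positivity
        linarith
      · intro p hp; simp only [ha]; split_ifs
        · exact (hp1 p (hpr p hp)).1
        · exact le_rfl
      · intro p hp; simp only [ha]; split_ifs
        · linarith [(hp1 p (hpr p hp)).2]
        · exact zero_le_one
    have Xd : (1 : ℝ) / 2 ≤ ∏ p ∈ Nat.primesBelow n, x p := by
      simp only [hx]
      rw [Finset.prod_ite_eq']
      split_ifs
      · linarith [(hp1 l hl).2]
      · norm_num
    have U0 : 0 ≤ ∏ p ∈ Nat.primesBelow W, min (L p) 1 :=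
      Finset.prod_nonneg fun p _ => (lt_min (hL0 p) one_pos).le
    calc (∏ p ∈ Nat.primesBelow W, min (L p) 1) / 8
        = (∏ p ∈ Nat.primesBelow W, min (L p) 1) * (1 / 2) * (1 / 2) * (1 / 2) := by ring
      _ ≤ _ := by
        have U1 := U0.trans U
        have V1 : 0 ≤ ∏ p ∈ Nat.primesBelow n, v p := by linarith
        have W1 : 0 ≤ ∏ p ∈ Nat.primesBelow n, w p := by linarith
        have i1 := mul_nonneg U1 V1
        have i2 := mul_nonneg i1 W1
        gcongr
end


lemma card_comp_eq {J : Type*} [Fintype J] [DecidableEq J] {N : ℕ} {Z : Type*} [Fintype Z] [DecidableEq Z]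
    (φ : J → Fin N → Z) (P : (J → Z) → Prop) [DecidablePred P] :
    (Finset.univ.filter fun w : J → Fin N => P (fun j => φ j (w j))).card =
      ∑ u ∈ Finset.univ.filter P, ∏ j, (Finset.univ.filter fun i => φ j i = u j).card := by
  rw [Finset.card_eq_sum_card_fiberwise (f := fun w j => φ j (w j)) (t := Finset.univ.filter P)]
  · refine Finset.sum_congr rfl fun u hu => ?_
    rw [← Fintype.card_piFinset]
    congr 1
    ext w
    simp only [Finset.mem_filter, Finset.mem_univ, true_and, Fintype.mem_piFinset] at hu ⊢
    constructor
    · rintro ⟨_, h2⟩ j; exact congrFun h2 j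
    · intro h2
      have : (fun j => φ j (w j)) = u := _root_.funext h2
      exact ⟨this ▸ hu, this⟩
  · intro w hw
    simpa using hw

open Classical in
lemma fiber_le (N p M : ℕ) (hp : p.Prime) (hM : Nat.Coprime M p) (c u : ZMod p) :
    (Finset.univ.filter fun i : Fin N => c + (M : ZMod p) * ((i : ℕ) : ZMod p) = u).card ≤ N / p + 1 := by
  have : Fact p.Prime := ⟨hp⟩
  rw [← Finset.card_range (N / p + 1)]
  refine Finset.card_le_card_of_injOn (fun i => (i : ℕ) / p) ?_ ?_
  · intro i _
    simp only [Finset.coe_range, Set.mem_Iio]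
    exact Nat.lt_succ_of_le (Nat.div_le_div_right i.2.le)
  · intro i hi i' hi' he
    simp only [Finset.coe_filter, Finset.mem_univ, true_and, Set.mem_ofPred_eq] at hi hi'
    have hMu : (M : ZMod p) ≠ 0 := by
      rw [Ne, ZMod.natCast_eq_zero_iff]
      intro hd
      exact hp.one_lt.ne' (Nat.dvd_one.mp (hM ▸ Nat.dvd_gcd hd dvd_rfl))
    have h1 : ((i : ℕ) : ZMod p) = ((i' : ℕ) : ZMod p) := by
      apply mul_left_cancel₀ hMu
      linear_combination hi - hi'
    rw [ZMod.natCast_eq_natCast_iff'] at h1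
    have he' : (i : ℕ) / p = (i' : ℕ) / p := he
    apply Fin.ext
    rw [← Nat.div_add_mod (i : ℕ) p, ← Nat.div_add_mod (i' : ℕ) p, h1, he']

open Classical in
lemma fiber_ge (p s M : ℕ) (hp : p.Prime) (hM : Nat.Coprime M p) (c u : ZMod p) :
    s ≤ (Finset.univ.filter fun i : Fin (p * s) => c + (M : ZMod p) * ((i : ℕ) : ZMod p) = u).card := by
  have : Fact p.Prime := ⟨hp⟩
  have hMu : (M : ZMod p) ≠ 0 := by
    rw [Ne, ZMod.natCast_eq_zero_iff]
    intro hd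
    exact hp.one_lt.ne' (Nat.dvd_one.mp (hM ▸ Nat.dvd_gcd hd dvd_rfl))
  set v : ZMod p := (M : ZMod p)⁻¹ * (u - c) with hv
  have hlt : ∀ t : Fin s, v.val + p * t < p * s := by
    intro t
    have h1 := ZMod.val_lt v
    have h2 : (t : ℕ) + 1 ≤ s := t.2
    calc v.val + p * t < p + p * t := by omega
      _ = p * (t + 1) := by ring
      _ ≤ p * s := Nat.mul_le_mul_left _ h2
  have hs : s = (Finset.univ : Finset (Fin s)).card := by simp
  refine hs.le.trans ?_
  refine Finset.card_le_card_of_injOn (fun t => ⟨v.val + p * t, hlt t⟩) ?_ ?_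
  · intro t _
    rw [Finset.mem_coe, Finset.mem_filter]
    refine ⟨Finset.mem_univ _, ?_⟩
    push_cast
    rw [ZMod.natCast_zmod_val, ZMod.natCast_self, zero_mul, add_zero, hv, ← mul_assoc, mul_inv_cancel₀ hMu]
    ring
  · intro t _ t' _ he
    simp only [Fin.mk.injEq] at he
    apply Fin.ext
    exact Nat.eq_of_mul_eq_mul_left hp.pos (by omega)

open Polynomial in
lemma det_line_roots {K : Type*} [Field K] [Fintype K] [DecidableEq K] (A0 B0 : Matrix (Fin 5) (Fin 5) K)
    (h0 : A0.det ≠ 0) : (Finset.univ.filter fun t : K => (A0 + t • B0).det = 0).card ≤ 5 := by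
  set P : Polynomial K := Matrix.det ((Polynomial.X : Polynomial K) • B0.map Polynomial.C + A0.map Polynomial.C) with hP
  have hev : ∀ t : K, P.eval t = (A0 + t • B0).det := by
    intro t
    rw [hP, ← Polynomial.coe_evalRingHom, RingHom.map_det]
    refine congrArg Matrix.det ?_
    ext i j
    simp only [RingHom.mapMatrix_apply, Matrix.map_apply, Matrix.add_apply, Matrix.smul_apply, map_add, smul_eq_mul,
      map_mul, Polynomial.coe_evalRingHom, Polynomial.eval_mul, Polynomial.eval_X, Polynomial.eval_C]
    ring
  have hP0 : P ≠ 0 := by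
    intro h
    have := hev 0
    rw [h] at this
    simp at this
    exact h0 this.symm
  have hdeg : P.natDegree ≤ 5 := by
    have := Polynomial.natDegree_det_X_add_C_le B0 A0
    simpa using this
  calc _ ≤ P.roots.toFinset.card := by
        apply Finset.card_le_card
        intro t ht
        simp only [Finset.mem_filter, Finset.mem_univ, true_and] at ht
        rw [Multiset.mem_toFinset, Polynomial.mem_roots hP0, Polynomial.IsRoot, hev, ht]
    _ ≤ P.roots.card := Multiset.toFinset_card_le _
    _ ≤ P.natDegree := Polynomial.card_roots' _
    _ ≤ 5 := hdeg

lemma det_zero_count {K : Type*} [Field K] [Fintype K] [DecidableEq K] {J : Type*} [Fintype J] [DecidableEq J]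
    (A0 : Matrix (Fin 5) (Fin 5) K) (L : (J → K) → Matrix (Fin 5) (Fin 5) K)
    (hL : ∀ (t : K) u, L (t • u) = t • L u) (h0 : A0.det ≠ 0) :
    (Fintype.card K - 1) * (Finset.univ.filter fun u : J → K => (A0 + L u).det = 0).card ≤
      5 * Fintype.card K ^ Fintype.card J := by
  have h1 : ∀ t : K, t ≠ 0 → (Finset.univ.filter fun u : J → K => (A0 + L u).det = 0).card =
      (Finset.univ.filter fun u : J → K => (A0 + t • L u).det = 0).card := by
    intro t ht
    refine Finset.card_bij' (fun u _ => t⁻¹ • u) (fun u _ => t • u) ?_ ?_ ?_ ?_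
    · intro u hu
      simp only [Finset.mem_filter, Finset.mem_univ, true_and] at hu ⊢
      rw [hL, smul_smul, mul_inv_cancel₀ ht, one_smul]; exact hu
    · intro u hu
      simp only [Finset.mem_filter, Finset.mem_univ, true_and] at hu ⊢
      rw [hL]; exact hu
    · intro u _; simp [smul_smul, ht]
    · intro u _; simp [smul_smul, ht]
  calc (Fintype.card K - 1) * (Finset.univ.filter fun u : J → K => (A0 + L u).det = 0).card
      = ∑ t ∈ Finset.univ.erase (0 : K), (Finset.univ.filter fun u : J → K => (A0 + t • L u).det = 0).card := by
        rw [Finset.sum_congr rfl (fun t ht => (h1 t (Finset.ne_of_mem_erase ht)).symm), Finset.sum_const,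
          Finset.card_erase_of_mem (Finset.mem_univ _), Finset.card_univ, smul_eq_mul]
    _ ≤ ∑ t : K, (Finset.univ.filter fun u : J → K => (A0 + t • L u).det = 0).card :=
        Finset.sum_le_sum_of_subset (Finset.erase_subset _ _)
    _ = ∑ u : J → K, (Finset.univ.filter fun t : K => (A0 + t • L u).det = 0).card := by
        simp only [Finset.card_filter]; exact Finset.sum_comm
    _ ≤ ∑ u : J → K, 5 := Finset.sum_le_sum fun u _ => det_line_roots A0 (L u) h0
    _ = 5 * Fintype.card K ^ Fintype.card J := by simp [mul_comm]


/-- extend a vector by a value at the index `o` -/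
def ext0 {h : ℕ} (o : Fin h) {S : Type*} (c : S) (z : {j : Fin h // j ≠ o} → S) : Fin h → S :=
  fun j => if hj : j = o then c else z ⟨j, hj⟩

lemma ext0_o {h : ℕ} (o : Fin h) {S : Type*} (c : S) (z : {j : Fin h // j ≠ o} → S) : ext0 o c z o = c := by
  simp [ext0]

lemma ext0_ne {h : ℕ} (o : Fin h) {S : Type*} (c : S) (z : {j : Fin h // j ≠ o} → S) (j : Fin h) (hj : j ≠ o) :
    ext0 o c z j = z ⟨j, hj⟩ := by
  simp [ext0, hj]

lemma ext0_map {h : ℕ} (o : Fin h) {S T : Type*} (φ : S → T) (c : S) (z : {j : Fin h // j ≠ o} → S) :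
    (fun j => φ (ext0 o c z j)) = ext0 o (φ c) (fun j => φ (z j)) := by
  ext j; by_cases hj : j = o <;> simp [ext0, hj]

lemma ext0_decomp {h : ℕ} (o : Fin h) {S : Type*} [CommRing S] (c : S) (z : {j : Fin h // j ≠ o} → S) :
    ext0 o c z = c • Pi.single o 1 + ext0 o 0 z := by
  ext j; by_cases hj : j = o <;> simp [ext0, hj]

lemma ext0_smul {h : ℕ} (o : Fin h) {S : Type*} [CommRing S] (c : S) (z : {j : Fin h // j ≠ o} → S) :
    ext0 o 0 (c • z) = c • ext0 o 0 z := by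
  ext j; by_cases hj : j = o <;> simp [ext0, hj]

/-- the family of integer points -/
def yw {h : ℕ} (o : Fin h) (a M l N : ℕ) (ys : Fin h → ℤ) (w : {j : Fin h // j ≠ o} → Fin N) : Fin h → ℤ :=
  ext0 o ((a : ℤ) * l) (fun j => (l : ℤ) * ys j + M * ((w j : ℕ) : ℤ))

lemma yw_cast {h : ℕ} (o : Fin h) (a M l N : ℕ) (ys : Fin h → ℤ) (w : {j : Fin h // j ≠ o} → Fin N) (p : ℕ) :
    (fun j => (yw o a M l N ys w j : ZMod p)) =
      ext0 o ((a : ZMod p) * l) (fun j => ((l : ZMod p) * (ys j : ZMod p)) + (M : ZMod p) * ((w j : ℕ) : ZMod p)) := by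
  rw [yw, ext0_map]
  push_cast
  rfl

section
variable {m h : ℕ} (B : Fin h → Matrix (Fin m) (Fin m) ℤ) (o : Fin h) (f g : Fin 5 → Fin m)

open Classical in
lemma count_D (a M l N p : ℕ) (ys : Fin h → ℤ) (hp : p.Prime) (hM : ¬ p ∣ M) (ha : ¬ p ∣ a) (hl : ¬ p ∣ l)
    (hd : ¬ (p : ℤ) ∣ ((B o + (B o)ᵀ).submatrix f g).det) :
    (p - 1) * (Finset.univ.filter fun w : {j : Fin h // j ≠ o} → Fin N =>
      (p : ℤ) ∣ DD B f g (yw o a M l N ys w)).card ≤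
      (N / p + 1) ^ (h - 1) * (5 * p ^ (h - 1)) := by
  have : Fact p.Prime := ⟨hp⟩
  have hJ : Fintype.card {j : Fin h // j ≠ o} = h - 1 := by
    simp
  have hMp : Nat.Coprime M p := ((Nat.Prime.coprime_iff_not_dvd hp).mpr hM).symm
  have key : ∀ w : {j : Fin h // j ≠ o} → Fin N, ((p : ℤ) ∣ DD B f g (yw o a M l N ys w)) ↔
      DD B f g (ext0 o ((a : ZMod p) * l)
        (fun j => ((l : ZMod p) * (ys j : ZMod p)) + (M : ZMod p) * ((w j : ℕ) : ZMod p))) = 0 := by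
    intro w
    rw [← yw_cast, ← ZMod.intCast_zmod_eq_zero_iff_dvd, ← eq_intCast (Int.castRingHom (ZMod p)), DD_map]
    rfl
  rw [Finset.filter_congr (fun w _ => key w)]
  rw [card_comp_eq (N := N) (fun (j : {j : Fin h // j ≠ o}) i => ((l : ZMod p) * (ys j : ZMod p)) + (M : ZMod p) * ((i : ℕ) : ZMod p))
    (fun z => DD B f g (ext0 o ((a : ZMod p) * l) z) = 0)]
  set A0 : Matrix (Fin 5) (Fin 5) (ZMod p) := ((a : ZMod p) * l) • (GG B (Pi.single o 1)).submatrix f g with hA0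
  set L : ({j : Fin h // j ≠ o} → ZMod p) → Matrix (Fin 5) (Fin 5) (ZMod p) :=
    fun z => (GG B (ext0 o 0 z)).submatrix f g with hL
  have hz : ∀ z, DD B f g (ext0 o ((a : ZMod p) * l) z) = (A0 + L z).det := by
    intro z
    rw [DD, ext0_decomp, GG_add, GG_smul]; rfl
  have hA : A0.det ≠ 0 := by
    rw [hA0, det_smul, GG_single, Matrix.submatrix_map, ← RingHom.mapMatrix_apply, ← RingHom.map_det]
    refine mul_ne_zero (pow_ne_zero _ (mul_ne_zero ?_ ?_)) ?_
    · rwa [Ne, ZMod.natCast_eq_zero_iff]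
    · rwa [Ne, ZMod.natCast_eq_zero_iff]
    · rwa [eq_intCast, Ne, ZMod.intCast_zmod_eq_zero_iff_dvd]
  have hcount := det_zero_count A0 L (by intro t u; simp only [hL]; rw [ext0_smul, GG_smul]; rfl) hA
  rw [ZMod.card, hJ] at hcount
  calc _ ≤ (p - 1) * ∑ u ∈ Finset.univ.filter (fun z => DD B f g (ext0 o ((a : ZMod p) * l) z) = 0),
        (N / p + 1) ^ (h - 1) := by
        refine Nat.mul_le_mul_left _ (Finset.sum_le_sum fun u _ => ?_)
        rw [← hJ, ← Finset.card_univ, ← Finset.prod_const]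
        exact Finset.prod_le_prod' fun j _ => fiber_le N p M hp hMp _ _
    _ = (N / p + 1) ^ (h - 1) * ((p - 1) *
        (Finset.univ.filter (fun z => (A0 + L z).det = 0)).card) := by
        rw [Finset.sum_const, smul_eq_mul]; simp only [hz]; ring
    _ ≤ _ := Nat.mul_le_mul_left _ hcount

open Classical in
lemma count_D' (a M l N p : ℕ) (ys : Fin h → ℤ) (hp : p.Prime) (hM : ¬ p ∣ M) (ha : ¬ p ∣ a) (hl : ¬ p ∣ l)
    (hd : ¬ (p : ℤ) ∣ ((B o + (B o)ᵀ).submatrix f g).det) (hpN : p ≤ N) :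
    ((Finset.univ.filter fun w : {j : Fin h // j ≠ o} → Fin N =>
      (p : ℤ) ∣ DD B f g (yw o a M l N ys w)).card : ℝ) ≤
      10 * 2 ^ (h - 1) / p * N ^ (h - 1) := by
  have h1 := count_D B o f g a M l N p ys hp hM ha hl hd
  set c := (Finset.univ.filter fun w : {j : Fin h // j ≠ o} → Fin N =>
      (p : ℤ) ∣ DD B f g (yw o a M l N ys w)).card with hc
  have hp2 : 2 ≤ p := hp.two_le
  have hp0 : (0 : ℝ) < p := by exact_mod_cast hp.pos
  have h2 : p * c ≤ 2 * ((p - 1) * c) := by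
    rw [← mul_assoc]; exact Nat.mul_le_mul_right _ (by omega)
  have h3 : (N / p + 1) * p ≤ 2 * N := by
    have := Nat.div_mul_le_self N p
    rw [add_mul]; omega
  have h4 : p * c ≤ 10 * (2 ^ (h - 1) * N ^ (h - 1)) := by
    calc p * c ≤ 2 * ((N / p + 1) ^ (h - 1) * (5 * p ^ (h - 1))) := h2.trans (Nat.mul_le_mul_left _ h1)
      _ = 10 * ((N / p + 1) * p) ^ (h - 1) := by rw [mul_pow]; ring
      _ ≤ 10 * (2 * N) ^ (h - 1) := by gcongr
      _ = _ := by rw [mul_pow]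
  have h5 : (p : ℝ) * c ≤ 10 * (2 ^ (h - 1) * N ^ (h - 1)) := by exact_mod_cast h4
  rw [div_mul_eq_mul_div, le_div_iff₀ hp0]
  linarith

open Classical in
lemma count_iso (a M l s : ℕ) (ys : Fin h → ℤ) [Fact l.Prime] (hl : l.Prime) (hM : ¬ l ∣ M)
    (H3 : l ^ (h - 1) ≤ 8 * (Finset.univ.filter fun z : {j : Fin h // j ≠ o} → ZMod l =>
      Iso B (ext0 o 0 z)).card) :
    (l * s) ^ (h - 1) ≤ 8 * (Finset.univ.filter fun w : {j : Fin h // j ≠ o} → Fin (l * s) =>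
      Iso B (fun k => (yw o a M l (l * s) ys w k : ZMod l))).card := by
  have hJ : Fintype.card {j : Fin h // j ≠ o} = h - 1 := by
    simp
  have hMp : Nat.Coprime M l := ((Nat.Prime.coprime_iff_not_dvd hl).mpr hM).symm
  have hcc := card_comp_eq (N := l * s) (fun (j : {j : Fin h // j ≠ o}) i => ((l : ZMod l) * (ys j : ZMod l)) + (M : ZMod l) * ((i : ℕ) : ZMod l))
    (fun z => Iso B (ext0 o 0 z))
  have hcc2 : (Finset.univ.filter fun w : {j : Fin h // j ≠ o} → Fin (l * s) =>
      Iso B (fun k => (yw o a M l (l * s) ys w k : ZMod l))) = Finset.univ.filter fun w : {j : Fin h // j ≠ o} → Fin (l * s) =>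
      Iso B (ext0 o 0 (fun j => ((l : ZMod l) * (ys j : ZMod l)) + (M : ZMod l) * ((w j : ℕ) : ZMod l))) := by
    ext w
    simp only [Finset.mem_filter, Finset.mem_univ, true_and]
    rw [yw_cast, ZMod.natCast_self, mul_zero]
  rw [hcc2, hcc]
  calc (l * s) ^ (h - 1) = l ^ (h - 1) * s ^ (h - 1) := mul_pow _ _ _
    _ ≤ (8 * (Finset.univ.filter fun z : {j : Fin h // j ≠ o} → ZMod l =>
      Iso B (ext0 o 0 z)).card) * s ^ (h - 1) := Nat.mul_le_mul_right _ H3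
    _ = 8 * ∑ u ∈ (Finset.univ.filter fun z : {j : Fin h // j ≠ o} → ZMod l =>
      Iso B (ext0 o 0 z)), s ^ (h - 1) := by rw [Finset.sum_const, smul_eq_mul]; ring
    _ ≤ _ := by
        refine Nat.mul_le_mul_left _ (Finset.sum_le_sum fun u _ => ?_)
        rw [← hJ, ← Finset.card_univ, ← Finset.prod_const]
        exact Finset.prod_le_prod' fun j _ => fiber_ge l s M hl hMp _ _

end


lemma big_factors (D N : ℕ) (hD : D ≠ 0) (hN : 2 ≤ N) (hlt : D < N ^ 6) :
    ∑ p ∈ D.primeFactors.filter (fun p : ℕ => N < p), 1 / (p : ℝ) ≤ 5 / N := by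
  set S := D.primeFactors.filter (fun p : ℕ => N < p) with hS
  have h1 : N ^ S.card ≤ D := by
    calc N ^ S.card ≤ ∏ p ∈ S, p := Finset.pow_card_le_prod _ _ _ (fun p hp => by
            rw [hS, Finset.mem_filter] at hp; exact hp.2.le)
      _ ≤ D := by
        apply Nat.le_of_dvd (Nat.pos_of_ne_zero hD)
        refine (Finset.prod_dvd_prod_of_subset _ _ _ (Finset.filter_subset _ _)).trans (Nat.prod_primeFactors_dvd D)
  have h2 : S.card < 6 := (Nat.pow_lt_pow_iff_right (by omega)).mp (h1.trans_lt hlt)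
  have hN0 : (0 : ℝ) < N := by exact_mod_cast (by omega : 0 < N)
  calc ∑ p ∈ S, 1 / (p : ℝ) ≤ ∑ p ∈ S, 1 / (N : ℝ) := by
        refine Finset.sum_le_sum fun p hp => ?_
        rw [hS, Finset.mem_filter] at hp
        have : (N : ℝ) ≤ p := by exact_mod_cast hp.2.le
        gcongr
    _ = S.card * (1 / N) := by rw [Finset.sum_const, nsmul_eq_mul]
    _ ≤ 5 * (1 / N) := by
        have : (S.card : ℝ) ≤ 5 := by exact_mod_cast (by omega : S.card ≤ 5)
        gcongr
    _ = 5 / N := by ring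

lemma prime_sq_sum (W N : ℕ) (hW : 1 ≤ W) (T : Finset ℕ) (hT : ∀ p ∈ T, W ≤ p ∧ p ≤ N) :
    ∑ p ∈ T, (1 / (p : ℝ) ^ 2) ≤ 2 / (W : ℝ) := by
  have h := sum_Ioo_inv_sq_le (α := ℝ) (W - 1) (N + 1)
  have e : (((W - 1 : ℕ) : ℝ) + 1) = W := by
    have : W - 1 + 1 = W := by omega
    exact_mod_cast this
  rw [e] at h
  refine le_trans ?_ h
  simp only [one_div]
  refine Finset.sum_le_sum_of_subset_of_nonneg ?_ (fun _ _ _ => by positivity)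
  intro p hp
  have := hT p hp
  rw [Finset.mem_Ioo]; omega

section
variable {m h : ℕ} (B : Fin h → Matrix (Fin m) (Fin m) ℤ) (q : Fin m → MvPolynomial (Fin h) ℤ)
  (R : MvPolynomial (Fin h) ℤ) (o : Fin h)

lemma DD_bound (f g : Fin 5 → Fin m) : ∃ E : ℕ, ∀ (y : Fin h → ℤ) (T : ℤ), (∀ k, |y k| ≤ T) →
    |DD B f g y| ≤ 120 * (E * T) ^ 5 := by
  refine ⟨∑ i, ∑ j, ∑ k, ((B k i j).natAbs + (B k j i).natAbs), fun y T hT => ?_⟩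
  have h1 := Matrix.det_le (A := (GG B y).submatrix f g) (abv := AbsoluteValue.abs)
    (x := ((∑ i, ∑ j, ∑ k, ((B k i j).natAbs + (B k j i).natAbs) : ℕ) : ℤ) * T) ?_
  · simpa [DD, Nat.factorial] using h1
  · intro i j
    have hT0 : ∀ k : Fin h, 0 ≤ T := fun k => (abs_nonneg _).trans (hT k)
    have h2 : |(GG B y) (f i) (g j)| ≤ (∑ k, (((B k (f i) (g j)).natAbs + (B k (g j) (f i)).natAbs : ℕ) : ℤ)) * T := by
      have : (GG B y) (f i) (g j) = ∑ k, y k * (B k (f i) (g j) + B k (g j) (f i)) := by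
        simp [GG, AA, Finset.sum_add_distrib, mul_add]
      rw [this, Finset.sum_mul]
      refine (Finset.abs_sum_le_sum_abs _ _).trans (Finset.sum_le_sum fun k _ => ?_)
      rw [abs_mul, mul_comm]
      refine mul_le_mul ?_ (hT k) (abs_nonneg _) (by positivity)
      push_cast
      exact abs_add_le _ _
    refine h2.trans ?_
    rcases Nat.eq_zero_or_pos h with h0 | h0
    · subst h0; simp
    refine mul_le_mul_of_nonneg_right ?_ (hT0 ⟨0, h0⟩)
    rw [← Nat.cast_sum]
    norm_cast
    refine le_trans ?_ (Finset.single_le_sum (f := fun i => ∑ j, ∑ k, ((B k i j).natAbs + (B k j i).natAbs))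
      (fun _ _ => Nat.zero_le _) (Finset.mem_univ (f i)))
    exact Finset.single_le_sum (f := fun j => ∑ k, ((B k (f i) j).natAbs + (B k j (f i)).natAbs))
      (fun _ _ => Nat.zero_le _) (Finset.mem_univ (g j))

open Classical in
lemma per_l (hm : 1 ≤ m) (f g : Fin 5 → Fin m)
    (H2 : ∀ (K : Type) [Field K] (y : Fin h → K), y o = 0 → (GG B y).rank ≤ 2)
    (W : ℕ) (L : ℕ → ℝ) (hL0 : ∀ p, 0 < L p) (a M : ℕ) (ys : Fin h → ℤ)
    (hyso : ys o = a) (ha : ∀ p, p.Prime → p ∣ a → p < W) (hM : ∀ p, p.Prime → p ∣ M → p < W)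
    (hL : ∀ p, p.Prime → p < W → ∀ l : ℕ, Nat.Coprime l p → ∀ y : Fin h → ℤ, (∀ j, (M : ℤ) ∣ y j - l * ys j) →
      ∀ᶠ N in Filter.atTop, L p ≤ rhoY B q R y (p ^ N))
    (hd : ∀ p, p.Prime → W ≤ p → ¬ (p : ℤ) ∣ ((B o + (B o)ᵀ).submatrix f g).det)
    (hW1 : 5120 * 2 ^ (h - 1) ≤ W)
    (p₀ : ℕ) (hp₀ : p₀.Prime) (hp₀W : W ≤ p₀)
    (l : ℕ) [Fact l.Prime] (hl : l.Prime) (hlp : p₀ < l) (s : ℕ) (hp₀N : p₀ ≤ l * s)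
    (H3 : l ^ (h - 1) ≤ 8 * (Finset.univ.filter fun z : {j : Fin h // j ≠ o} → ZMod l =>
      Iso B (ext0 o 0 z)).card)
    (hbd : ∀ w : {j : Fin h // j ≠ o} → Fin (l * s), (DD B f g (yw o a M l (l * s) ys w)).natAbs < (l * s) ^ 6) :
    ((l * s : ℕ) : ℝ) ^ (h - 1) / 16 ≤ (Finset.univ.filter fun w : {j : Fin h // j ≠ o} → Fin (l * s) =>
      (∏ p ∈ Nat.primesBelow W, min (L p) 1) / 8 ≤
        (singSeries m (fun x => FF B q R x (yw o a M l (l * s) ys w))).re).card := by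
  set N := l * s with hN
  set D : ({j : Fin h // j ≠ o} → Fin N) → ℤ := fun w => DD B f g (yw o a M l N ys w) with hDdef
  have hWpos : 1 ≤ W := le_trans (Nat.one_le_iff_ne_zero.mpr (by positivity)) hW1
  have hW20 : 5120 ≤ W := le_trans (by nlinarith [Nat.one_le_two_pow (n := h - 1)]) hW1
  have hN20 : 5120 ≤ N := by omega
  have hNpos : (0 : ℝ) < N := by exact_mod_cast (by omega : 0 < N)
  have hWR : (0 : ℝ) < W := by exact_mod_cast hWpos
  set X : ℝ := (N : ℝ) ^ (h - 1) with hX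
  have hX0 : 0 < X := by positivity
  set T : Finset ℕ := (Finset.range (N + 1)).filter (fun p : ℕ => p.Prime ∧ W ≤ p ∧ p ≠ l) with hT
  set S : ({j : Fin h // j ≠ o} → Fin N) → ℝ := fun w => ∑ p ∈ T.filter (fun p : ℕ => (p : ℤ) ∣ D w), 1 / (p : ℝ) with hS
  have hnl : ∀ p, p.Prime → p ≠ l → ¬ p ∣ l := fun p hp hpl hdv => hpl ((Nat.prime_dvd_prime_iff_eq hp hl).mp hdv)
  have hna : ∀ p, p.Prime → W ≤ p → ¬ p ∣ a := fun p hp hpW hdv => by have := ha p hp hdv; omega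
  have hnM : ∀ p, p.Prime → W ≤ p → ¬ p ∣ M := fun p hp hpW hdv => by have := hM p hp hdv; omega
  have hcD : ∀ p, p.Prime → W ≤ p → p ≠ l → p ≤ N →
      ((Finset.univ.filter fun w => (p : ℤ) ∣ D w).card : ℝ) ≤ 10 * 2 ^ (h - 1) / p * X :=
    fun p hp hpW hpl hpN =>
      count_D' B o f g a M l N p ys hp (hnM p hp hpW) (hna p hp hpW) (hnl p hp hpl) (hd p hp hpW) hpN
  have hc0 : (10 : ℝ) * 2 ^ (h - 1) ≤ W / 512 := by
    have : (5120 * 2 ^ (h - 1) : ℝ) ≤ W := by exact_mod_cast hW1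
    linarith
  -- sets
  set G1 := Finset.univ.filter fun w : {j : Fin h // j ≠ o} → Fin N =>
      Iso B (fun k => (yw o a M l N ys w k : ZMod l)) with hG1
  set B1 := Finset.univ.filter fun w => (p₀ : ℤ) ∣ D w with hB1
  set B2 := Finset.univ.filter fun w => 1 / 4 < S w with hB2
  have hG1c : X ≤ 8 * (G1.card : ℝ) := by
    have := count_iso B o a M l s ys hl (hnM l hl (by omega)) H3
    rw [hX]; exact_mod_cast this
  have hB1c : (B1.card : ℝ) ≤ X / 64 := by
    refine (hcD p₀ hp₀ hp₀W hlp.ne hp₀N).trans ?_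
    have : (W : ℝ) ≤ p₀ := by exact_mod_cast hp₀W
    have h2 : 10 * 2 ^ (h - 1) / (p₀ : ℝ) ≤ 1 / 64 := by
      rw [div_le_iff₀ (by linarith)]; linarith
    calc _ ≤ 1 / 64 * X := by gcongr
      _ = X / 64 := by ring
  have hB2c : (B2.card : ℝ) ≤ X / 64 := by
    have hsumS : ∑ w, S w ≤ X / 256 := by
      calc ∑ w, S w = ∑ p ∈ T, ((Finset.univ.filter fun w => (p : ℤ) ∣ D w).card : ℝ) * (1 / p) := by
            simp only [hS, Finset.sum_filter]
            rw [Finset.sum_comm]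
            refine Finset.sum_congr rfl fun p _ => ?_
            rw [← Finset.sum_filter, Finset.sum_const, nsmul_eq_mul]
        _ ≤ ∑ p ∈ T, (10 * 2 ^ (h - 1) * X) * (1 / (p : ℝ) ^ 2) := by
            refine Finset.sum_le_sum fun p hp => ?_
            rw [hT, Finset.mem_filter, Finset.mem_range] at hp
            obtain ⟨h1, h2, h3, h4⟩ := hp
            have hp0 : (0 : ℝ) < p := by exact_mod_cast h2.pos
            calc _ ≤ (10 * 2 ^ (h - 1) / p * X) * (1 / (p : ℝ)) := by
                  have := hcD p h2 h3 h4 (by omega)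
                  gcongr
              _ = _ := by field_simp
        _ = (10 * 2 ^ (h - 1) * X) * ∑ p ∈ T, 1 / (p : ℝ) ^ 2 := by rw [Finset.mul_sum]
        _ ≤ (10 * 2 ^ (h - 1) * X) * (2 / W) := by
            gcongr
            refine prime_sq_sum W N hWpos T fun p hp => ?_
            rw [hT, Finset.mem_filter, Finset.mem_range] at hp
            exact ⟨hp.2.2.1, by omega⟩
        _ ≤ (W / 512 * X) * (2 / W) := by gcongr
        _ = X / 256 := by field_simp; norm_num
    have hS0 : ∀ w, 0 ≤ S w := fun w => Finset.sum_nonneg fun p _ => by positivity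
    have : (B2.card : ℝ) * (1 / 4) ≤ ∑ w, S w := by
      calc (B2.card : ℝ) * (1 / 4) = ∑ w ∈ B2, (1 / 4 : ℝ) := by rw [Finset.sum_const, nsmul_eq_mul]
        _ ≤ ∑ w ∈ B2, S w := Finset.sum_le_sum fun w hw => by
            rw [hB2, Finset.mem_filter] at hw; exact hw.2.le
        _ ≤ ∑ w, S w := Finset.sum_le_sum_of_subset_of_nonneg (Finset.subset_univ _) (fun w _ _ => hS0 w)
    linarith
  -- good ones
  have hgood : G1 \ (B1 ∪ B2) ⊆ Finset.univ.filter fun w : {j : Fin h // j ≠ o} → Fin N =>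
      (∏ p ∈ Nat.primesBelow W, min (L p) 1) / 8 ≤
        (singSeries m (fun x => FF B q R x (yw o a M l N ys w))).re := by
    intro w hw
    simp only [hG1, hB1, hB2, Finset.mem_sdiff, Finset.mem_union, Finset.mem_filter, Finset.mem_univ, true_and,
      not_or, not_lt] at hw ⊢
    obtain ⟨hiso, hp0, hSw⟩ := hw
    have hD0 : D w ≠ 0 := fun h0 => hp0 (h0 ▸ dvd_zero _)
    refine sing_lower B q R o hm f g H2 W L hL0 (yw o a M l N ys w) l hl (by omega) ?_ hd ?_ hiso hD0 ?_
    · intro p hp hpW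
      refine hL p hp hpW l ?_ _ ?_
      · exact (Nat.coprime_primes hl hp).mpr (by omega)
      · intro j
        by_cases hj : j = o
        · subst hj
          rw [yw, ext0_o, hyso]
          simp [mul_comm]
        · rw [yw, ext0_ne _ _ _ _ hj]
          simp
    · intro p hp hpW hpl hdv
      rw [yw, ext0_o] at hdv
      have : p ∣ a * l := by exact_mod_cast hdv
      rcases hp.dvd_mul.mp this with h1 | h1
      · exact hna p hp hpW h1
      · exact hnl p hp hpl h1
    · have hb := big_factors (D w).natAbs N (by simpa using hD0) (by omega) (hbd w)
      have h5 : (5 : ℝ) / N ≤ 1 / 4 := by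
        rw [div_le_iff₀ hNpos]
        have : (5120 : ℝ) ≤ N := by exact_mod_cast hN20
        linarith
      have hsub : (D w).natAbs.primeFactors.filter (fun p : ℕ => W ≤ p ∧ p ≠ l) ⊆
          (T.filter (fun p : ℕ => (p : ℤ) ∣ D w)) ∪ (D w).natAbs.primeFactors.filter (fun p : ℕ => N < p) := by
        intro p hp
        simp only [Finset.mem_filter, Nat.mem_primeFactors, Finset.mem_union, hT, Finset.mem_range] at hp ⊢
        obtain ⟨⟨h1, h2, h3⟩, h4, h5⟩ := hp
        by_cases hpN : N < p
        · exact Or.inr ⟨⟨h1, h2, h3⟩, hpN⟩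
        · exact Or.inl ⟨⟨by omega, h1, h4, h5⟩, Int.natCast_dvd.mpr h2⟩
      calc _ ≤ ∑ p ∈ (T.filter (fun p : ℕ => (p : ℤ) ∣ D w)) ∪ (D w).natAbs.primeFactors.filter (fun p : ℕ => N < p),
            1 / (p : ℝ) := Finset.sum_le_sum_of_subset_of_nonneg hsub (fun _ _ _ => by positivity)
        _ ≤ S w + ∑ p ∈ (D w).natAbs.primeFactors.filter (fun p : ℕ => N < p), 1 / (p : ℝ) := by
            rw [← Finset.sum_union_inter]
            have : 0 ≤ ∑ x ∈ (T.filter (fun p : ℕ => (p : ℤ) ∣ D w)) ∩ (D w).natAbs.primeFactors.filter (fun p : ℕ => N < p),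
              1 / (x : ℝ) := Finset.sum_nonneg fun p _ => by positivity
            linarith
        _ ≤ 1 / 2 := by linarith
  have hcard : (G1.card : ℝ) ≤ ((G1 \ (B1 ∪ B2)).card : ℝ) + (B1.card + B2.card) := by
    have h1 := Finset.card_le_card_sdiff_add_card (s := G1) (t := B1 ∪ B2)
    have h2 := Finset.card_union_le B1 B2
    exact_mod_cast (by omega : G1.card ≤ (G1 \ (B1 ∪ B2)).card + (B1.card + B2.card))
  refine le_trans ?_ (Nat.cast_le.mpr (Finset.card_le_card hgood))
  linarith

end


lemma pi_lower (l1 : ℕ) : ∃ n0 : ℕ, ∀ n : ℕ, n0 ≤ n → (n : ℝ) / (4 * Real.log n) ≤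
    (((Finset.range (n + 1)).filter (fun l : ℕ => l.Prime ∧ l1 ≤ l)).card : ℝ) := by
  have hlo := Real.isLittleO_log_id_atTop.bound (c := 1 / (10 * (2 + l1))) (by positivity)
  rw [Filter.eventually_atTop] at hlo
  obtain ⟨x0, hx0⟩ := hlo
  refine ⟨max 3 (Nat.ceil x0), fun n hn => ?_⟩
  have hn3 : 3 ≤ n := (le_max_left _ _).trans hn
  have hnx : x0 ≤ n := (Nat.le_ceil x0).trans (by exact_mod_cast (le_max_right _ _).trans hn)
  have hnR : (3 : ℝ) ≤ n := by exact_mod_cast hn3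
  have hlogpos : 0 < Real.log n := Real.log_pos (by linarith)
  have h1 := hx0 n hnx
  simp only [id, Real.norm_eq_abs, abs_of_pos hlogpos, abs_of_pos (by linarith : (0 : ℝ) < n)] at h1
  have h1' : (2 + l1) * Real.log n ≤ n / 10 := by
    calc (2 + (l1 : ℝ)) * Real.log n ≤ (2 + l1) * (1 / (10 * (2 + l1)) * n) := by gcongr
      _ = n / 10 := by field_simp
  have h2 := Chebyshev.pi_ge n
  have h3 : Real.log (n + 1) ≤ 2 * Real.log n := by
    rw [← Real.log_rpow (by linarith)]
    apply Real.log_le_log (by linarith)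
    norm_num
    nlinarith
  have h4 : (Nat.primeCounting n : ℝ) ≤ (((Finset.range (n + 1)).filter (fun l : ℕ => l.Prime ∧ l1 ≤ l)).card : ℝ) + l1 := by
    have : Nat.primeCounting n ≤ ((Finset.range (n + 1)).filter (fun l : ℕ => l.Prime ∧ l1 ≤ l)).card + l1 := by
      rw [Nat.primeCounting, Nat.primeCounting', Nat.count_eq_card_filter_range]
      refine le_trans (Finset.card_le_card (t := (Finset.range (n + 1)).filter (fun l : ℕ => l.Prime ∧ l1 ≤ l) ∪ Finset.range l1) ?_) ?_
      · intro l hl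
        simp only [Finset.mem_filter, Finset.mem_union, Finset.mem_range] at hl ⊢
        by_cases h : l1 ≤ l
        · exact Or.inl ⟨hl.1, hl.2, h⟩
        · right; omega
      · refine (Finset.card_union_le _ _).trans ?_
        simp
    exact_mod_cast this
  have h5 : (n : ℝ) / (4 * Real.log n) + l1 ≤ ((n * Real.log 2 - Real.log (n + 1)) / Real.log n) := by
    rw [le_div_iff₀ hlogpos, add_mul]
    have : (n : ℝ) / (4 * Real.log n) * Real.log n = n / 4 := by field_simp
    rw [this]
    have := Real.log_two_gt_d9
    nlinarith
  have h2' : ((n * Real.log 2 - Real.log (n + 1)) / Real.log n) ≤ (Nat.primeCounting n : ℝ) := h2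
  linarith

section
variable {m h : ℕ} (B : Fin h → Matrix (Fin m) (Fin m) ℤ) (q : Fin m → MvPolynomial (Fin h) ℤ)
  (R : MvPolynomial (Fin h) ℤ) (o : Fin h)

open Classical in
theorem main_count (hm : 1 ≤ m) (hq : ∀ j, (q j).IsHomogeneous 2) (hR : R.IsHomogeneous 3) (f g : Fin 5 → Fin m)
    (hd0 : ((B o + (B o)ᵀ).submatrix f g).det ≠ 0)
    (H2 : ∀ (K : Type) [Field K] (y : Fin h → K), y o = 0 → (GG B y).rank ≤ 2)
    (l0 : ℕ) (H3 : ∀ (l : ℕ) [Fact l.Prime], l0 ≤ l → l ^ (h - 1) ≤ 8 *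
      (Finset.univ.filter fun z : {j : Fin h // j ≠ o} → ZMod l => Iso B (ext0 o 0 z)).card)
    (hloc : ∀ (p : ℕ) [Fact p.Prime], ∃ (x : Fin m → ℚ_[p]) (y : Fin h → ℚ_[p]) (i : Fin m),
      FF B q R x y = 0 ∧ gX B q x y i ≠ 0 ∧ y o = 1) :
    ∃ c > (0 : ℝ), ∃ K > (0 : ℝ), ∃ Y₀ : ℝ, ∀ Y : ℝ, Y₀ ≤ Y →
      ∃ 𝒞 : Finset (Fin h → ℤ),
        (∀ y ∈ 𝒞, ∀ i, (|y i| : ℝ) ≤ K * Y) ∧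
        c * Y ^ h / Real.log Y ≤ ∑ y ∈ 𝒞, (singSeries m fun x => FF B q R x y).re := by
  set W : ℕ := max (5120 * 2 ^ (h - 1)) (((B o + (B o)ᵀ).submatrix f g).det.natAbs + 1) with hW
  obtain ⟨a, M, L, ys, ha0, hM0, hL0, hyso, ha, hM, hL⟩ := glob_data B q R o hm hq hR hloc W
  have hd : ∀ p, p.Prime → W ≤ p → ¬ (p : ℤ) ∣ ((B o + (B o)ᵀ).submatrix f g).det := by
    intro p _ hpW hdv
    have := Nat.le_of_dvd (Int.natAbs_pos.mpr hd0) (Int.natCast_dvd.mp hdv)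
    have := le_max_right (5120 * 2 ^ (h - 1)) (((B o + (B o)ᵀ).submatrix f g).det.natAbs + 1)
    omega
  obtain ⟨p₀, hp₀W, hp₀⟩ := Nat.exists_infinite_primes W
  obtain ⟨E, hE⟩ := DD_bound B f g
  set A : ℕ := a + ∑ j, (ys j).natAbs + M with hA
  have hh : 0 < h := o.pos
  set c₀ : ℝ := (∏ p ∈ Nat.primesBelow W, min (L p) 1) / 8 with hc₀
  have hc₀pos : 0 < c₀ := by
    refine div_pos (Finset.prod_pos fun p _ => lt_min (hL0 p) one_pos) (by norm_num)
  set l1 := max l0 (p₀ + 1) with hl1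
  obtain ⟨n0, hn0⟩ := pi_lower l1
  set n1 := max (max n0 (2 * p₀)) (2 * (120 * (E * A * 2) ^ 5 + 1)) with hn1
  have hybd : ∀ (n l N : ℕ) (w : {j : Fin h // j ≠ o} → Fin N), l ≤ n → N ≤ n → ∀ k,
      |yw o a M l N ys w k| ≤ (A : ℤ) * n := by
    intro n l N w hln hNn k
    by_cases hk : k = o
    · subst hk
      rw [yw, ext0_o, abs_of_nonneg (by positivity)]
      have : a ≤ A := by omega
      exact_mod_cast Nat.mul_le_mul this hln
    · rw [yw, ext0_ne _ _ _ _ hk]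
      have h1 : ((w ⟨k, hk⟩ : ℕ)) ≤ n := (w ⟨k, hk⟩).2.le.trans hNn
      have h2 : (ys k).natAbs ≤ ∑ j, (ys j).natAbs :=
        Finset.single_le_sum (f := fun j => (ys j).natAbs) (fun _ _ => Nat.zero_le _) (Finset.mem_univ k)
      calc |(l : ℤ) * ys k + M * ((w ⟨k, hk⟩ : ℕ) : ℤ)| ≤ |(l : ℤ) * ys k| + |(M : ℤ) * ((w ⟨k, hk⟩ : ℕ) : ℤ)| :=
            abs_add_le _ _
        _ = ((l * (ys k).natAbs + M * (w ⟨k, hk⟩ : ℕ) : ℕ) : ℤ) := by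
            rw [abs_mul, abs_mul]; push_cast; simp
        _ ≤ ((A * n : ℕ) : ℤ) := by
            apply Int.ofNat_le.mpr
            calc l * (ys k).natAbs + M * (w ⟨k, hk⟩ : ℕ) ≤ n * (∑ j, (ys j).natAbs) + M * n :=
                  Nat.add_le_add (Nat.mul_le_mul hln h2) (Nat.mul_le_mul_left _ h1)
              _ = (∑ j, (ys j).natAbs + M) * n := by ring
              _ ≤ A * n := Nat.mul_le_mul_right _ (by omega)
        _ = (A : ℤ) * n := by push_cast; ring
  refine ⟨c₀ / (128 * 4 ^ (h - 1)), by positivity, A, by exact_mod_cast (by omega : 0 < A), max 3 ((n1 : ℝ) + 1), fun Y hY => ?_⟩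
  have hY3 : 3 ≤ Y := (le_max_left _ _).trans hY
  set n := Nat.floor Y with hn
  have hnY : (n : ℝ) ≤ Y := Nat.floor_le (by linarith)
  have hnY2 : Y < n + 1 := Nat.lt_floor_add_one Y
  have hn1n : n1 ≤ n := by
    apply Nat.le_floor
    have := (le_max_right _ _).trans hY
    linarith
  have hnn0 : n0 ≤ n := (le_max_left _ _).trans ((le_max_left _ _).trans hn1n)
  have hnp0 : 2 * p₀ ≤ n := (le_max_right _ _).trans ((le_max_left _ _).trans hn1n)
  have hnE : 2 * (120 * (E * A * 2) ^ 5 + 1) ≤ n := (le_max_right _ _).trans hn1n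
  have hn3 : (3 : ℝ) ≤ n := by exact_mod_cast Nat.le_floor (by exact_mod_cast hY3)
  set P := (Finset.range (n + 1)).filter (fun l : ℕ => l.Prime ∧ l1 ≤ l) with hP
  have hPc := hn0 n hnn0
  set Gd : ∀ l : ℕ, Finset ({j : Fin h // j ≠ o} → Fin (l * (n / l))) := fun l =>
    Finset.univ.filter fun w => c₀ ≤ (singSeries m (fun x => FF B q R x (yw o a M l (l * (n / l)) ys w))).re with hGd
  have hinj : ∀ l, Function.Injective (yw o a M l (l * (n / l)) ys) := by
    intro l w w' he
    ext j
    have := congrFun he j.1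
    rw [yw, yw, ext0_ne _ _ _ _ j.2, ext0_ne _ _ _ _ j.2] at this
    have h2 : (M : ℤ) * ((w j : ℕ) : ℤ) = M * ((w' j : ℕ) : ℤ) := by simpa using this
    have h3 := mul_left_cancel₀ (by exact_mod_cast hM0.ne') h2
    exact_mod_cast h3
  have hN : ∀ l ∈ P, l * (n / l) ≤ n ∧ n < 2 * (l * (n / l)) ∧ l.Prime ∧ l1 ≤ l ∧ l ≤ n := by
    intro l hl
    rw [hP, Finset.mem_filter, Finset.mem_range] at hl
    have h1 : 1 ≤ n / l := (Nat.one_le_div_iff hl.2.1.pos).mpr (by omega)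
    have h2 := Nat.div_add_mod n l
    have h3 := Nat.mod_lt n hl.2.1.pos
    have h4 : l * 1 ≤ l * (n / l) := Nat.mul_le_mul_left _ h1
    refine ⟨by omega, by omega, hl.2.1, hl.2.2, by omega⟩
  have hGc : ∀ l ∈ P, ((n : ℝ) / 2) ^ (h - 1) / 16 ≤ ((Gd l).card : ℝ) := by
    intro l hl
    obtain ⟨h1, h2, h3, h4, h5⟩ := hN l hl
    have : Fact l.Prime := ⟨h3⟩
    have hl0 : l0 ≤ l := (le_max_left _ _).trans h4
    have hlp : p₀ + 1 ≤ l := (le_max_right _ _).trans h4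
    refine le_trans ?_ (per_l B q R o hm f g H2 W L hL0 a M ys hyso ha hM hL hd (le_max_left _ _) p₀ hp₀ hp₀W l h3
      (by omega) (n / l) (by omega) (H3 l hl0) ?_)
    · have : (n : ℝ) / 2 ≤ ((l * (n / l) : ℕ) : ℝ) := by
        have : (n : ℝ) < 2 * ((l * (n / l) : ℕ) : ℝ) := by exact_mod_cast h2
        linarith
      gcongr
    · intro w
      have h6 := hE (yw o a M l (l * (n / l)) ys w) ((A : ℤ) * n) (hybd n l _ w h5 h1)
      have h7 : (DD B f g (yw o a M l (l * (n / l)) ys w)).natAbs ≤ 120 * (E * (A * n)) ^ 5 := by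
        rw [← Int.natCast_natAbs] at h6
        exact_mod_cast h6
      refine h7.trans_lt ?_
      generalize l * (n / l) = N at h1 h2
      calc 120 * (E * (A * n)) ^ 5
          ≤ 120 * (E * (A * (2 * N))) ^ 5 := by gcongr
        _ = (120 * (E * A * 2) ^ 5) * N ^ 5 := by ring
        _ < N * N ^ 5 := by
            apply Nat.mul_lt_mul_of_pos_right (by omega)
            have : 0 < N := by omega
            positivity
        _ = N ^ 6 := by ring
  refine ⟨P.biUnion fun l => (Gd l).image (yw o a M l (l * (n / l)) ys), ?_, ?_⟩
  · intro y hy i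
    simp only [Finset.mem_biUnion, Finset.mem_image] at hy
    obtain ⟨l, hl, w, hw, rfl⟩ := hy
    obtain ⟨h1, h2, h3, h4, h5⟩ := hN l hl
    have := hybd n l _ w h5 h1 i
    have h6 : (|(yw o a M l (l * (n / l)) ys w i : ℝ)|) ≤ (A : ℝ) * n := by exact_mod_cast this
    refine h6.trans ?_
    gcongr
  · rw [Finset.sum_biUnion]
    · have hlogY : 0 < Real.log Y := Real.log_pos (by linarith)
      have hlogn : 0 < Real.log n := Real.log_pos (by linarith)
      have hpow : Y ^ h = Y ^ (h - 1) * Y := by rw [← pow_succ]; congr 1; omega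
      calc c₀ / (128 * 4 ^ (h - 1)) * Y ^ h / Real.log Y
          = ((Y / 2) / (4 * Real.log Y)) * (((Y / 2) / 2) ^ (h - 1) / 16 * c₀) := by
            rw [hpow, div_pow, div_pow]
            have : (4 : ℝ) ^ (h - 1) = 2 ^ (h - 1) * 2 ^ (h - 1) := by rw [← mul_pow]; norm_num
            rw [this]
            field_simp
            norm_num
        _ ≤ ((n : ℝ) / (4 * Real.log n)) * (((n : ℝ) / 2) ^ (h - 1) / 16 * c₀) := by
            have h1 : Y / 2 ≤ n := by linarith
            have h2 : Real.log n ≤ Real.log Y := Real.log_le_log (by linarith) hnY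
            gcongr
        _ ≤ (P.card : ℝ) * (((n : ℝ) / 2) ^ (h - 1) / 16 * c₀) := by gcongr
        _ = ∑ l ∈ P, (((n : ℝ) / 2) ^ (h - 1) / 16 * c₀) := by rw [Finset.sum_const, nsmul_eq_mul]
        _ ≤ _ := by
            refine Finset.sum_le_sum fun l hl => ?_
            rw [Finset.sum_image (fun _ _ _ _ he => hinj l he)]
            calc _ ≤ ((Gd l).card : ℝ) * c₀ := by
                  have := hGc l hl
                  gcongr
              _ = ∑ w ∈ Gd l, c₀ := by rw [Finset.sum_const, nsmul_eq_mul]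
              _ ≤ _ := by
                  refine Finset.sum_le_sum fun w hw => ?_
                  rw [hGd, Finset.mem_filter] at hw
                  exact hw.2
    · intro l _ l' _ hne
      rw [Function.onFun, Finset.disjoint_left]
      intro y hy hy'
      simp only [Finset.mem_image] at hy hy'
      obtain ⟨w, _, rfl⟩ := hy
      obtain ⟨w', _, he⟩ := hy'
      have := congrFun he o
      rw [yw, yw, ext0_o, ext0_o] at this
      have h3 := mul_left_cancel₀ (by exact_mod_cast ha0.ne') this
      exact hne (by exact_mod_cast h3.symm)

end


lemma quad_roots {F : Type*} [Field F] [Fintype F] [DecidableEq F] (a b c : F) (h : ¬ (a = 0 ∧ b = 0 ∧ c = 0)) :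
    (Finset.univ.filter fun t : F => a + t * b + t ^ 2 * c = 0).card ≤ 2 := by
  set P : Polynomial F := Polynomial.C c * Polynomial.X ^ 2 + Polynomial.C b * Polynomial.X + Polynomial.C a with hP
  have hP0 : P ≠ 0 := by
    intro h0
    apply h
    have h1 := congrArg (fun p => Polynomial.coeff p 0) h0
    have h2 := congrArg (fun p => Polynomial.coeff p 1) h0
    have h3 := congrArg (fun p => Polynomial.coeff p 2) h0
    simp [hP, Polynomial.coeff_X, Polynomial.coeff_C] at h1 h2 h3
    exact ⟨h1, h2, h3⟩
  calc _ ≤ P.roots.toFinset.card := by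
        apply Finset.card_le_card
        intro t ht
        simp only [Finset.mem_filter, Finset.mem_univ, true_and] at ht
        rw [Multiset.mem_toFinset, Polynomial.mem_roots hP0, Polynomial.IsRoot]
        simp only [hP, Polynomial.eval_add, Polynomial.eval_mul, Polynomial.eval_C, Polynomial.eval_X,
          Polynomial.eval_pow]
        linear_combination ht
    _ ≤ P.roots.card := Multiset.toFinset_card_le _
    _ ≤ P.natDegree := Polynomial.card_roots' _
    _ ≤ 2 := Polynomial.natDegree_quadratic_le

section
variable {F : Type*} [Field F] [Fintype F] [DecidableEq F] {V : Type*} [AddCommGroup V] [Module F V] [Fintype V]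

lemma card_translate (P : V → Prop) [DecidablePred P] (v : V) :
    (Finset.univ.filter fun z => P (z + v)).card = (Finset.univ.filter P).card := by
  refine Finset.card_bij' (fun z _ => z + v) (fun z _ => z - v) ?_ ?_ ?_ ?_ <;> intro z hz <;> simp_all

/-- averaging over lines -/
lemma line_avg (P : V → Prop) [DecidablePred P] (v : V) (c : ℕ)
    (hc : ∀ z, (Finset.univ.filter fun t : F => P (z + t • v)).card ≤ c) :
    Fintype.card F * (Finset.univ.filter P).card ≤ c * Fintype.card V := by
  calc Fintype.card F * (Finset.univ.filter P).card
      = ∑ t : F, (Finset.univ.filter fun z => P (z + t • v)).card := by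
        rw [Finset.sum_congr rfl (fun t _ => card_translate P (t • v)), Finset.sum_const, Finset.card_univ, smul_eq_mul]
    _ = ∑ z : V, (Finset.univ.filter fun t : F => P (z + t • v)).card := by
        simp only [Finset.card_filter]; exact Finset.sum_comm
    _ ≤ ∑ z : V, c := Finset.sum_le_sum fun z _ => hc z
    _ = _ := by rw [Finset.sum_const, Finset.card_univ, smul_eq_mul, mul_comm]

lemma plane_avg (P : V → Prop) [DecidablePred P] (u v : V)
    (hc : ∀ z, (Finset.univ.filter fun t : F × F => P (z + (t.1 • u + t.2 • v))).card ≤ 1) :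
    Fintype.card F ^ 2 * (Finset.univ.filter P).card ≤ Fintype.card V := by
  calc Fintype.card F ^ 2 * (Finset.univ.filter P).card
      = ∑ t : F × F, (Finset.univ.filter fun z => P (z + (t.1 • u + t.2 • v))).card := by
        rw [Finset.sum_congr rfl (fun (t : F × F) _ => card_translate P (t.1 • u + t.2 • v)), Finset.sum_const,
          Finset.card_univ, smul_eq_mul, Fintype.card_prod, sq]
    _ = ∑ z : V, (Finset.univ.filter fun t : F × F => P (z + (t.1 • u + t.2 • v))).card := by
        simp only [Finset.card_filter]; exact Finset.sum_comm
    _ ≤ ∑ z : V, 1 := Finset.sum_le_sum fun z _ => hc z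
    _ = _ := by rw [Finset.sum_const, Finset.card_univ, smul_eq_mul, mul_one]

lemma ker_ge (lam : V →ₗ[F] F) :
    Fintype.card V ≤ Fintype.card F * (Finset.univ.filter fun z => lam z = 0).card := by
  have h1 : Fintype.card V = ∑ t : F, (Finset.univ.filter fun z => lam z = t).card := by
    rw [← Finset.card_univ]
    exact Finset.card_eq_sum_card_fiberwise (fun z _ => Finset.mem_univ _)
  rw [h1]
  calc _ ≤ ∑ t : F, (Finset.univ.filter fun z => lam z = 0).card := by
        refine Finset.sum_le_sum fun t _ => ?_
        rcases (Finset.univ.filter fun z => lam z = t).eq_empty_or_nonempty with h | ⟨z0, hz0⟩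
        · rw [h]; simp
        · refine Finset.card_le_card_of_injOn (fun z => z - z0) ?_ ?_
          · intro z hz
            simp_all
          · intro z _ z' _ he
            simpa using he
    _ = _ := by rw [Finset.sum_const, Finset.card_univ, smul_eq_mul]

lemma ker_le (lam : V →ₗ[F] F) (v : V) (hv : lam v ≠ 0) :
    Fintype.card F * (Finset.univ.filter fun z => lam z = 0).card ≤ Fintype.card V := by
  have := line_avg (F := F) (fun z => lam z = 0) v 1 ?_
  · simpa using this
  · intro z
    rw [Finset.card_le_one]
    intro t ht t' ht'
    simp only [Finset.mem_filter, Finset.mem_univ, true_and, map_add, map_smul, smul_eq_mul] at ht ht'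
    apply mul_right_cancel₀ hv
    linear_combination ht - ht'

lemma h3_abs (a b c : V →ₗ[F] F) (hF : 32 ≤ Fintype.card F) (z₀ : V) (hz₀ : 4 * a z₀ * c z₀ - b z₀ ^ 2 ≠ 0)
    (u v : V) (huv : ∀ s t : F, a (s • u + t • v) = 0 → b (s • u + t • v) = 0 → c (s • u + t • v) = 0 → s = 0 ∧ t = 0) :
    Fintype.card V ≤ 8 * (Finset.univ.filter fun z =>
      4 * a z * c z - b z ^ 2 ≠ 0 ∧ ∃ t : F, a z + t * b z + t ^ 2 * c z = 0).card := by
  classical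
  set l := Fintype.card F with hl
  set Q := Fintype.card V with hQ
  set K := Finset.univ.filter fun z => a z = 0 ∧ b z = 0 ∧ c z = 0 with hK
  set D := Finset.univ.filter fun z => 4 * a z * c z - b z ^ 2 = 0 with hD
  set G := Finset.univ.filter fun z => 4 * a z * c z - b z ^ 2 ≠ 0 ∧ ∃ t : F, a z + t * b z + t ^ 2 * c z = 0 with hG
  have hKc : l ^ 2 * K.card ≤ Q := by
    refine plane_avg (F := F) (fun z => a z = 0 ∧ b z = 0 ∧ c z = 0) u v fun z => ?_
    rw [Finset.card_le_one]
    rintro ⟨s, t⟩ h1 ⟨s', t'⟩ h2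
    simp only [Finset.mem_filter, Finset.mem_univ, true_and, map_add, map_smul, smul_eq_mul] at h1 h2
    have := huv (s - s') (t - t')
      (by simp only [map_add, map_smul, smul_eq_mul]; linear_combination h1.1 - h2.1)
      (by simp only [map_add, map_smul, smul_eq_mul]; linear_combination h1.2.1 - h2.2.1)
      (by simp only [map_add, map_smul, smul_eq_mul]; linear_combination h1.2.2 - h2.2.2)
    rw [sub_eq_zero, sub_eq_zero] at this
    rw [this.1, this.2]
  have hDc : l * D.card ≤ 2 * Q := by
    refine line_avg (F := F) (fun z => 4 * a z * c z - b z ^ 2 = 0) z₀ 2 fun z => ?_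
    refine le_trans (le_of_eq ?_) (quad_roots (4 * a z * c z - b z ^ 2)
      (4 * (a z * c z₀ + a z₀ * c z) - 2 * b z * b z₀) (4 * a z₀ * c z₀ - b z₀ ^ 2) (fun h => hz₀ h.2.2))
    congr 1
    ext t
    simp only [Finset.mem_filter, Finset.mem_univ, true_and, map_add, map_smul, smul_eq_mul]
    constructor <;> intro h <;> linear_combination h
  -- double counting
  have hdc : Q ≤ ∑ z : V, (Finset.univ.filter fun t : F => a z + t * b z + t ^ 2 * c z = 0).card := by
    have h1 : l * Q ≤ l * ∑ t : F, (Finset.univ.filter fun z => a z + t * b z + t ^ 2 * c z = 0).card := by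
      calc l * Q = ∑ t : F, Q := by rw [Finset.sum_const, Finset.card_univ, smul_eq_mul]
        _ ≤ ∑ t : F, l * (Finset.univ.filter fun z => a z + t * b z + t ^ 2 * c z = 0).card := by
            refine Finset.sum_le_sum fun t _ => ?_
            have := ker_ge (a + t • b + t ^ 2 • c)
            simpa using this
        _ = _ := by rw [Finset.mul_sum]
    have h2 := Nat.le_of_mul_le_mul_left h1 (by omega)
    refine h2.trans (le_of_eq ?_)
    simp only [Finset.card_filter]; exact Finset.sum_comm
  have hub : ∑ z : V, (Finset.univ.filter fun t : F => a z + t * b z + t ^ 2 * c z = 0).card ≤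
      ∑ z : V, ((if z ∈ K then l else 0) + (if z ∈ D then 2 else 0) + (if z ∈ G then 2 else 0)) := by
    refine Finset.sum_le_sum fun z _ => ?_
    by_cases hzK : z ∈ K
    · rw [if_pos hzK]
      have : (Finset.univ.filter fun t : F => a z + t * b z + t ^ 2 * c z = 0).card ≤ l := Finset.card_le_univ _
      omega
    have h2 : (Finset.univ.filter fun t : F => a z + t * b z + t ^ 2 * c z = 0).card ≤ 2 :=
      quad_roots _ _ _ (by simpa [hK] using hzK)
    by_cases hzD : z ∈ D
    · rw [if_pos hzD]; omega
    by_cases hzG : z ∈ G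
    · rw [if_pos hzG]; omega
    have : (Finset.univ.filter fun t : F => a z + t * b z + t ^ 2 * c z = 0) = ∅ := by
      rw [Finset.filter_eq_empty_iff]
      intro t _ ht
      apply hzG
      rw [hG, Finset.mem_filter]
      refine ⟨Finset.mem_univ _, ?_, t, ht⟩
      intro h; exact hzD (by rw [hD, Finset.mem_filter]; exact ⟨Finset.mem_univ _, h⟩)
    rw [this]; simp
  have hsum : ∑ z : V, ((if z ∈ K then l else 0) + (if z ∈ D then 2 else 0) + (if z ∈ G then 2 else 0)) =
      l * K.card + 2 * D.card + 2 * G.card := by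
    rw [Finset.sum_add_distrib, Finset.sum_add_distrib]
    simp only [Finset.sum_ite_mem, Finset.univ_inter, Finset.sum_const, smul_eq_mul]
    ring
  have htot : Q ≤ l * K.card + 2 * D.card + 2 * G.card := hdc.trans (hub.trans hsum.le)
  have hK2 : 32 * (l * K.card) ≤ Q := by
    refine le_trans ?_ hKc
    rw [sq, mul_assoc]; exact Nat.mul_le_mul_right _ hF
  have hD2 : 32 * D.card ≤ 2 * Q := (Nat.mul_le_mul_right _ hF).trans hDc
  omega

end


lemma indep_rows {K : Type*} [Field K] {a b : ℕ} (M : Matrix (Fin a) (Fin b) K) (hM : 5 ≤ M.rank) :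
    ∃ f : Fin 5 → Fin a, LinearIndependent K (M.submatrix f id).row := by
  rw [rank_eq_finrank_span_row] at hM
  obtain ⟨v, hv, _, hli⟩ := Submodule.exists_fun_fin_finrank_span_eq K (Set.range M.row)
  choose φ hφ using hv
  refine ⟨fun i => φ (Fin.castLE hM i), ?_⟩
  have h1 := hli.comp (Fin.castLE hM) (Fin.castLE_injective hM)
  have h2 : (M.submatrix (fun i => φ (Fin.castLE hM i)) id).row = v ∘ Fin.castLE hM := by
    ext i j
    exact congrFun (hφ _) j
  rw [h2]
  exact h1

lemma exists_minor {K : Type*} [Field K] {m : ℕ} (M : Matrix (Fin m) (Fin m) K) (hM : 5 ≤ M.rank) :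
    ∃ f g : Fin 5 → Fin m, (M.submatrix f g).det ≠ 0 := by
  obtain ⟨f, hf⟩ := indep_rows M hM
  have h1 := hf.rank_matrix
  rw [Fintype.card_fin, ← rank_transpose] at h1
  obtain ⟨g, hg⟩ := indep_rows (M.submatrix f id)ᵀ h1.ge
  refine ⟨f, g, ?_⟩
  rw [Matrix.linearIndependent_rows_iff_isUnit, Matrix.isUnit_iff_isUnit_det, isUnit_iff_ne_zero, ← det_transpose] at hg
  exact hg

section
variable {m h : ℕ}

/-- the two matrix families of the shapes (I) and (II) -/
def BB (o : Fin h) (A : Matrix (Fin m) (Fin m) ℤ) (i0 i1 : Fin m) (u v : Fin h → Fin m → ℤ) :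
    Fin h → Matrix (Fin m) (Fin m) ℤ :=
  fun k => (if k = o then A else 0) + vecMulVec (Pi.single i0 1) (u k) + vecMulVec (Pi.single i1 1) (v k)

/-- evaluation of a vector of linear forms -/
def ll {S : Type*} [CommRing S] (u : Fin h → Fin m → ℤ) (y : Fin h → S) : Fin m → S :=
  fun i => ∑ k, y k * (u k i : S)

variable (o : Fin h) (A : Matrix (Fin m) (Fin m) ℤ) (i0 i1 : Fin m) (u v : Fin h → Fin m → ℤ)

lemma AA_BB {S : Type*} [CommRing S] (y : Fin h → S) :
    AA (BB o A i0 i1 u v) y = y o • A.map (Int.castRingHom S) + vecMulVec (Pi.single i0 1) (ll u y) +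
      vecMulVec (Pi.single i1 1) (ll v y) := by
  have hs : ∀ i j : Fin m, (((Pi.single i (1 : ℤ) : Fin m → ℤ) j : ℤ) : S) = (Pi.single i (1 : S) : Fin m → S) j := by
    intro i j; by_cases hij : j = i
    · subst hij; simp
    · simp [hij]
  ext i j
  simp only [AA, BB, ll, Matrix.add_apply, vecMulVec_apply, Int.cast_add, Int.cast_mul, mul_add, Finset.sum_add_distrib,
    hs, Finset.mul_sum, Matrix.smul_apply, Matrix.map_apply, smul_eq_mul]
  congr 1
  · congr 1
    · rw [Finset.sum_eq_single o]
      · simp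
      · intro k _ hk; simp [hk]
      · simp
    · exact Finset.sum_congr rfl fun k _ => by ring
  · exact Finset.sum_congr rfl fun k _ => by ring

lemma aeval_eval {σ : Type*} (y : σ → ℤ) (p : MvPolynomial σ ℤ) : aeval y p = eval y p := by
  rw [aeval_def, eval, coe_eval₂Hom]
  congr 1

lemma eval_CP_BB (q : Fin m → MvPolynomial (Fin h) ℤ) (R : MvPolynomial (Fin h) ℤ) (z : Fin m ⊕ Fin h → ℤ) :
    eval z (CP (BB o A i0 i1 u v) q R) =
      z (Sum.inr o) * ∑ i, ∑ j, A i j * z (Sum.inl i) * z (Sum.inl j)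
      + z (Sum.inl i0) * ∑ i, ll u (fun k => z (Sum.inr k)) i * z (Sum.inl i)
      + z (Sum.inl i1) * ∑ i, ll v (fun k => z (Sum.inr k)) i * z (Sum.inl i)
      + ∑ i, z (Sum.inl i) * eval (fun k => z (Sum.inr k)) (q i) + eval (fun k => z (Sum.inr k)) R := by
  have h1 := aeval_CP (BB o A i0 i1 u v) q R z
  rw [← aeval_eval, h1, FF, QP, AA_BB]
  simp only [add_mulVec, dotProduct_add, vecMulVec_mulVec, smul_mulVec, dotProduct_smul]
  simp only [dotProduct_single_one, aeval_eval]
  congr 2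
  · congr 1
    · congr 1
      simp only [dotProduct, mulVec, Matrix.map_apply, eq_intCast, Int.cast_id, smul_eq_mul, Finset.mul_sum]
      exact Finset.sum_congr rfl fun i _ => Finset.sum_congr rfl fun j _ => by ring
  · exact Finset.sum_congr rfl fun i _ => by ring

end


section
variable {m h : ℕ}

lemma eval_map_aeval {σ K : Type*} [Field K] (z : σ → K) (p : MvPolynomial σ ℤ) :
    eval z (MvPolynomial.map (Int.castRingHom K) p) = aeval z p := by
  rw [eval_map, aeval_def]
  congr 1

open Classical in
theorem final (B : Fin h → Matrix (Fin m) (Fin m) ℤ) (q : Fin m → MvPolynomial (Fin h) ℤ)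
    (R : MvPolynomial (Fin h) ℤ) (o : Fin h) (hm : 1 ≤ m) (hq : ∀ j, (q j).IsHomogeneous 2)
    (hR : R.IsHomogeneous 3)
    (hrank : 5 ≤ Matrix.rank ((B o + (B o)ᵀ).map ((↑) : ℤ → ℚ)))
    (H2 : ∀ (K : Type) [Field K] (y : Fin h → K), y o = 0 → (GG B y).rank ≤ 2)
    (l0 : ℕ) (H3 : ∀ (l : ℕ) [Fact l.Prime], l0 ≤ l → l ^ (h - 1) ≤ 8 *
      (Finset.univ.filter fun z : {j : Fin h // j ≠ o} → ZMod l => Iso B (ext0 o 0 z)).card)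
    (H4 : ∃ k, k ≠ o ∧ B k + (B k)ᵀ ≠ 0)
    (Cpoly : MvPolynomial (Fin m ⊕ Fin h) ℤ) (hC : Cpoly = CP B q R)
    (hpadic : ∀ (p : ℕ) [Fact p.Prime], ∃ z : (Fin m ⊕ Fin h) → ℚ_[p],
      eval z (MvPolynomial.map (Int.castRingHom ℚ_[p]) Cpoly) = 0 ∧
      ∃ u, eval z (pderiv u (MvPolynomial.map (Int.castRingHom ℚ_[p]) Cpoly)) ≠ 0) :
    ∃ c > (0 : ℝ), ∃ K > (0 : ℝ), ∃ Y₀ : ℝ, ∀ Y : ℝ, Y₀ ≤ Y →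
      ∃ 𝒞 : Finset (Fin h → ℤ),
        (∀ y ∈ 𝒞, ∀ i, (|y i| : ℝ) ≤ K * Y) ∧
        c * Y ^ h / Real.log Y ≤
          ∑ y ∈ 𝒞, (singSeries m fun x => eval (Sum.elim x y) Cpoly).re := by
  subst hC
  obtain ⟨f, g, hfg⟩ := exists_minor _ hrank
  have hd : ((B o + (B o)ᵀ).submatrix f g).det ≠ 0 := by
    intro h0
    apply hfg
    have := (Int.castRingHom ℚ).map_det ((B o + (B o)ᵀ).submatrix f g)
    rw [h0, map_zero] at this
    rw [this]
    rfl
  have hloc : ∀ (p : ℕ) [Fact p.Prime], ∃ (x : Fin m → ℚ_[p]) (y : Fin h → ℚ_[p]) (i : Fin m),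
      FF B q R x y = 0 ∧ gX B q x y i ≠ 0 ∧ y o = 1 := by
    intro p _
    obtain ⟨z, h0, u, hu⟩ := hpadic p
    rw [eval_map_aeval] at h0
    rw [pderiv_map, eval_map_aeval] at hu
    exact local_data B q R o f g hd (H2 ℚ_[p]) H4 hq hR z h0 u hu
  obtain ⟨c, hc, K, hK, Y₀, hY⟩ := main_count B q R o hm hq hR f g hd H2 l0 H3 hloc
  refine ⟨c, hc, K, hK, Y₀, fun Y h1 => ?_⟩
  obtain ⟨𝒞, h2, h3⟩ := hY Y h1
  refine ⟨𝒞, h2, ?_⟩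
  have h4 : ∀ (x : Fin m → ℤ) (y : Fin h → ℤ), eval (Sum.elim x y) (CP B q R) = FF B q R x y := by
    intro x y
    rw [← aeval_eval, aeval_CP]
    rfl
  simp only [h4]
  exact h3

/-! ### shape data -/

variable (o : Fin h) (A : Matrix (Fin m) (Fin m) ℤ) (i0 i1 : Fin m)

lemma BB_o (u v : Fin h → Fin m → ℤ) (hu : u o = 0) (hv : v o = 0) : BB o A i0 i1 u v o = A := by
  ext i j
  simp [BB, hu, hv, vecMulVec_apply]

/-- coefficient vectors of shape (I), first row -/
def u1 (c₁ c₂ : Fin h → ℤ) : Fin h → Fin m → ℤ := fun k => Pi.single i0 (c₁ k) + Pi.single i1 (c₂ k)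
/-- coefficient vectors of shape (I), second row -/
def v1 (c₃ : Fin h → ℤ) : Fin h → Fin m → ℤ := fun k => Pi.single i1 (c₃ k)
/-- coefficient vectors of shape (II) -/
def u2 (t₂ : Fin h → ℤ) (t : Fin m → Fin h → ℤ) : Fin h → Fin m → ℤ :=
  fun k i => if i = i1 then t₂ k else if 2 ≤ i.val then t i k else 0

/-- evaluation of a linear form -/
def lf {S : Type*} [CommRing S] (c : Fin h → ℤ) (y : Fin h → S) : S := ∑ k, y k * (c k : S)

lemma ll_u1 {S : Type*} [CommRing S] (c₁ c₂ : Fin h → ℤ) (y : Fin h → S) :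
    ll (u1 i0 i1 c₁ c₂) y = Pi.single i0 (lf c₁ y) + Pi.single i1 (lf c₂ y) := by
  ext i
  simp only [ll, u1, lf, Pi.add_apply, Pi.single_apply, Int.cast_add, mul_add, Finset.sum_add_distrib]
  congr 1 <;> split_ifs <;> simp

lemma ll_v1 {S : Type*} [CommRing S] (c₃ : Fin h → ℤ) (y : Fin h → S) :
    ll (v1 i1 c₃) y = (Pi.single i1 (lf c₃ y) : Fin m → S) := by
  ext i
  simp only [ll, v1, lf, Pi.single_apply]
  split_ifs <;> simp

lemma ll_u2 {S : Type*} [CommRing S] (t₂ : Fin h → ℤ) (t : Fin m → Fin h → ℤ) (y : Fin h → S) (i : Fin m) :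
    ll (u2 i1 t₂ t) y i = if i = i1 then lf t₂ y else if 2 ≤ i.val then lf (t i) y else 0 := by
  simp only [ll, u2, lf]
  split_ifs <;> simp

lemma ll_zero {S : Type*} [CommRing S] (y : Fin h → S) : ll (0 : Fin h → Fin m → ℤ) y = 0 := by
  ext i; simp [ll]

lemma H2_one (c₁ c₂ c₃ : Fin h → ℤ) (K : Type) [Field K] (y : Fin h → K) (hy : y o = 0) :
    (GG (BB o A i0 i1 (u1 i0 i1 c₁ c₂) (v1 i1 c₃)) y).rank ≤ 2 := by
  have : GG (BB o A i0 i1 (u1 i0 i1 c₁ c₂) (v1 i1 c₃)) y =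
      vecMulVec (Pi.single i0 1) (Pi.single i0 (2 * lf c₁ y) + Pi.single i1 (lf c₂ y)) +
      vecMulVec (Pi.single i1 1) (Pi.single i0 (lf c₂ y) + Pi.single i1 (2 * lf c₃ y)) := by
    rw [GG, AA_BB, hy, ll_u1, ll_v1]
    ext i j
    simp only [Matrix.add_apply, Matrix.transpose_apply, vecMulVec_apply, Pi.add_apply, Pi.single_apply, zero_smul,
      Matrix.zero_apply]
    split_ifs <;> ring
  rw [this]
  refine (rank_add_le' _ _).trans ?_
  have h1 := Matrix.rank_vecMulVec_le (Pi.single i0 (1 : K)) (Pi.single i0 (2 * lf c₁ y) + Pi.single i1 (lf c₂ y))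
  have h2 := Matrix.rank_vecMulVec_le (Pi.single i1 (1 : K)) (Pi.single i0 (lf c₂ y) + Pi.single i1 (2 * lf c₃ y))
  omega

lemma H2_two (u : Fin h → Fin m → ℤ) (K : Type) [Field K] (y : Fin h → K) (hy : y o = 0) :
    (GG (BB o A i0 i1 u 0) y).rank ≤ 2 := by
  have : GG (BB o A i0 i1 u 0) y =
      vecMulVec (Pi.single i0 1) (ll u y) + vecMulVec (ll u y) (Pi.single i0 1) := by
    rw [GG, AA_BB, hy, ll_zero]
    ext i j
    simp only [Matrix.add_apply, Matrix.transpose_apply, vecMulVec_apply, zero_smul,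
      Matrix.zero_apply, Pi.zero_apply]
    ring
  rw [this]
  refine (rank_add_le' _ _).trans ?_
  have h1 := Matrix.rank_vecMulVec_le (Pi.single i0 (1 : K)) (ll u y)
  have h2 := Matrix.rank_vecMulVec_le (ll u y) (Pi.single i0 (1 : K))
  omega

lemma CP_one (c₁ c₂ c₃ : Fin h → ℤ) (q : Fin m → MvPolynomial (Fin h) ℤ) (R : MvPolynomial (Fin h) ℤ) :
    (X (Sum.inr o) * rename Sum.inl (∑ i, ∑ j, C (A i j) * X i * X j)
          + (∑ j, C (c₁ j) * X (Sum.inr j)) * X (Sum.inl i0) ^ 2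
          + (∑ j, C (c₂ j) * X (Sum.inr j)) * X (Sum.inl i0) * X (Sum.inl i1)
          + (∑ j, C (c₃ j) * X (Sum.inr j)) * X (Sum.inl i1) ^ 2
          + ∑ i, X (Sum.inl i) * rename Sum.inr (q i) + rename Sum.inr R : MvPolynomial (Fin m ⊕ Fin h) ℤ) =
    CP (BB o A i0 i1 (u1 i0 i1 c₁ c₂) (v1 i1 c₃)) q R := by
  apply MvPolynomial.funext
  intro z
  rw [eval_CP_BB, ll_u1, ll_v1]
  have hr : ∀ p : MvPolynomial (Fin h) ℤ, eval z (rename Sum.inr p) = eval (fun k => z (Sum.inr k)) p := by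
    intro p; rw [eval_rename]; rfl
  have hr2 : ∀ p : MvPolynomial (Fin m) ℤ, eval z (rename Sum.inl p) = eval (fun k => z (Sum.inl k)) p := by
    intro p; rw [eval_rename]; rfl
  have hl : ∀ c : Fin h → ℤ, ∑ j, c j * z (Sum.inr j) = lf c (fun k => z (Sum.inr k)) := by
    intro c; exact Finset.sum_congr rfl fun j _ => by simp [mul_comm]
  simp only [map_add, map_mul, map_sum, map_pow, eval_X, eval_C, hr, hr2, hl]
  simp only [Pi.add_apply, Pi.single_apply, add_mul, Finset.sum_add_distrib, ite_mul, zero_mul, Finset.sum_ite_eq',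
    Finset.mem_univ, if_true]
  ring

lemma CP_two (h1 : i1.val = 1) (t₂ : Fin h → ℤ) (t : Fin m → Fin h → ℤ)
    (q : Fin m → MvPolynomial (Fin h) ℤ) (R : MvPolynomial (Fin h) ℤ) :
    (X (Sum.inr o) * rename Sum.inl (∑ i, ∑ j, C (A i j) * X i * X j)
          + (∑ j, C (t₂ j) * X (Sum.inr j)) * X (Sum.inl i0) * X (Sum.inl i1)
          + X (Sum.inl i0) * (∑ i ∈ Finset.univ.filter fun i : Fin m => 2 ≤ i.val,
                (∑ j, C (t i j) * X (Sum.inr j)) * X (Sum.inl i))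
          + ∑ i, X (Sum.inl i) * rename Sum.inr (q i) + rename Sum.inr R : MvPolynomial (Fin m ⊕ Fin h) ℤ) =
    CP (BB o A i0 i1 (u2 i1 t₂ t) 0) q R := by
  apply MvPolynomial.funext
  intro z
  rw [eval_CP_BB, ll_zero]
  have hr : ∀ p : MvPolynomial (Fin h) ℤ, eval z (rename Sum.inr p) = eval (fun k => z (Sum.inr k)) p := by
    intro p; rw [eval_rename]; rfl
  have hr2 : ∀ p : MvPolynomial (Fin m) ℤ, eval z (rename Sum.inl p) = eval (fun k => z (Sum.inl k)) p := by
    intro p; rw [eval_rename]; rfl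
  have hl : ∀ c : Fin h → ℤ, ∑ j, c j * z (Sum.inr j) = lf c (fun k => z (Sum.inr k)) := by
    intro c; exact Finset.sum_congr rfl fun j _ => by simp [mul_comm]
  simp only [map_add, map_mul, map_sum, eval_X, eval_C, hr, hr2, hl, ll_u2]
  have hs : ∑ i : Fin m, (if i = i1 then lf t₂ (fun k => z (Sum.inr k)) else if 2 ≤ i.val then
        lf (t i) (fun k => z (Sum.inr k)) else 0) * z (Sum.inl i) =
      lf t₂ (fun k => z (Sum.inr k)) * z (Sum.inl i1) +
      ∑ i ∈ Finset.univ.filter (fun i : Fin m => 2 ≤ i.val), lf (t i) (fun k => z (Sum.inr k)) * z (Sum.inl i) := by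
    have : ∀ i : Fin m, (if i = i1 then lf t₂ (fun k => z (Sum.inr k)) else if 2 ≤ i.val then
        lf (t i) (fun k => z (Sum.inr k)) else 0) * z (Sum.inl i) =
        (if i = i1 then lf t₂ (fun k => z (Sum.inr k)) * z (Sum.inl i) else 0) +
        (if 2 ≤ i.val then lf (t i) (fun k => z (Sum.inr k)) * z (Sum.inl i) else 0) := by
      intro i
      by_cases hi : i = i1
      · subst hi; simp [h1]
      · simp [hi]
    rw [Finset.sum_congr rfl fun i _ => this i, Finset.sum_add_distrib, Finset.sum_filter]
    simp
  rw [hs]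
  simp only [Pi.zero_apply, zero_mul, Finset.sum_const_zero, mul_zero]
  ring

end


section
variable {m h : ℕ} (o : Fin h) (A : Matrix (Fin m) (Fin m) ℤ) (i0 i1 : Fin m)

lemma cast_ne_zero_of_lt {l : ℕ} (a : ℤ) (ha : a ≠ 0) (hl : a.natAbs < l) : (a : ZMod l) ≠ 0 := by
  intro h0
  rw [ZMod.intCast_zmod_eq_zero_iff_dvd] at h0
  have := Nat.le_of_dvd (Int.natAbs_pos.mpr ha) (Int.natCast_dvd.mp h0)
  omega

/-- the linear form on the coordinates different from `o` -/
def linz {S : Type*} [CommRing S] (c : Fin h → ℤ) : ({j : Fin h // j ≠ o} → S) →ₗ[S] S where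
  toFun z := lf c (ext0 o 0 z)
  map_add' a b := by
    simp only [lf, ← Finset.sum_add_distrib]
    refine Finset.sum_congr rfl fun k _ => ?_
    by_cases hk : k = o <;> simp [ext0, hk, add_mul]
  map_smul' s a := by
    simp only [lf, RingHom.id_apply, smul_eq_mul, Finset.mul_sum, ext0_smul, Pi.smul_apply, mul_assoc]

lemma linz_apply {S : Type*} [CommRing S] (c : Fin h → ℤ) (z : {j : Fin h // j ≠ o} → S) :
    linz o c z = lf c (ext0 o 0 z) := rfl

lemma linz_single {S : Type*} [CommRing S] (c : Fin h → ℤ) (j : {j : Fin h // j ≠ o}) :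
    linz o c (Pi.single j (1 : S)) = (c j : S) := by
  rw [linz_apply, lf, Finset.sum_eq_single j.1]
  · rw [ext0_ne o _ _ j.1 j.2]; simp
  · intro k _ hk
    by_cases hko : k = o
    · simp [ext0, hko]
    · rw [ext0_ne o _ _ k hko, Pi.single_eq_of_ne, zero_mul]
      intro h1; exact hk (congrArg Subtype.val h1)
  · simp

lemma cardV {l : ℕ} [Fact l.Prime] : Fintype.card ({j : Fin h // j ≠ o} → ZMod l) = l ^ (h - 1) := by
  simp [ZMod.card]

open Classical in
lemma H3_two (h01 : i0 ≠ i1) (t₂ : Fin h → ℤ) (t : Fin m → Fin h → ℤ) (k : Fin h) (hk : k ≠ o) (hk2 : t₂ k ≠ 0)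
    (l : ℕ) [Fact l.Prime] (hl : (t₂ k).natAbs + 2 ≤ l) : l ^ (h - 1) ≤ 8 *
      (Finset.univ.filter fun z : {j : Fin h // j ≠ o} → ZMod l =>
        Iso (BB o A i0 i1 (u2 i1 t₂ t) 0) (ext0 o 0 z)).card := by
  have h1 : linz o t₂ (Pi.single ⟨k, hk⟩ (1 : ZMod l)) ≠ 0 := by
    rw [linz_single]
    exact cast_ne_zero_of_lt (t₂ k) hk2 (by omega)
  have h2 := ker_le (linz o t₂ (S := ZMod l)) (Pi.single ⟨k, hk⟩ (1 : ZMod l)) h1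
  rw [cardV, ZMod.card] at h2
  have h3 : (Finset.univ.filter fun z : {j : Fin h // j ≠ o} → ZMod l => ¬ linz o t₂ z = 0).card ≤
      (Finset.univ.filter fun z : {j : Fin h // j ≠ o} → ZMod l =>
        Iso (BB o A i0 i1 (u2 i1 t₂ t) 0) (ext0 o 0 z)).card := by
    apply Finset.card_le_card
    intro z hz
    simp only [Finset.mem_filter, Finset.mem_univ, true_and] at hz ⊢
    refine ⟨Pi.single i1 1, ?_, ?_⟩
    · rw [AA_BB, ext0_o, ll_zero]
      simp [add_mulVec, vecMulVec_apply, mulVec_single_one, h01.symm]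
    · intro h4
      apply hz
      have h5 := congrFun h4 i0
      rw [GG, AA_BB, ext0_o, ll_zero] at h5
      simpa [add_mulVec, mulVec_single_one, vecMulVec_apply, ll_u2, h01.symm, h01, linz_apply] using h5
  have h4 := Finset.card_filter_add_card_filter_not (s := Finset.univ) (fun z : {j : Fin h // j ≠ o} → ZMod l => linz o t₂ z = 0)
  rw [Finset.card_univ, cardV] at h4
  have h5 : 2 * (Finset.univ.filter fun z : {j : Fin h // j ≠ o} → ZMod l => linz o t₂ z = 0).card ≤ l ^ (h - 1) :=
    (Nat.mul_le_mul_right _ (by omega : 2 ≤ l)).trans h2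
  omega

lemma H4_two (h01 : i0 ≠ i1) (t₂ : Fin h → ℤ) (t : Fin m → Fin h → ℤ) (k : Fin h) (hk : k ≠ o) (hk2 : t₂ k ≠ 0) :
    BB o A i0 i1 (u2 i1 t₂ t) 0 k + (BB o A i0 i1 (u2 i1 t₂ t) 0 k)ᵀ ≠ 0 := by
  intro h0
  have := congrFun (congrFun h0 i0) i1
  simp [BB, hk, vecMulVec_apply, u2, h01, h01.symm] at this
  exact hk2 this

lemma H4_one (h01 : i0 ≠ i1) (c₁ c₂ c₃ : Fin h → ℤ) (k : Fin h) (hk : k ≠ o) (hk2 : c₁ k ≠ 0 ∨ c₂ k ≠ 0 ∨ c₃ k ≠ 0) :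
    BB o A i0 i1 (u1 i0 i1 c₁ c₂) (v1 i1 c₃) k + (BB o A i0 i1 (u1 i0 i1 c₁ c₂) (v1 i1 c₃) k)ᵀ ≠ 0 := by
  intro h0
  have e1 := congrFun (congrFun h0 i0) i1
  have e2 := congrFun (congrFun h0 i0) i0
  have e3 := congrFun (congrFun h0 i1) i1
  simp [BB, hk, vecMulVec_apply, u1, v1, h01, h01.symm] at e1 e2 e3
  omega

open Classical in
lemma H3_one (h01 : i0 ≠ i1) (c₁ c₂ c₃ : Fin h → ℤ) (y : {j : Fin h // j ≠ o} → ℤ)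
    (hy : 4 * linz o c₁ y * linz o c₃ y - linz o c₂ y ^ 2 ≠ 0)
    (j1 j2 : {j : Fin h // j ≠ o})
    (d1 d2 : Fin h → ℤ) (hd1 : d1 = c₁ ∨ d1 = c₂ ∨ d1 = c₃) (hd2 : d2 = c₁ ∨ d2 = c₂ ∨ d2 = c₃)
    (hmin : d1 j1 * d2 j2 - d1 j2 * d2 j1 ≠ 0)
    (l : ℕ) [Fact l.Prime]
    (hl : (4 * linz o c₁ y * linz o c₃ y - linz o c₂ y ^ 2).natAbs + (d1 j1 * d2 j2 - d1 j2 * d2 j1).natAbs + 32 ≤ l) :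
    l ^ (h - 1) ≤ 8 *
      (Finset.univ.filter fun z : {j : Fin h // j ≠ o} → ZMod l =>
        Iso (BB o A i0 i1 (u1 i0 i1 c₁ c₂) (v1 i1 c₃)) (ext0 o 0 z)).card := by
  have hcast : ∀ c : Fin h → ℤ, linz o c (fun j => (y j : ZMod l)) = ((linz o c y : ℤ) : ZMod l) := by
    intro c
    have := ext0_map o (Int.cast : ℤ → ZMod l) 0 y
    rw [linz_apply, linz_apply, lf, lf, Int.cast_sum]
    refine Finset.sum_congr rfl fun k _ => ?_
    have := congrFun this k
    simp only [Int.cast_zero] at this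
    rw [Int.cast_mul, this]; simp
  have hm1 := cast_ne_zero_of_lt (l := l) _ hmin (by omega)
  have key := h3_abs (linz o c₁ (S := ZMod l)) (linz o c₂) (linz o c₃) (by rw [ZMod.card]; omega)
    (fun j => (y j : ZMod l)) (by
      rw [hcast, hcast, hcast]
      have := cast_ne_zero_of_lt (l := l) _ hy (by omega)
      push_cast at this
      exact this) (Pi.single j1 1) (Pi.single j2 1) (by
      intro s t e1 e2 e3
      simp only [map_add, map_smul, linz_single, smul_eq_mul] at e1 e2 e3
      have f1 : s * (d1 j1 : ZMod l) + t * (d1 j2 : ZMod l) = 0 := by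
        rcases hd1 with h | h | h <;> rw [h] <;> assumption
      have f2 : s * (d2 j1 : ZMod l) + t * (d2 j2 : ZMod l) = 0 := by
        rcases hd2 with h | h | h <;> rw [h] <;> assumption
      push_cast at hm1
      constructor
      · refine (mul_eq_zero.mp (?_ : s * ((d1 j1 : ZMod l) * d2 j2 - d1 j2 * d2 j1) = 0)).resolve_right hm1
        linear_combination (d2 j2 : ZMod l) * f1 - (d1 j2 : ZMod l) * f2
      · refine (mul_eq_zero.mp (?_ : t * ((d1 j1 : ZMod l) * d2 j2 - d1 j2 * d2 j1) = 0)).resolve_right hm1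
        linear_combination (d1 j1 : ZMod l) * f2 - (d2 j1 : ZMod l) * f1)
  rw [cardV] at key
  refine key.trans (Nat.mul_le_mul_left _ (Finset.card_le_card ?_))
  intro z hz
  simp only [Finset.mem_filter, Finset.mem_univ, true_and] at hz ⊢
  obtain ⟨hdisc, t, ht⟩ := hz
  simp only [linz_apply] at hdisc ht
  refine ⟨Pi.single i0 1 + Pi.single i1 t, ?_, ?_⟩
  · rw [AA_BB, ext0_o, ll_u1, ll_v1]
    simp only [zero_smul, zero_add, add_mulVec, vecMulVec_mulVec, dotProduct_add, add_dotProduct]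
    simp [h01, h01.symm]
    linear_combination ht
  · intro h4
    apply hdisc
    have e0 := congrFun h4 i0
    have e1 := congrFun h4 i1
    rw [GG, AA_BB, ext0_o, ll_u1, ll_v1] at e0 e1
    simp [add_mulVec, vecMulVec_mulVec, mulVec_add, transpose_vecMulVec, h01, h01.symm] at e0 e1
    simp [vecMulVec_apply, h01, h01.symm] at e0 e1
    linear_combination 2 * lf c₃ (ext0 o 0 z) * e0 - lf c₂ (ext0 o 0 z) * e1

end


section
variable {m h : ℕ} (o : Fin h)

lemma lf_restrict (c : Fin h → ℤ) (hc : c o = 0) (y : Fin h → ℤ) :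
    linz o c (fun j => y j.1) = lf c y := by
  rw [linz_apply]
  refine Finset.sum_congr rfl fun k _ => ?_
  by_cases hk : k = o
  · subst hk; simp [hc]
  · rw [ext0_ne o _ _ k hk]

lemma disc_point (c₁ c₂ c₃ : Fin h → ℤ) (h1 : c₁ o = 0) (h2 : c₂ o = 0) (h3 : c₃ o = 0)
    (hdisc : (4 * (∑ j, C (c₁ j) * X j) * (∑ j, C (c₃ j) * X j)
          - (∑ j, C (c₂ j) * X j) ^ 2 : MvPolynomial (Fin h) ℤ) ≠ 0) :
    ∃ y : {j : Fin h // j ≠ o} → ℤ, 4 * linz o c₁ y * linz o c₃ y - linz o c₂ y ^ 2 ≠ 0 := by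
  by_contra hcon
  push Not at hcon
  apply hdisc
  apply MvPolynomial.funext
  intro y
  have := hcon (fun j => y j.1)
  rw [lf_restrict o c₁ h1, lf_restrict o c₂ h2, lf_restrict o c₃ h3] at this
  have hl : ∀ c : Fin h → ℤ, ∑ j, c j * y j = lf c y := by
    intro c; exact Finset.sum_congr rfl fun j _ => by simp [mul_comm]
  simp only [map_sub, map_mul, map_sum, map_pow, eval_X, eval_C, hl, map_zero, map_ofNat]
  exact this

lemma exists_coef (c₁ c₂ c₃ : Fin h → ℤ) (y : {j : Fin h // j ≠ o} → ℤ)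
    (hy : 4 * linz o c₁ y * linz o c₃ y - linz o c₂ y ^ 2 ≠ 0) :
    ∃ k, k ≠ o ∧ (c₁ k ≠ 0 ∨ c₂ k ≠ 0 ∨ c₃ k ≠ 0) := by
  by_contra hcon
  push Not at hcon
  have h0 : ∀ c : Fin h → ℤ, (∀ k, k ≠ o → c k = 0) → linz o c y = 0 := by
    intro c hc
    rw [linz_apply]
    refine Finset.sum_eq_zero fun k _ => ?_
    by_cases hk : k = o
    · subst hk; simp [ext0_o]
    · simp [hc k hk]
  apply hy
  rw [h0 c₁ fun k hk => (hcon k hk).1, h0 c₂ fun k hk => (hcon k hk).2.1]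
  ring

lemma exists_minor2 (c₁ c₂ c₃ : Fin h → ℤ) (h1 : c₁ o = 0) (h2 : c₂ o = 0) (h3 : c₃ o = 0)
    (k : Fin h) (hk : c₁ k ≠ 0 ∨ c₂ k ≠ 0 ∨ c₃ k ≠ 0)
    (hspan : Module.finrank ℚ (Submodule.span ℚ
          ({fun j => (c₁ j : ℚ), fun j => (c₂ j : ℚ), fun j => (c₃ j : ℚ)} :
            Set (Fin h → ℚ))) ≠ 1) :
    ∃ (j1 j2 : {j : Fin h // j ≠ o}) (d1 d2 : Fin h → ℤ), (d1 = c₁ ∨ d1 = c₂ ∨ d1 = c₃) ∧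
      (d2 = c₁ ∨ d2 = c₂ ∨ d2 = c₃) ∧ d1 j1 * d2 j2 - d1 j2 * d2 j1 ≠ 0 := by
  by_contra hcon
  push Not at hcon
  apply hspan
  obtain ⟨d, hd, hdk⟩ : ∃ d : Fin h → ℤ, (d = c₁ ∨ d = c₂ ∨ d = c₃) ∧ d k ≠ 0 := by
    rcases hk with h | h | h
    · exact ⟨c₁, by simp, h⟩
    · exact ⟨c₂, by simp, h⟩
    · exact ⟨c₃, by simp, h⟩
  have hz : ∀ e : Fin h → ℤ, (e = c₁ ∨ e = c₂ ∨ e = c₃) → e o = 0 := by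
    rintro e (rfl | rfl | rfl) <;> assumption
  have hko : k ≠ o := by rintro rfl; exact hdk (hz d hd)
  have hdk' : (d k : ℚ) ≠ 0 := by exact_mod_cast hdk
  have hprop : ∀ e : Fin h → ℤ, (e = c₁ ∨ e = c₂ ∨ e = c₃) → (fun j => (e j : ℚ)) ∈
      Submodule.span ℚ ({fun j => (d j : ℚ)} : Set (Fin h → ℚ)) := by
    intro e he
    rw [Submodule.mem_span_singleton]
    refine ⟨(e k : ℚ) / d k, ?_⟩
    ext j
    simp only [Pi.smul_apply, smul_eq_mul]
    rw [div_mul_eq_mul_div, div_eq_iff hdk']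
    by_cases hj : j = o
    · subst hj; simp [hz d hd, hz e he]
    · have := hcon ⟨k, hko⟩ ⟨j, hj⟩ e d he hd
      simp only at this
      have h5 : e k * d j = e j * d k := by linarith
      exact_mod_cast h5
  have heq : Submodule.span ℚ ({fun j => (c₁ j : ℚ), fun j => (c₂ j : ℚ), fun j => (c₃ j : ℚ)} : Set (Fin h → ℚ)) =
      Submodule.span ℚ ({fun j => (d j : ℚ)} : Set (Fin h → ℚ)) := by
    apply le_antisymm
    · rw [Submodule.span_le]
      rintro _ (rfl | rfl | rfl)
      · exact hprop c₁ (by simp)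
      · exact hprop c₂ (by simp)
      · exact hprop c₃ (by simp)
    · apply Submodule.span_mono
      rw [Set.singleton_subset_iff]
      rcases hd with rfl | rfl | rfl <;> simp
  rw [heq]
  apply finrank_span_singleton
  intro h0
  exact hdk' (congrFun h0 k)

end


/-- For `C` of one of the two shapes (I), (II) (rank-two `z`-part of the
pencil), irreducible with nonsingular `p`-adic zeros for all `p`, one has
`Σ_{y ∈ 𝒞_h(Y)} 𝔖(F_y) ≫ Y^h / log Y`. Linear forms in `z = (y₂,…,y_h)` are encoded via
their integer coefficient vectors, vanishing at index `0`. -/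
theorem stmt12 (n h m : ℕ) (hh : 0 < h) (hhn : h < n) (hm : m = n - h) (hm2 : 1 < m)
    (A₁ : Matrix (Fin m) (Fin m) ℤ) (r : ℕ) (hr5 : 5 ≤ r)
    (hrank : Matrix.rank ((A₁ + A₁ᵀ).map ((↑) : ℤ → ℚ)) = r)
    (hindef : (∃ u : Fin m → ℝ, 0 < u ⬝ᵥ (A₁.map ((↑) : ℤ → ℝ)).mulVec u) ∧
      (∃ u : Fin m → ℝ, u ⬝ᵥ (A₁.map ((↑) : ℤ → ℝ)).mulVec u < 0))
    (q : Fin m → MvPolynomial (Fin h) ℤ) (hq : ∀ j, (q j).IsHomogeneous 2)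
    (R : MvPolynomial (Fin h) ℤ) (hR : R.IsHomogeneous 3)
    (Cpoly : MvPolynomial (Fin m ⊕ Fin h) ℤ)
    (hshape :
      -- shape (I)
      (∃ c₁ c₂ c₃ : Fin h → ℤ,
        c₁ ⟨0, hh⟩ = 0 ∧ c₂ ⟨0, hh⟩ = 0 ∧ c₃ ⟨0, hh⟩ = 0 ∧
        (4 * (∑ j, C (c₁ j) * X j) * (∑ j, C (c₃ j) * X j)
          - (∑ j, C (c₂ j) * X j) ^ 2 : MvPolynomial (Fin h) ℤ) ≠ 0 ∧
        Module.finrank ℚ (Submodule.span ℚ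
          ({fun j => (c₁ j : ℚ), fun j => (c₂ j : ℚ), fun j => (c₃ j : ℚ)} :
            Set (Fin h → ℚ))) ≠ 1 ∧
        Cpoly = X (Sum.inr ⟨0, hh⟩) * rename Sum.inl (∑ i, ∑ j, C (A₁ i j) * X i * X j)
          + (∑ j, C (c₁ j) * X (Sum.inr j)) *
              X (Sum.inl ⟨0, Nat.lt_trans Nat.zero_lt_one hm2⟩) ^ 2
          + (∑ j, C (c₂ j) * X (Sum.inr j)) *
              X (Sum.inl ⟨0, Nat.lt_trans Nat.zero_lt_one hm2⟩) * X (Sum.inl ⟨1, hm2⟩)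
          + (∑ j, C (c₃ j) * X (Sum.inr j)) * X (Sum.inl ⟨1, hm2⟩) ^ 2
          + ∑ i, X (Sum.inl i) * rename Sum.inr (q i) + rename Sum.inr R) ∨
      -- shape (II)
      (∃ (t₂ : Fin h → ℤ) (t : Fin m → Fin h → ℤ),
        t₂ ⟨0, hh⟩ = 0 ∧ t₂ ≠ 0 ∧ (∀ i, t i ⟨0, hh⟩ = 0) ∧
        Cpoly = X (Sum.inr ⟨0, hh⟩) * rename Sum.inl (∑ i, ∑ j, C (A₁ i j) * X i * X j)
          + (∑ j, C (t₂ j) * X (Sum.inr j)) *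
              X (Sum.inl ⟨0, Nat.lt_trans Nat.zero_lt_one hm2⟩) * X (Sum.inl ⟨1, hm2⟩)
          + X (Sum.inl ⟨0, Nat.lt_trans Nat.zero_lt_one hm2⟩) *
              (∑ i ∈ Finset.univ.filter fun i : Fin m => 2 ≤ i.val,
                (∑ j, C (t i j) * X (Sum.inr j)) * X (Sum.inl i))
          + ∑ i, X (Sum.inl i) * rename Sum.inr (q i) + rename Sum.inr R))
    (hirr : Irreducible (MvPolynomial.map (Int.castRingHom ℚ) Cpoly))
    (hpadic : ∀ (p : ℕ) [Fact p.Prime], ∃ z : (Fin m ⊕ Fin h) → ℚ_[p],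
      eval z (MvPolynomial.map (Int.castRingHom ℚ_[p]) Cpoly) = 0 ∧
      ∃ u, eval z (pderiv u (MvPolynomial.map (Int.castRingHom ℚ_[p]) Cpoly)) ≠ 0) :
    ∃ c > (0 : ℝ), ∃ K > (0 : ℝ), ∃ Y₀ : ℝ, ∀ Y : ℝ, Y₀ ≤ Y →
      ∃ 𝒞 : Finset (Fin h → ℤ),
        (∀ y ∈ 𝒞, ∀ i, (|y i| : ℝ) ≤ K * Y) ∧
        c * Y ^ h / Real.log Y ≤
          ∑ y ∈ 𝒞, (singSeries m fun x => eval (Sum.elim x y) Cpoly).re := by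
  classical
  have h01 : (⟨0, Nat.lt_trans Nat.zero_lt_one hm2⟩ : Fin m) ≠ ⟨1, hm2⟩ := by simp
  rcases hshape with ⟨c₁, c₂, c₃, e1, e2, e3, hdisc, hspan, hC⟩ | ⟨t₂, t, e1, ht2, e2, hC⟩
  · obtain ⟨y, hy⟩ := disc_point ⟨0, hh⟩ c₁ c₂ c₃ e1 e2 e3 hdisc
    obtain ⟨k, hko, hk⟩ := exists_coef ⟨0, hh⟩ c₁ c₂ c₃ y hy
    obtain ⟨j1, j2, d1, d2, hd1, hd2, hmin⟩ := exists_minor2 ⟨0, hh⟩ c₁ c₂ c₃ e1 e2 e3 k hk hspan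
    rw [CP_one] at hC
    refine final _ q R ⟨0, hh⟩ (by omega) hq hR ?_ (H2_one _ _ _ _ _ _ _) _
      (fun l _ hl => H3_one _ _ _ _ h01 c₁ c₂ c₃ y hy j1 j2 d1 d2 hd1 hd2 hmin l hl)
      ⟨k, hko, H4_one _ _ _ _ h01 _ _ _ k hko hk⟩ Cpoly hC hpadic
    rw [BB_o _ _ _ _ _ _ (by ext i; simp [u1, e1, e2]) (by ext i; simp [v1, e3]), hrank]
    exact hr5
  · obtain ⟨k, hk⟩ := Function.ne_iff.mp ht2
    rw [Pi.zero_apply] at hk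
    have hko : k ≠ ⟨0, hh⟩ := by rintro rfl; exact hk e1
    rw [CP_two _ _ _ _ rfl] at hC
    refine final _ q R ⟨0, hh⟩ (by omega) hq hR ?_ (H2_two _ _ _ _ _) _
      (fun l _ hl => H3_two _ _ _ _ h01 t₂ t k hko hk l hl)
      ⟨k, hko, H4_two _ _ _ _ h01 _ _ k hko hk⟩ Cpoly hC hpadic
    rw [BB_o _ _ _ _ _ _ (by ext i; simp [u2, e1, e2]) rfl, hrank]
    exact hr5
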